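/- arXiv:2112.06156 — 2 statements merged into one kernel-verified Lean document; each statement's English description precedes it below -/
import Mathlib

section
/- Let k ≥ 4 be a fixed integer and let μ_k be the indicator function of the k-free numbers. Then ∑_{n ≤ x} μ_k(⌊x/n⌋) = C_k · x + O(x^{1/3} log x) as x → ∞, where C_k = ∑_{n=1}^∞ μ_k(n)/(n(n+1)). -/
open Finset Filter Asymptotics

/-- `muk k n` is the indicator of the `k`-free numbers: `muk k n = 1` if no `k`-th power of
a prime divides `n`, and `muk k n = 0` otherwise. -/
noncomputable def muk (k n : ℕ) : ℝ :=
  letI := Classical.dec (∀ p : ℕ, p.Prime → ¬ p ^ k ∣ n)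
  if ∀ p : ℕ, p.Prime → ¬ p ^ k ∣ n then 1 else 0

/-- The additive character `e(t) = exp(2πit)`. -/
noncomputable def expTwoPi (t : ℝ) : ℂ := Complex.exp ((2 * Real.pi * t : ℝ) * Complex.I)

lemma norm_expTwoPi (t : ℝ) : ‖expTwoPi t‖ = 1 := Complex.norm_exp_ofReal_mul_I _

lemma expTwoPi_add (s t : ℝ) : expTwoPi (s + t) = expTwoPi s * expTwoPi t := by
  unfold expTwoPi
  rw [← Complex.exp_add]
  congr 1
  push_cast
  ring

lemma expTwoPi_intCast (j : ℤ) : expTwoPi j = 1 := by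
  unfold expTwoPi
  rw [Complex.exp_eq_one_iff]
  exact ⟨j, by push_cast; ring⟩

lemma expTwoPi_re (t : ℝ) : (expTwoPi t).re = Real.cos (2 * Real.pi * t) :=
  Complex.exp_ofReal_mul_I_re _

lemma norm_expTwoPi_sub_one_le (t : ℝ) :
    ‖expTwoPi t - 1‖ ≤ 2 * Real.pi * min 1 |t| := by
  have hpi := Real.pi_gt_three
  rw [mul_min_of_nonneg _ _ (by positivity)]
  refine le_min ?_ ?_
  · calc ‖expTwoPi t - 1‖ ≤ ‖expTwoPi t‖ + ‖(1 : ℂ)‖ := norm_sub_le _ _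
      _ ≤ 2 * Real.pi * 1 := by rw [norm_expTwoPi, norm_one]; linarith
  · have h := Real.norm_exp_I_mul_ofReal_sub_one_le (x := 2 * Real.pi * t)
    rw [Real.norm_eq_abs, abs_mul, abs_of_pos (by positivity : 0 < 2 * Real.pi)] at h
    unfold expTwoPi
    rwa [mul_comm Complex.I] at h

/-- The periodic second Bernoulli function divided by two, a primitive of `fract - 1/2`. -/
noncomputable def bernoulliPrimitive (u : ℝ) : ℝ := (Int.fract u ^ 2 - Int.fract u + 1 / 6) / 2

lemma bernoulliPrimitive_le (u v : ℝ) :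
    bernoulliPrimitive v ≤
      bernoulliPrimitive u + (v - u) * (Int.fract u - 1 / 2) + (v - u) ^ 2 / 2 := by
  unfold bernoulliPrimitive
  have hu := Int.floor_add_fract u
  have hv := Int.floor_add_fract v
  have hb0 := Int.fract_nonneg v
  have hb1 := Int.fract_lt_one v
  set a := Int.fract u
  set b := Int.fract v
  have key : 0 ≤ ((⌊v⌋ - ⌊u⌋ : ℤ) : ℝ) * (((⌊v⌋ - ⌊u⌋ : ℤ) : ℝ) - 1 + 2 * b) := by
    rcases lt_or_ge 0 (⌊v⌋ - ⌊u⌋) with h | h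
    · have h1 : (1 : ℝ) ≤ ((⌊v⌋ - ⌊u⌋ : ℤ) : ℝ) := by exact_mod_cast h
      apply mul_nonneg <;> linarith
    · rcases h.lt_or_eq with h | h
      · have h1 : ((⌊v⌋ - ⌊u⌋ : ℤ) : ℝ) ≤ -1 := by
          have : ⌊v⌋ - ⌊u⌋ ≤ -1 := by omega
          exact_mod_cast this
        apply mul_nonneg_of_nonpos_of_nonpos <;> linarith
      · rw [h]; simp
  push_cast at key
  rw [← hu, ← hv]
  nlinarith [key]

lemma hasSum_bernoulliPrimitive (u : ℝ) :
    HasSum (fun h : ℕ => Real.cos (2 * Real.pi * (((h + 1 : ℕ) : ℝ) * u)) /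
      (2 * Real.pi ^ 2 * ((h + 1 : ℕ) : ℝ) ^ 2)) (bernoulliPrimitive u) := by
  have h := hasSum_one_div_nat_pow_mul_cos (k := 1) one_ne_zero
    (x := Int.fract u) ⟨Int.fract_nonneg u, (Int.fract_lt_one u).le⟩
  have h2 := (hasSum_nat_add_iff' 1).mpr h
  have h3 := h2.mul_left (1 / (2 * Real.pi ^ 2))
  have hB : (Polynomial.map (algebraMap ℚ ℝ) (Polynomial.bernoulli (2 * 1))).eval (Int.fract u)
      = Int.fract u ^ 2 - Int.fract u + 1 / 6 := by
    rw [Polynomial.bernoulli_def]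
    simp [Finset.sum_range_succ, Polynomial.eval_add]
    ring
  rw [hB] at h3
  convert! h3 using 1
  · funext n
    have : Real.cos (2 * Real.pi * (((n + 1 : ℕ) : ℝ) * u)) =
        Real.cos (2 * Real.pi * ((n + 1 : ℕ) : ℝ) * Int.fract u) := by
      rw [← Real.cos_sub_int_mul_two_pi _ ((n + 1 : ℕ) * ⌊u⌋)]
      congr 1
      rw [Int.fract]
      push_cast
      ring
    rw [this, mul_one]
    field_simp
  · unfold bernoulliPrimitive
    simp
    field_simp

lemma one_div_mul_sqrt_le {h : ℝ} (hh : 1 ≤ h) :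
    1 / (h * √h) ≤ 4 / √h - 4 / √(h + 1) := by
  have h1 : 0 < √h := Real.sqrt_pos.mpr (by linarith)
  have h2 : 0 < √(h + 1) := Real.sqrt_pos.mpr (by linarith)
  have e1 : √h ^ 2 = h := Real.sq_sqrt (by linarith)
  have e2 : √(h + 1) ^ 2 = h + 1 := Real.sq_sqrt (by linarith)
  set p := √h
  set q := √(h + 1)
  have hq : q ≤ 2 * p := by nlinarith
  have hd : (q - p) * (q + p) = 1 := by nlinarith
  have hqp : 0 < q - p := by nlinarith
  rw [← e1, div_sub_div _ _ h1.ne' h2.ne', div_le_div_iff₀ (by positivity) (by positivity)]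
  have key : q * (q + p) ≤ 4 * p ^ 2 := by nlinarith
  have : q ≤ 4 * p ^ 2 * (q - p) := by
    calc q = q * ((q - p) * (q + p)) := by rw [hd, mul_one]
      _ = q * (q + p) * (q - p) := by ring
      _ ≤ 4 * p ^ 2 * (q - p) := by gcongr
  nlinarith [mul_le_mul_of_nonneg_left this h1.le]

lemma one_div_sqrt_add_one_le {h : ℝ} (hh : 0 ≤ h) :
    1 / √(h + 1) ≤ 2 * (√(h + 1) - √h) := by
  have h2 : 0 < √(h + 1) := Real.sqrt_pos.mpr (by linarith)
  have h1 : 0 ≤ √h := Real.sqrt_nonneg _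
  have e1 : √h ^ 2 = h := Real.sq_sqrt hh
  have e2 : √(h + 1) ^ 2 = h + 1 := Real.sq_sqrt (by linarith)
  rw [div_le_iff₀ h2]
  nlinarith [sq_nonneg (√(h + 1) - √h)]

lemma sum_one_div_mul_sqrt_le (K : ℕ) :
    ∑ h ∈ range K, 1 / (((h + 1 : ℕ) : ℝ) * √((h + 1 : ℕ) : ℝ)) ≤ 4 := by
  suffices ∑ h ∈ range K, 1 / (((h + 1 : ℕ) : ℝ) * √((h + 1 : ℕ) : ℝ)) ≤
      4 - 4 / √((K : ℝ) + 1) by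
    have : 0 ≤ 4 / √((K : ℝ) + 1) := by positivity
    linarith
  induction K with
  | zero => simp
  | succ K ih =>
    rw [sum_range_succ]
    have := one_div_mul_sqrt_le (h := ((K + 1 : ℕ) : ℝ))
      (by push_cast; linarith [K.cast_nonneg (α := ℝ)])
    push_cast at this ih ⊢
    linarith

lemma sum_min_div_mul_sqrt_le {δ : ℝ} (hδ : 0 < δ) (K : ℕ) :
    ∑ h ∈ range K, min 1 (((h + 1 : ℕ) : ℝ) * δ) / (((h + 1 : ℕ) : ℝ) * √((h + 1 : ℕ) : ℝ)) ≤
      6 * √δ := by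
  set S : ℕ → ℝ := fun K => ∑ h ∈ range K,
    min 1 (((h + 1 : ℕ) : ℝ) * δ) / (((h + 1 : ℕ) : ℝ) * √((h + 1 : ℕ) : ℝ)) with hS
  have hsδ : 0 < √δ := Real.sqrt_pos.mpr hδ
  have hδ2 : √δ ^ 2 = δ := Real.sq_sqrt hδ.le
  have hsmall : ∀ K : ℕ, (K : ℝ) * δ ≤ 1 → δ * √(K : ℝ) ≤ √δ := by
    intro K hK
    calc δ * √(K : ℝ) = √δ * √(K * δ) := by
          rw [Real.sqrt_mul K.cast_nonneg]; linear_combination -√(K : ℝ) * hδ2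
      _ ≤ √δ * 1 := by gcongr; exact Real.sqrt_le_one.mpr hK
      _ = √δ := mul_one _
  suffices h : ((K : ℝ) * δ ≤ 1 → S K ≤ 2 * δ * √(K : ℝ)) ∧
      (1 < (K : ℝ) * δ → S K ≤ 6 * √δ - 4 / √((K : ℝ) + 1)) by
    rcases le_or_gt ((K : ℝ) * δ) 1 with h1 | h1
    · have := h.1 h1
      have := hsmall K h1
      change S K ≤ _
      nlinarith
    · have := h.2 h1
      have h3 : 0 ≤ 4 / √((K : ℝ) + 1) := by positivity
      change S K ≤ _
      linarith
  induction K with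
  | zero => simp [hS]
  | succ K ih =>
    have hstep : S (K + 1) = S K +
        min 1 (((K + 1 : ℕ) : ℝ) * δ) / (((K + 1 : ℕ) : ℝ) * √((K + 1 : ℕ) : ℝ)) :=
      sum_range_succ _ _
    have hK0 : (0 : ℝ) ≤ K := K.cast_nonneg
    have hpos : (0 : ℝ) < ((K + 1 : ℕ) : ℝ) := by positivity
    have hspos : 0 < √((K + 1 : ℕ) : ℝ) := Real.sqrt_pos.mpr hpos
    constructor
    · intro h1
      have h0 : (K : ℝ) * δ ≤ 1 := by push_cast at h1; nlinarith
      have h2 : min 1 (((K + 1 : ℕ) : ℝ) * δ) / (((K + 1 : ℕ) : ℝ) * √((K + 1 : ℕ) : ℝ)) ≤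
          δ * (1 / √((K + 1 : ℕ) : ℝ)) := by
        rw [div_le_iff₀ (by positivity)]
        refine (min_le_right _ _).trans (le_of_eq ?_)
        field_simp
      have h3 := one_div_sqrt_add_one_le hK0
      push_cast at h2 h3 hstep ⊢
      have := ih.1 h0
      nlinarith [mul_le_mul_of_nonneg_left h3 hδ.le]
    · intro h1
      have h2 : min 1 (((K + 1 : ℕ) : ℝ) * δ) / (((K + 1 : ℕ) : ℝ) * √((K + 1 : ℕ) : ℝ)) ≤
          1 / (((K + 1 : ℕ) : ℝ) * √((K + 1 : ℕ) : ℝ)) := by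
        gcongr
        exact min_le_left _ _
      have h3 := one_div_mul_sqrt_le (h := ((K + 1 : ℕ) : ℝ)) (by push_cast; linarith)
      have h4 : S K ≤ 6 * √δ - 4 / √((K + 1 : ℕ) : ℝ) := by
        rcases le_or_gt ((K : ℝ) * δ) 1 with h0 | h0
        · have h5 := ih.1 h0
          have h6 := hsmall K h0
          have h7 : 1 / √((K + 1 : ℕ) : ℝ) ≤ √δ := by
            rw [div_le_iff₀ hspos, ← Real.sqrt_mul hδ.le, mul_comm]
            exact Real.one_le_sqrt.mpr h1.le
          have h8 : 4 / √((K + 1 : ℕ) : ℝ) = 4 * (1 / √((K + 1 : ℕ) : ℝ)) := by ring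
          rw [h8]
          linarith
        · have := ih.2 h0
          push_cast
          exact this
      linarith

lemma abs_le_of_hasSum_of_abs_sum_range_le {f : ℕ → ℝ} {a C : ℝ} (hf : HasSum f a)
    (h : ∀ K, |∑ i ∈ range K, f i| ≤ C) : |a| ≤ C :=
  le_of_tendsto hf.tendsto_sum_nat.abs (Eventually.of_forall h)

lemma abs_sum_bernoulliPrimitive_sub_le {ι : Type*} (s : Finset ι) (u : ι → ℝ) {P Q : ℝ}
    (hP : 0 ≤ P) (hQ : 0 ≤ Q)
    (hE : ∀ h : ℕ, 1 ≤ h → ‖∑ n ∈ s, expTwoPi (h * u n)‖ ≤ P * √h + Q / √h)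
    {t : ℝ} (ht : t ≠ 0) :
    |∑ n ∈ s, (bernoulliPrimitive (u n + t) - bernoulliPrimitive (u n))| ≤
      P * (6 * √|t|) + Q * (|t| * 4) := by
  have hs := hasSum_sum (s := s) fun n _ =>
    (hasSum_bernoulliPrimitive (u n + t)).sub (hasSum_bernoulliPrimitive (u n))
  refine abs_le_of_hasSum_of_abs_sum_range_le hs fun K => ?_
  have hterm : ∀ h : ℕ, |∑ n ∈ s, (Real.cos (2 * Real.pi * (((h + 1 : ℕ) : ℝ) * (u n + t))) /
      (2 * Real.pi ^ 2 * ((h + 1 : ℕ) : ℝ) ^ 2) -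
      Real.cos (2 * Real.pi * (((h + 1 : ℕ) : ℝ) * u n)) /
      (2 * Real.pi ^ 2 * ((h + 1 : ℕ) : ℝ) ^ 2))| ≤
      P * (min 1 (((h + 1 : ℕ) : ℝ) * |t|) / (((h + 1 : ℕ) : ℝ) * √((h + 1 : ℕ) : ℝ))) +
      Q * (|t| * (1 / (((h + 1 : ℕ) : ℝ) * √((h + 1 : ℕ) : ℝ)))) := by
    intro h
    have hh := hE (h + 1) (by omega)
    set H : ℝ := ((h + 1 : ℕ) : ℝ) with hH
    have hHpos : 0 < H := by positivity
    have hsH : 0 < √H := Real.sqrt_pos.mpr hHpos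
    have hsH2 : √H ^ 2 = H := Real.sq_sqrt hHpos.le
    have heq : ∑ n ∈ s, (Real.cos (2 * Real.pi * (H * (u n + t))) / (2 * Real.pi ^ 2 * H ^ 2) -
        Real.cos (2 * Real.pi * (H * u n)) / (2 * Real.pi ^ 2 * H ^ 2)) =
        ((expTwoPi (H * t) - 1) * ∑ n ∈ s, expTwoPi (H * u n)).re / (2 * Real.pi ^ 2 * H ^ 2) := by
      rw [mul_sum, Complex.re_sum, sum_div]
      refine sum_congr rfl fun n _ => ?_
      rw [← sub_div, ← expTwoPi_re, ← expTwoPi_re, ← Complex.sub_re, mul_add, expTwoPi_add]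
      congr 2
      ring
    rw [heq, abs_div, abs_of_pos (by positivity : 0 < 2 * Real.pi ^ 2 * H ^ 2)]
    have h1 : |((expTwoPi (H * t) - 1) * ∑ n ∈ s, expTwoPi (H * u n)).re| ≤
        2 * Real.pi * min 1 (H * |t|) * (P * √H + Q / √H) := by
      refine (Complex.abs_re_le_norm _).trans ?_
      rw [norm_mul]
      have := norm_expTwoPi_sub_one_le (H * t)
      rw [abs_mul, abs_of_pos hHpos] at this
      gcongr
    have hmin : 0 ≤ min 1 (H * |t|) := by positivity
    have hpi := Real.pi_gt_three
    calc _ ≤ 2 * Real.pi * min 1 (H * |t|) * (P * √H + Q / √H) / (2 * Real.pi ^ 2 * H ^ 2) := by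
          gcongr
      _ = (1 / Real.pi) * (min 1 (H * |t|) * (P * √H + Q / √H) / H ^ 2) := by
          field_simp
      _ ≤ 1 * (min 1 (H * |t|) * (P * √H + Q / √H) / H ^ 2) := by
          gcongr
          rw [div_le_one (by positivity)]
          linarith
      _ = P * (min 1 (H * |t|) / (H * √H)) + Q * (min 1 (H * |t|) / (H ^ 2 * √H)) := by
          have : H ^ 2 = H * √H ^ 2 := by rw [hsH2]; ring
          rw [this]
          field_simp
      _ ≤ _ := by
          gcongr
          calc min 1 (H * |t|) / (H ^ 2 * √H) ≤ (H * |t|) / (H ^ 2 * √H) := by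
                gcongr
                exact min_le_right _ _
            _ = |t| * (1 / (H * √H)) := by field_simp
  calc _ ≤ ∑ h ∈ range K, _ := (abs_sum_le_sum_abs _ _).trans (sum_le_sum fun h _ => hterm h)
    _ ≤ _ := by
      rw [sum_add_distrib, ← mul_sum, ← mul_sum, ← mul_sum]
      have h1 := sum_min_div_mul_sqrt_le (abs_pos.mpr ht) K
      have h2 := sum_one_div_mul_sqrt_le K
      gcongr

/-- A bound for sums of the sawtooth function in terms of exponential sums. -/
lemma abs_sum_fract_sub_half_le {ι : Type*} (s : Finset ι) (u : ι → ℝ) {P Q δ : ℝ}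
    (hP : 0 ≤ P) (hQ : 0 ≤ Q) (hδ : 0 < δ)
    (hE : ∀ h : ℕ, 1 ≤ h → ‖∑ n ∈ s, expTwoPi (h * u n)‖ ≤ P * √h + Q / √h) :
    |∑ n ∈ s, (Int.fract (u n) - 1 / 2)| ≤ #s * δ / 2 + 6 * P / √δ + 4 * Q := by
  have hsδ : 0 < √δ := Real.sqrt_pos.mpr hδ
  have hδ2 : √δ ^ 2 = δ := Real.sq_sqrt hδ.le
  have key : ∀ t : ℝ, t ≠ 0 → |t| = δ →
      -(t * ∑ n ∈ s, (Int.fract (u n) - 1 / 2)) ≤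
        δ * (#s * δ / 2 + 6 * P / √δ + 4 * Q) := by
    intro t ht htδ
    have h1 := abs_sum_bernoulliPrimitive_sub_le s u hP hQ hE ht
    rw [htδ] at h1
    have ht2 : t ^ 2 = δ ^ 2 := by rw [← htδ, sq_abs]
    have h2 : ∑ n ∈ s, (bernoulliPrimitive (u n + t) - bernoulliPrimitive (u n)) ≤
        ∑ n ∈ s, (t * (Int.fract (u n) - 1 / 2) + δ ^ 2 / 2) := by
      refine sum_le_sum fun n _ => ?_
      have := bernoulliPrimitive_le (u n) (u n + t)
      rw [add_sub_cancel_left, ht2] at this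
      linarith
    rw [sum_add_distrib, ← mul_sum, sum_const, nsmul_eq_mul] at h2
    have h3 : δ * (#s * δ / 2 + 6 * P / √δ + 4 * Q) =
        P * (6 * √δ) + Q * (δ * 4) + #s * (δ ^ 2 / 2) := by
      have : δ * (6 * P / √δ) = P * (6 * √δ) := by
        rw [mul_div_assoc', div_eq_iff hsδ.ne']
        nlinarith
      rw [mul_add, mul_add, this]
      ring
    rw [h3]
    linarith [neg_abs_le (∑ n ∈ s, (bernoulliPrimitive (u n + t) - bernoulliPrimitive (u n)))]
  have hp := key δ hδ.ne' (abs_of_pos hδ)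
  have hn := key (-δ) (neg_ne_zero.mpr hδ.ne') (by rw [abs_neg, abs_of_pos hδ])
  rw [abs_le]
  constructor
  · have : δ * (-(∑ n ∈ s, (Int.fract (u n) - 1 / 2))) ≤
      δ * (#s * δ / 2 + 6 * P / √δ + 4 * Q) := by linarith
    linarith [le_of_mul_le_mul_left this hδ]
  · exact le_of_mul_le_mul_left (by linarith) hδ

/-- `cot (πt)` as a quotient. -/
noncomputable def cotPi (t : ℝ) : ℝ := Real.cos (Real.pi * t) / Real.sin (Real.pi * t)

lemma two_mul_le_sin_pi_mul {η t : ℝ} (hη : 0 < η) (h1 : η ≤ t) (h2 : t ≤ 1 - η) :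
    2 * η ≤ Real.sin (Real.pi * t) := by
  have hpi := Real.pi_pos
  rcases le_total t (1 / 2) with h | h
  · have := Real.mul_le_sin (x := Real.pi * t) (by nlinarith) (by nlinarith)
    have e : 2 / Real.pi * (Real.pi * t) = 2 * t := by field_simp
    linarith
  · have := Real.mul_le_sin (x := Real.pi * (1 - t)) (by nlinarith) (by nlinarith)
    have e : 2 / Real.pi * (Real.pi * (1 - t)) = 2 * (1 - t) := by field_simp
    have e2 : Real.pi * (1 - t) = Real.pi - Real.pi * t := by ring
    rw [e, e2, Real.sin_pi_sub] at this
    linarith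

lemma abs_cotPi_le {η t : ℝ} (hη : 0 < η) (h1 : η ≤ t) (h2 : t ≤ 1 - η) :
    |cotPi t| ≤ 1 / (2 * η) := by
  have h := two_mul_le_sin_pi_mul hη h1 h2
  rw [cotPi, abs_div, abs_of_pos (by linarith : 0 < Real.sin (Real.pi * t))]
  gcongr
  exact Real.abs_cos_le_one _

lemma cotPi_le_cotPi {η s t : ℝ} (hη : 0 < η) (h1 : η ≤ s) (hst : s ≤ t) (h2 : t ≤ 1 - η) :
    cotPi t ≤ cotPi s := by
  have hs := two_mul_le_sin_pi_mul hη h1 (hst.trans h2)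
  have ht := two_mul_le_sin_pi_mul hη (h1.trans hst) h2
  have hpi := Real.pi_pos
  have h3 : 0 ≤ Real.sin (Real.pi * t - Real.pi * s) :=
    Real.sin_nonneg_of_nonneg_of_le_pi (by nlinarith) (by nlinarith)
  rw [Real.sin_sub] at h3
  rw [cotPi, cotPi, div_le_div_iff₀ (by linarith) (by linarith)]
  linarith

/-- The reciprocal of `e(t) - 1`. -/
noncomputable def invExpSubOne (t : ℝ) : ℂ := -(1 / 2) - (cotPi t / 2 : ℝ) * Complex.I

lemma expTwoPi_sub_one_mul_invExpSubOne {t : ℝ} (h : Real.sin (Real.pi * t) ≠ 0) :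
    (expTwoPi t - 1) * invExpSubOne t = 1 := by
  have h1 : expTwoPi t = (Real.cos (2 * (Real.pi * t)) : ℝ) +
      (Real.sin (2 * (Real.pi * t)) : ℝ) * Complex.I := by
    unfold expTwoPi
    rw [Complex.exp_mul_I, ← Complex.ofReal_cos, ← Complex.ofReal_sin]
    ring_nf
  rw [h1, Real.cos_two_mul, Real.sin_two_mul, invExpSubOne, cotPi]
  have hsc := Real.sin_sq_add_cos_sq (Real.pi * t)
  set c := Real.cos (Real.pi * t)
  set s := Real.sin (Real.pi * t)
  apply Complex.ext
  · simp [-Complex.ofReal_pow]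
    field_simp
    ring
  · simp [-Complex.ofReal_pow]
    field_simp
    linear_combination -2 * c * hsc

lemma invExpSubOne_sub (s t : ℝ) :
    invExpSubOne s - invExpSubOne t = ((cotPi t - cotPi s) / 2 : ℝ) * Complex.I := by
  unfold invExpSubOne
  push_cast
  ring

lemma norm_invExpSubOne_le {η t : ℝ} (hη : 0 < η) (h1 : η ≤ t) (h2 : t ≤ 1 - η) :
    ‖invExpSubOne t‖ ≤ 1 / η := by
  have h := abs_cotPi_le hη h1 h2
  have h3 : 1 / 2 ≤ 1 / (2 * η) := by
    gcongr
    linarith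
  calc ‖invExpSubOne t‖ ≤ ‖(-(1 / 2) : ℂ)‖ + ‖((cotPi t / 2 : ℝ) : ℂ) * Complex.I‖ :=
        norm_sub_le _ _
    _ = 1 / 2 + |cotPi t| / 2 := by
      rw [norm_mul, Complex.norm_I, Complex.norm_real, Real.norm_eq_abs, abs_div]
      norm_num
    _ ≤ 1 / (2 * η) + 1 / (2 * η) := by
      have := abs_nonneg (cotPi t)
      linarith
    _ = 1 / η := by field_simp; norm_num

lemma norm_sum_expTwoPi_le_of_mem_Icc_zero (g : ℕ → ℝ) {η : ℝ} (hη : 0 < η) (M : ℕ)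
    (hΔ : ∀ n ≤ M, η ≤ g (n + 1) - g n ∧ g (n + 1) - g n ≤ 1 - η)
    (hmono : ∀ n < M, g (n + 1) - g n ≤ g (n + 2) - g (n + 1)) :
    ‖∑ n ∈ range (M + 1), expTwoPi (g n)‖ ≤ 3 / η := by
  set w : ℕ → ℂ := fun n => invExpSubOne (g (n + 1) - g n) with hw
  have hterm : ∀ n ≤ M, expTwoPi (g n) = expTwoPi (g (n + 1)) * w n - expTwoPi (g n) * w n := by
    intro n hn
    have hsin := two_mul_le_sin_pi_mul hη (hΔ n hn).1 (hΔ n hn).2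
    have := expTwoPi_sub_one_mul_invExpSubOne (t := g (n + 1) - g n) (by linarith)
    have h2 : expTwoPi (g (n + 1)) = expTwoPi (g n) * expTwoPi (g (n + 1) - g n) := by
      rw [← expTwoPi_add]; ring_nf
    rw [h2, hw]
    linear_combination -expTwoPi (g n) * this
  have hsum : ∀ K ≤ M, ∑ n ∈ range (K + 1), expTwoPi (g n) =
      expTwoPi (g (K + 1)) * w K - expTwoPi (g 0) * w 0 -
        ∑ n ∈ range K, expTwoPi (g (n + 1)) * (w (n + 1) - w n) := by
    intro K hK
    induction K with
    | zero => simpa using hterm 0 hK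
    | succ K ih =>
      rw [sum_range_succ, ih (by omega), sum_range_succ _ K]
      linear_combination hterm (K + 1) hK
  rw [hsum M le_rfl]
  have hb : ∀ n ≤ M, ∀ z : ℝ, ‖expTwoPi z * w n‖ ≤ 1 / η := by
    intro n hn z
    rw [norm_mul, norm_expTwoPi, one_mul]
    exact norm_invExpSubOne_le hη (hΔ n hn).1 (hΔ n hn).2
  have hvar : ‖∑ n ∈ range M, expTwoPi (g (n + 1)) * (w (n + 1) - w n)‖ ≤ 1 / η := by
    calc _ ≤ ∑ n ∈ range M, ‖expTwoPi (g (n + 1)) * (w (n + 1) - w n)‖ := norm_sum_le _ _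
      _ = ∑ n ∈ range M, (cotPi (g (n + 1) - g n) / 2 - cotPi (g (n + 1 + 1) - g (n + 1)) / 2) := by
        refine sum_congr rfl fun n hn => ?_
        have hn := mem_range.mp hn
        have := cotPi_le_cotPi hη (hΔ n hn.le).1 (hmono n hn) (hΔ (n + 1) hn).2
        rw [norm_mul, norm_expTwoPi, one_mul, hw]
        simp only
        rw [invExpSubOne_sub, norm_mul, Complex.norm_I, mul_one, Complex.norm_real,
          Real.norm_eq_abs, abs_of_nonneg (by linarith)]
        ring
      _ = cotPi (g 1 - g 0) / 2 - cotPi (g (M + 1) - g M) / 2 :=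
        sum_range_sub' (fun n => cotPi (g (n + 1) - g n) / 2) M
      _ ≤ 1 / (2 * η) / 2 + 1 / (2 * η) / 2 := by
        have h1 := abs_cotPi_le hη (hΔ 0 (Nat.zero_le _)).1 (hΔ 0 (Nat.zero_le _)).2
        have h2 := abs_cotPi_le hη (hΔ M le_rfl).1 (hΔ M le_rfl).2
        have := (abs_le.mp h1).2
        have := (abs_le.mp h2).1
        norm_num at *
        linarith
      _ ≤ 1 / η := by
        have : 1 / (2 * η) = 1 / η / 2 := by field_simp
        have h0 : 0 < 1 / η := by positivity
        linarith
  calc _ ≤ ‖expTwoPi (g (M + 1)) * w M‖ + ‖expTwoPi (g 0) * w 0‖ +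
        ‖∑ n ∈ range M, expTwoPi (g (n + 1)) * (w (n + 1) - w n)‖ :=
        (norm_sub_le _ _).trans (by gcongr; exact norm_sub_le _ _)
    _ ≤ 1 / η + 1 / η + 1 / η := by
      gcongr
      · exact hb M le_rfl _
      · exact hb 0 (Nat.zero_le _) _
    _ = 3 / η := by ring

/-- The Kusmin–Landau inequality. -/
lemma norm_sum_expTwoPi_le_of_mem_Icc (g : ℕ → ℝ) (j : ℤ) {η : ℝ} (hη : 0 < η) (a b : ℕ)
    (hΔ : ∀ n ∈ Icc a b, j + η ≤ g (n + 1) - g n ∧ g (n + 1) - g n ≤ j + 1 - η)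
    (hmono : ∀ n, a ≤ n → n < b → g (n + 1) - g n ≤ g (n + 2) - g (n + 1)) :
    ‖∑ n ∈ Icc a b, expTwoPi (g n)‖ ≤ 3 / η := by
  rcases lt_or_ge b a with hab | hab
  · rw [Icc_eq_empty (by omega), sum_empty, norm_zero]
    positivity
  have h := norm_sum_expTwoPi_le_of_mem_Icc_zero (fun n => g (a + n) - j * n) hη (b - a)
    (fun n hn => by
      have := hΔ (a + n) (mem_Icc.mpr ⟨by omega, by omega⟩)
      rw [add_assoc] at this
      push_cast
      constructor <;> linarith [this.1, this.2])
    (fun n hn => by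
      have := hmono (a + n) (by omega) (by omega)
      rw [add_assoc, add_assoc] at this
      push_cast
      linarith)
  convert h using 2
  rw [← Ico_add_one_right_eq_Icc, sum_Ico_eq_sum_range]
  rw [show b + 1 - a = b - a + 1 by omega]
  refine sum_congr rfl fun n _ => ?_
  have : expTwoPi (g (a + n)) = expTwoPi (g (a + n) - j * n) * expTwoPi ((j * n : ℤ) : ℝ) := by
    rw [← expTwoPi_add]
    push_cast
    ring_nf
  rw [this, expTwoPi_intCast, mul_one]

lemma card_le_of_separated (s : Finset ℕ) (D : ℕ → ℝ) {lam c w : ℝ} (hlam : 0 < lam) (hw : 0 ≤ w)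
    (hD : ∀ m ∈ s, ∀ n ∈ s, m ≤ n → lam * ((n : ℝ) - m) ≤ D n - D m)
    (hs : ∀ n ∈ s, c ≤ D n ∧ D n ≤ c + w) : (#s : ℝ) ≤ w / lam + 1 := by
  rcases s.eq_empty_or_nonempty with rfl | hne
  · simp only [card_empty, Nat.cast_zero]
    positivity
  have hle := s.min'_le_max' hne
  set a := s.min' hne
  set b := s.max' hne
  have ha : a ∈ s := s.min'_mem hne
  have hb : b ∈ s := s.max'_mem hne
  have hcard : #s ≤ b - a + 1 := by
    calc #s ≤ #(Icc a b) := card_le_card fun n hn =>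
          mem_Icc.mpr ⟨s.min'_le n hn, s.le_max' n hn⟩
      _ = b - a + 1 := by rw [Nat.card_Icc]; omega
  have h1 := hD a ha b hb hle
  have h2 : (b : ℝ) - a ≤ w / lam := by
    rw [le_div_iff₀ hlam]
    linarith [(hs a ha).1, (hs b hb).2]
  have h3 : (#s : ℝ) ≤ ((b - a + 1 : ℕ) : ℝ) := by exact_mod_cast hcard
  rw [Nat.cast_add, Nat.cast_sub hle] at h3
  push_cast at h3
  linarith

lemma norm_sum_expTwoPi_le_card (s : Finset ℕ) (g : ℕ → ℝ) :
    ‖∑ n ∈ s, expTwoPi (g n)‖ ≤ #s := by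
  refine (norm_sum_le _ _).trans (le_of_eq ?_)
  simp [norm_expTwoPi]

lemma norm_sum_expTwoPi_floor_eq_le (g : ℕ → ℝ) {lam η : ℝ} (M : ℕ) (j : ℤ) (hlam : 0 < lam)
    (hη : 0 < η)
    (hD : ∀ m n, m ≤ n → n < M →
      lam * ((n : ℝ) - m) ≤ (g (n + 1) - g n) - (g (m + 1) - g m)) :
    ‖∑ n ∈ range M with ⌊g (n + 1) - g n⌋ = j, expTwoPi (g n)‖ ≤
      3 / η + 2 * (η / lam + 1) := by
  set D : ℕ → ℝ := fun n => g (n + 1) - g n with hDdef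
  have hmono : ∀ m n, m ≤ n → n < M → D m ≤ D n := by
    intro m n hmn hn
    have h1 := hD m n hmn hn
    have : (m : ℝ) ≤ n := by exact_mod_cast hmn
    have h2 : 0 ≤ lam * ((n : ℝ) - m) := mul_nonneg hlam.le (by linarith)
    simp only [hDdef]
    linarith
  set s := (range M).filter fun n => ⌊D n⌋ = j with hs
  have hsmem : ∀ n ∈ s, n < M ∧ (j : ℝ) ≤ D n ∧ D n < j + 1 := by
    intro n hn
    rw [hs, mem_filter, mem_range, Int.floor_eq_iff] at hn
    exact hn
  set s₁ := s.filter fun n => D n < j + η with hs₁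
  set s₂ := (s.filter fun n => ¬ D n < j + η).filter fun n => j + 1 - η < D n with hs₂
  set s₃ := (s.filter fun n => ¬ D n < j + η).filter fun n => ¬ j + 1 - η < D n with hs₃
  have hsplit : ∑ n ∈ s, expTwoPi (g n) = ∑ n ∈ s₁, expTwoPi (g n) +
      (∑ n ∈ s₂, expTwoPi (g n) + ∑ n ∈ s₃, expTwoPi (g n)) := by
    rw [hs₂, hs₃, sum_filter_add_sum_filter_not, hs₁, sum_filter_add_sum_filter_not]
  have h1 : ‖∑ n ∈ s₁, expTwoPi (g n)‖ ≤ η / lam + 1 := by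
    refine (norm_sum_expTwoPi_le_card _ _).trans
      (card_le_of_separated s₁ D (c := j) hlam hη.le ?_ ?_)
    · intro m _ n hn hmn
      exact hD m n hmn (hsmem n (mem_filter.mp hn).1).1
    · intro n hn
      have := mem_filter.mp hn
      exact ⟨(hsmem n this.1).2.1, this.2.le⟩
  have h2 : ‖∑ n ∈ s₂, expTwoPi (g n)‖ ≤ η / lam + 1 := by
    refine (norm_sum_expTwoPi_le_card _ _).trans
      (card_le_of_separated s₂ D (c := j + 1 - η) hlam hη.le ?_ ?_)
    · intro m _ n hn hmn
      exact hD m n hmn (hsmem n (mem_filter.mp (mem_filter.mp hn).1).1).1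
    · intro n hn
      have h := mem_filter.mp hn
      have := (hsmem n (mem_filter.mp h.1).1).2.2
      exact ⟨h.2.le, by linarith⟩
  have h3 : ‖∑ n ∈ s₃, expTwoPi (g n)‖ ≤ 3 / η := by
    have hmem : ∀ n, n ∈ s₃ ↔ n < M ∧ j ≤ D n ∧ D n < j + 1 ∧ j + η ≤ D n ∧ D n ≤ j + 1 - η := by
      intro n
      rw [hs₃, mem_filter, mem_filter, hs, mem_filter, mem_range, Int.floor_eq_iff, not_lt, not_lt]
      tauto
    rcases s₃.eq_empty_or_nonempty with he | hne
    · rw [he, sum_empty, norm_zero]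
      positivity
    have ha := (hmem _).mp (s₃.min'_mem hne)
    have hb := (hmem _).mp (s₃.max'_mem hne)
    have heq : s₃ = Icc (s₃.min' hne) (s₃.max' hne) := by
      apply Subset.antisymm
      · exact fun n hn => mem_Icc.mpr ⟨s₃.min'_le n hn, s₃.le_max' n hn⟩
      · intro n hn
        obtain ⟨hn1, hn2⟩ := mem_Icc.mp hn
        have hnM : n < M := by omega
        have h4 := hmono _ _ hn1 hnM
        have h5 := hmono _ _ hn2 hb.1
        exact (hmem n).mpr ⟨hnM, by linarith, by linarith, by linarith, by linarith⟩
    rw [heq]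
    refine norm_sum_expTwoPi_le_of_mem_Icc g j hη _ _ ?_ ?_
    · intro n hn
      rw [← heq] at hn
      exact ((hmem n).mp hn).2.2.2
    · intro n _ hn
      exact hmono n (n + 1) (by omega) (by omega)
  rw [hsplit]
  have := norm_add₃_le (a := ∑ n ∈ s₁, expTwoPi (g n)) (b := ∑ n ∈ s₂, expTwoPi (g n))
    (c := ∑ n ∈ s₃, expTwoPi (g n))
  rw [← add_assoc]
  linarith

/-- Van der Corput's second derivative test, for second differences. -/
lemma norm_sum_expTwoPi_le_of_second_difference (g : ℕ → ℝ) {lam C : ℝ} (M : ℕ) (hlam : 0 < lam)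
    (hC : 1 ≤ C)
    (h : ∀ n, n + 1 < M → lam ≤ (g (n + 2) - g (n + 1)) - (g (n + 1) - g n) ∧
      (g (n + 2) - g (n + 1)) - (g (n + 1) - g n) ≤ C * lam) :
    ‖∑ n ∈ range M, expTwoPi (g n)‖ ≤ 10 * C * M * √lam + 20 / √lam := by
  have hsl : 0 < √lam := Real.sqrt_pos.mpr hlam
  have hsl2 : √lam ^ 2 = lam := Real.sq_sqrt hlam.le
  rcases le_or_gt 1 lam with hl | hl
  · have h1 := norm_sum_expTwoPi_le_card (range M) g
    rw [card_range] at h1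
    have h2 : 1 ≤ √lam := Real.one_le_sqrt.mpr hl
    have h3 : (M : ℝ) * 1 ≤ M * (10 * C * √lam) := by
      gcongr
      nlinarith
    have h4 : 0 < 20 / √lam := by positivity
    linarith
  rcases Nat.eq_zero_or_pos M with rfl | hM
  · rw [range_zero, sum_empty, norm_zero]
    positivity
  have hsl1 : √lam ≤ 1 := Real.sqrt_le_one.mpr hl.le
  have hD : ∀ m n, m ≤ n → n < M →
      lam * ((n : ℝ) - m) ≤ (g (n + 1) - g n) - (g (m + 1) - g m) ∧
      (g (n + 1) - g n) - (g (m + 1) - g m) ≤ C * lam * ((n : ℝ) - m) := by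
    intro m n hmn
    induction n, hmn using Nat.le_induction with
    | base => intro _; simp
    | succ n hmn ih =>
      intro hn
      have h1 := ih (by omega)
      have h2 := h n hn
      push_cast
      rw [add_assoc, show 1 + 1 = 2 from rfl]
      constructor <;> nlinarith [h1.1, h1.2, h2.1, h2.2]
  set D : ℕ → ℝ := fun n => g (n + 1) - g n with hDdef
  have hmaps : ∀ n ∈ range M, ⌊D n⌋ ∈ Icc ⌊D 0⌋ ⌊D (M - 1)⌋ := by
    intro n hn
    have hn := mem_range.mp hn
    have h1 := (hD 0 n (Nat.zero_le _) hn).1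
    have h2 := (hD n (M - 1) (by omega) (by omega)).1
    have h3 : (n : ℝ) ≤ ((M - 1 : ℕ) : ℝ) := by exact_mod_cast Nat.le_sub_one_of_lt hn
    have h4 : 0 ≤ lam * ((n : ℝ) - (0 : ℕ)) := by
      rw [Nat.cast_zero, sub_zero]; positivity
    have h5 : 0 ≤ lam * (((M - 1 : ℕ) : ℝ) - n) := mul_nonneg hlam.le (by linarith)
    rw [mem_Icc]
    constructor <;> apply Int.floor_le_floor <;> simp only [hDdef] <;> linarith
  have hsum := sum_fiberwise_of_maps_to hmaps fun n => expTwoPi (g n)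
  rw [← hsum]
  have hfib : ∀ j : ℤ, ‖∑ n ∈ range M with ⌊D n⌋ = j, expTwoPi (g n)‖ ≤ 7 / √lam := by
    intro j
    refine (norm_sum_expTwoPi_floor_eq_le g M j hlam hsl fun m n hmn hn =>
      (hD m n hmn hn).1).trans ?_
    have h1 : √lam / lam = 1 / √lam := by
      rw [div_eq_div_iff hlam.ne' hsl.ne']; linarith
    have h2 : 1 ≤ 1 / √lam := by rwa [le_div_iff₀ hsl, one_mul]
    have h3 : 3 / √lam = 3 * (1 / √lam) := by ring
    have h4 : 7 / √lam = 7 * (1 / √lam) := by ring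
    rw [h1, h3, h4]
    linarith
  have hcard : (#(Icc ⌊D 0⌋ ⌊D (M - 1)⌋) : ℝ) ≤ C * lam * M + 2 := by
    have h0 : ⌊D 0⌋ ≤ ⌊D (M - 1)⌋ + 1 := by
      have := mem_Icc.mp (hmaps 0 (mem_range.mpr hM))
      omega
    have h1 : ((#(Icc ⌊D 0⌋ ⌊D (M - 1)⌋) : ℤ) : ℝ) = ⌊D (M - 1)⌋ + 1 - ⌊D 0⌋ := by
      rw [Int.card_Icc, Int.toNat_of_nonneg (by omega)]
      push_cast
      ring
    rw [Int.cast_natCast] at h1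
    have h2 := (hD 0 (M - 1) (Nat.zero_le _) (by omega)).2
    have h3 : C * lam * (((M - 1 : ℕ) : ℝ) - (0 : ℕ)) ≤ C * lam * M := by
      rw [Nat.cast_zero, sub_zero]
      gcongr
      omega
    have h4 := Int.floor_le (D (M - 1))
    have h5 := Int.lt_floor_add_one (D 0)
    rw [h1]
    simp only [hDdef] at *
    linarith
  calc _ ≤ ∑ j ∈ Icc ⌊D 0⌋ ⌊D (M - 1)⌋, 7 / √lam :=
        (norm_sum_le _ _).trans (sum_le_sum fun j _ => hfib j)
    _ = #(Icc ⌊D 0⌋ ⌊D (M - 1)⌋) * (7 / √lam) := by rw [sum_const, nsmul_eq_mul]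
    _ ≤ (C * lam * M + 2) * (7 / √lam) := by gcongr
    _ = 7 * C * M * √lam + 14 / √lam := by
      have : lam / √lam = √lam := by rw [div_eq_iff hsl.ne']; linarith
      calc _ = 7 * C * M * (lam / √lam) + 14 / √lam := by ring
        _ = _ := by rw [this]
    _ ≤ _ := by
      gcongr <;> norm_num

lemma abs_sum_Icc_le_of_dyadic (f : ℕ → ℝ) {A : ℝ} {B : ℕ} (hA1 : |f 1| ≤ A)
    (h : ∀ N M : ℕ, 1 ≤ N → N ≤ B → M ≤ N + 1 → |∑ n ∈ range M, f (N + 1 + n)| ≤ A) :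
    |∑ n ∈ Icc 1 B, f n| ≤ A * (Nat.log 2 B + 1) := by
  have hA : 0 ≤ A := (abs_nonneg _).trans hA1
  induction B using Nat.strong_induction_on with
  | _ B ih =>
    rcases lt_or_ge B 2 with hB | hB
    · interval_cases B
      · simpa using hA
      · simpa using hA1
    have h1 := ih (B / 2) (by omega) fun N M hN hNB hM => h N M hN (by omega) hM
    have h2 := h (B / 2) (B - B / 2) (by omega) (by omega) (by omega)
    have hsplit : ∑ n ∈ Icc 1 B, f n =
        ∑ n ∈ Icc 1 (B / 2), f n + ∑ n ∈ range (B - B / 2), f (B / 2 + 1 + n) := by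
      rw [← Ico_add_one_right_eq_Icc, ← Ico_add_one_right_eq_Icc,
        ← sum_Ico_consecutive f (by omega : 1 ≤ B / 2 + 1) (by omega : B / 2 + 1 ≤ B + 1),
        sum_Ico_eq_sum_range f (B / 2 + 1)]
      congr 3
      omega
    rw [hsplit, Nat.log_of_one_lt_of_le one_lt_two hB]
    push_cast
    have := abs_add_le (∑ n ∈ Icc 1 (B / 2), f n) (∑ n ∈ range (B - B / 2), f (B / 2 + 1 + n))
    linarith

lemma second_difference_div (y a : ℝ) (ha : 0 < a) :
    (y / (a + 2) - y / (a + 1)) - (y / (a + 1) - y / a) = 2 * y / (a * (a + 1) * (a + 2)) := by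
  field_simp
  ring

lemma norm_sum_expTwoPi_hyperbola_le {y θ τ : ℝ} (hy : 0 < y) (hθ0 : 0 ≤ θ) (hθ1 : θ ≤ 1)
    {N M : ℕ} (hN : 1 ≤ N) (hM : M ≤ N + 1) (h : ℕ) (hh : 1 ≤ h) :
    ‖∑ n ∈ range M, expTwoPi (h * (y / (((N + 1 + n : ℕ) : ℝ) + θ) - τ))‖ ≤
      (600 * M * √(y / (30 * N ^ 3))) * √h + (20 / √(y / (30 * N ^ 3))) / √h := by
  have hN' : (1 : ℝ) ≤ N := by exact_mod_cast hN
  have hh' : (1 : ℝ) ≤ h := by exact_mod_cast hh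
  have h1 := norm_sum_expTwoPi_le_of_second_difference
    (fun n => h * (y / (((N + 1 + n : ℕ) : ℝ) + θ) - τ)) (lam := y / (30 * N ^ 3) * h) (C := 60)
    M (by positivity) (by norm_num) ?_
  · rw [Real.sqrt_mul (by positivity)] at h1
    refine h1.trans (le_of_eq ?_)
    rw [div_div]
    ring
  · intro n hn
    have hnN : (n : ℝ) + 1 ≤ N := by exact_mod_cast (by omega : n + 1 ≤ N)
    set a : ℝ := N + 1 + n + θ with ha
    have hn0 : (0 : ℝ) ≤ n := n.cast_nonneg
    have haN : (N : ℝ) ≤ a := by linarith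
    have haN2 : a ≤ 3 * N := by linarith
    have hdiff := second_difference_div y a (by linarith)
    have e : (↑h * (y / (((N + 1 + (n + 2) : ℕ) : ℝ) + θ) - τ) -
        ↑h * (y / (((N + 1 + (n + 1) : ℕ) : ℝ) + θ) - τ) -
        (↑h * (y / (((N + 1 + (n + 1) : ℕ) : ℝ) + θ) - τ) -
        ↑h * (y / (((N + 1 + n : ℕ) : ℝ) + θ) - τ))) = h * (2 * y / (a * (a + 1) * (a + 2))) := by
      rw [← hdiff, ha]
      push_cast
      ring_nf
    rw [e]
    have hlow : (N : ℝ) ^ 3 ≤ a * (a + 1) * (a + 2) := by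
      calc (N : ℝ) ^ 3 = N * N * N := by ring
        _ ≤ a * (a + 1) * (a + 2) := by gcongr <;> linarith
    have hup : a * (a + 1) * (a + 2) ≤ 60 * N ^ 3 := by
      calc a * (a + 1) * (a + 2) ≤ (3 * N) * (4 * N) * (5 * N) := by gcongr <;> linarith
        _ = _ := by ring
    constructor
    · calc y / (30 * N ^ 3) * h = h * (2 * y / (60 * N ^ 3)) := by field_simp; norm_num
        _ ≤ _ := by gcongr
    · calc _ ≤ h * (2 * y / N ^ 3) := by gcongr
        _ = _ := by field_simp; norm_num

lemma abs_sum_fract_hyperbola_block_le {z θ τ : ℝ} (hz : 1 ≤ z) (hθ0 : 0 ≤ θ) (hθ1 : θ ≤ 1)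
    {N M : ℕ} (hN : 1 ≤ N) (hNz : (N : ℝ) ^ 2 ≤ z ^ 3) (hM : M ≤ N + 1) :
    |∑ n ∈ range M, (Int.fract (z ^ 3 / (((N + 1 + n : ℕ) : ℝ) + θ) - τ) - 1 / 2)| ≤
      8000 * z := by
  have hN' : (1 : ℝ) ≤ N := by exact_mod_cast hN
  have hM' : (M : ℝ) ≤ 2 * N := by exact_mod_cast (by omega : M ≤ 2 * N)
  have hδ : 0 < z / N := by positivity
  have hl : 0 < z ^ 3 / (30 * N ^ 3) := by positivity
  have hs := Real.sqrt_pos.mpr hl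
  have h := abs_sum_fract_sub_half_le (range M)
    (fun n => z ^ 3 / (((N + 1 + n : ℕ) : ℝ) + θ) - τ)
    (P := 600 * M * √(z ^ 3 / (30 * N ^ 3))) (Q := 20 / √(z ^ 3 / (30 * N ^ 3)))
    (by positivity) (by positivity) hδ
    fun h hh => norm_sum_expTwoPi_hyperbola_le (by positivity) hθ0 hθ1 hN hM h hh
  refine h.trans ?_
  rw [card_range]
  have h1 : M * (z / N) / 2 ≤ z := by
    calc M * (z / N) / 2 ≤ 2 * N * (z / N) / 2 := by gcongr
      _ = z := by field_simp
  have h2 : √(z ^ 3 / (30 * N ^ 3)) / √(z / N) ≤ z / N := by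
    rw [← Real.sqrt_div hl.le]
    refine Real.sqrt_le_iff.mpr ⟨hδ.le, ?_⟩
    have : z ^ 3 / (30 * (N : ℝ) ^ 3) / (z / N) = (z / N) ^ 2 / 30 := by
      field_simp
    rw [this]
    nlinarith [sq_nonneg (z / N)]
  have h2' : 6 * (600 * M * √(z ^ 3 / (30 * N ^ 3))) / √(z / N) ≤ 7200 * z := by
    calc _ = 3600 * M * (√(z ^ 3 / (30 * N ^ 3)) / √(z / N)) := by ring
      _ ≤ 3600 * (2 * N) * (z / N) := by gcongr
      _ = 7200 * z := by field_simp; norm_num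
  have h3 : 1 / (6 * z) ≤ √(z ^ 3 / (30 * N ^ 3)) := by
    refine Real.le_sqrt_of_sq_le ?_
    rw [div_pow, div_le_div_iff₀ (by positivity) (by positivity)]
    have hNz2 : (N : ℝ) ≤ z ^ 2 := by
      refine le_of_sq_le_sq ?_ (by positivity)
      nlinarith [pow_pos (by linarith : 0 < z) 3]
    have : (N : ℝ) ^ 3 ≤ z ^ 3 * z ^ 2 := by
      calc (N : ℝ) ^ 3 = N ^ 2 * N := by ring
        _ ≤ z ^ 3 * z ^ 2 := by gcongr
    nlinarith [pow_pos (by linarith : 0 < z) 5]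
  have h3' : 4 * (20 / √(z ^ 3 / (30 * N ^ 3))) ≤ 480 * z := by
    have : 1 / √(z ^ 3 / (30 * N ^ 3)) ≤ 6 * z := by
      rw [div_le_iff₀ hs]
      rw [div_le_iff₀ (by positivity)] at h3
      linarith
    calc _ = 80 * (1 / √(z ^ 3 / (30 * N ^ 3))) := by ring
      _ ≤ 80 * (6 * z) := by gcongr
      _ = _ := by ring
  linarith

/-- A Voronoi-strength bound for the sawtooth sum along a shifted hyperbola. -/
lemma abs_sum_fract_hyperbola_le {z θ τ : ℝ} (hz : 1 ≤ z) (hθ0 : 0 ≤ θ) (hθ1 : θ ≤ 1)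
    {B : ℕ} (hB : (B : ℝ) ^ 2 ≤ z ^ 3) :
    |∑ n ∈ Icc 1 B, (Int.fract (z ^ 3 / ((n : ℝ) + θ) - τ) - 1 / 2)| ≤
      8000 * z * (Nat.log 2 B + 1) := by
  refine abs_sum_Icc_le_of_dyadic (fun n => Int.fract (z ^ 3 / ((n : ℝ) + θ) - τ) - 1 / 2) ?_ ?_
  · have h0 := Int.fract_nonneg (z ^ 3 / (((1 : ℕ) : ℝ) + θ) - τ)
    have h1 := Int.fract_lt_one (z ^ 3 / (((1 : ℕ) : ℝ) + θ) - τ)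
    rw [abs_le]
    constructor <;> linarith
  · intro N M hN hNB hM
    refine abs_sum_fract_hyperbola_block_le hz hθ0 hθ1 hN ?_ hM
    calc (N : ℝ) ^ 2 ≤ (B : ℝ) ^ 2 := by gcongr
      _ ≤ z ^ 3 := hB

lemma sum_Ioc_div_sub_div_bounds {y θ : ℝ} (hy : 0 ≤ y) (hθ0 : 0 ≤ θ) (hθ1 : θ ≤ 1) {B L : ℕ}
    (hB : 1 ≤ B) (hBL : B ≤ L) :
    θ * y * (1 / ((B : ℝ) + 1) - 1 / ((L : ℝ) + 1)) ≤
      ∑ l ∈ Ioc B L, (y / (l : ℝ) - y / ((l : ℝ) + θ)) ∧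
    ∑ l ∈ Ioc B L, (y / (l : ℝ) - y / ((l : ℝ) + θ)) ≤ θ * y * (1 / (B : ℝ) - 1 / (L : ℝ)) := by
  induction L, hBL using Nat.le_induction with
  | base => simp
  | succ L hBL ih =>
    have hL : (1 : ℝ) ≤ L := by exact_mod_cast hB.trans hBL
    rw [sum_Ioc_succ_top (by omega)]
    push_cast
    have e : y / ((L : ℝ) + 1) - y / ((L : ℝ) + 1 + θ) =
        θ * y * (1 / (((L : ℝ) + 1) * ((L : ℝ) + 1 + θ))) := by
      field_simp
      ring
    have e1 : 1 / (L : ℝ) - 1 / ((L : ℝ) + 1) = 1 / ((L + 1) * (L : ℝ)) := by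
      field_simp
      ring
    have e2 : 1 / ((L : ℝ) + 1) - 1 / ((L : ℝ) + 1 + 1) = 1 / ((L + 1) * ((L : ℝ) + 1 + 1)) := by
      field_simp
      ring
    have h1 : 1 / (((L : ℝ) + 1) * ((L : ℝ) + 1 + θ)) ≤ 1 / ((L + 1) * (L : ℝ)) := by
      gcongr
      linarith
    have h2 : 1 / ((L + 1) * ((L : ℝ) + 1 + 1)) ≤ 1 / (((L : ℝ) + 1) * ((L : ℝ) + 1 + θ)) := by
      gcongr
    have hθy : 0 ≤ θ * y := by positivity
    have h3 := mul_le_mul_of_nonneg_left h1 hθy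
    have h4 := mul_le_mul_of_nonneg_left h2 hθy
    rw [← e1] at h3
    rw [← e2] at h4
    rw [e]
    constructor <;> nlinarith [ih.1, ih.2]

lemma abs_mul_sub_sum_Ioc_le {y θ : ℝ} (hθ0 : 0 ≤ θ) (hθ1 : θ ≤ 1) {B L : ℕ}
    (hB : 1 ≤ B) (hBL : B ≤ L) (hBy : (B : ℝ) ^ 2 ≤ y) (hyB : y ≤ ((B : ℝ) + 1) ^ 2)
    (hyL : y ≤ (L : ℝ) + 1) :
    |B * θ - ∑ l ∈ Ioc B L, (y / (l : ℝ) - y / ((l : ℝ) + θ))| ≤ 3 := by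
  have hB' : (1 : ℝ) ≤ B := by exact_mod_cast hB
  have hL0 : (0 : ℝ) ≤ L := L.cast_nonneg
  have hy : 0 ≤ y := (sq_nonneg _).trans hBy
  obtain ⟨h1, h2⟩ := sum_Ioc_div_sub_div_bounds hy hθ0 hθ1 hB hBL
  have a1 : y * (1 / (B : ℝ) - 1 / (L : ℝ)) ≤ B + 3 := by
    have : 0 ≤ y * (1 / (L : ℝ)) := by positivity
    have : y * (1 / (B : ℝ)) ≤ B + 3 := by
      rw [mul_one_div, div_le_iff₀ (by positivity)]
      nlinarith
    linarith
  have a2 : (B : ℝ) - 2 ≤ y * (1 / ((B : ℝ) + 1) - 1 / ((L : ℝ) + 1)) := by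
    have : y * (1 / ((L : ℝ) + 1)) ≤ 1 := by
      rw [mul_one_div, div_le_one (by positivity)]
      exact hyL
    have : (B : ℝ) - 1 ≤ y * (1 / ((B : ℝ) + 1)) := by
      rw [mul_one_div, le_div_iff₀ (by positivity)]
      nlinarith
    linarith
  have b1 := mul_le_mul_of_nonneg_left a1 hθ0
  have b2 := mul_le_mul_of_nonneg_left a2 hθ0
  rw [abs_le]
  constructor <;> nlinarith

lemma sum_filter_dvd_Icc {f : ℕ → ℝ} {q : ℕ} (hq : 1 ≤ q) (M : ℕ) :
    ∑ m ∈ Icc 1 M with q ∣ m, f m = ∑ l ∈ Icc 1 (M / q), f (q * l) := by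
  symm
  refine sum_bij (fun l _ => q * l) ?_ ?_ ?_ ?_
  · intro l hl
    obtain ⟨h1, h2⟩ := mem_Icc.mp hl
    rw [mem_filter, mem_Icc]
    refine ⟨⟨Nat.mul_pos hq h1, ?_⟩, dvd_mul_right _ _⟩
    rw [mul_comm]
    exact (Nat.le_div_iff_mul_le hq).mp h2
  · intro a _ b _ h
    exact Nat.eq_of_mul_eq_mul_left hq h
  · intro m hm
    rw [mem_filter, mem_Icc] at hm
    obtain ⟨⟨h1, h2⟩, l, rfl⟩ := hm
    refine ⟨l, mem_Icc.mpr ⟨Nat.pos_of_mul_pos_left h1, ?_⟩, rfl⟩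
    rw [Nat.le_div_iff_mul_le hq, mul_comm]
    exact h2
  · intros; rfl

lemma ite_dvd_floor_eq {a : ℝ} (ha : 1 ≤ a) {q : ℕ} (hq : 1 ≤ q) :
    (if q ∣ ⌊a⌋₊ then (1 : ℝ) else 0) =
      1 / q - (Int.fract (a / q) - 1 / 2) + (Int.fract (a / q - 1 / q) - 1 / 2) := by
  have hq' : (0 : ℝ) < q := by exact_mod_cast hq
  obtain ⟨m, hm⟩ : ∃ m, ⌊a⌋₊ = m + 1 := ⟨⌊a⌋₊ - 1, by
    have := Nat.floor_pos.mpr ha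
    omega⟩
  have h1 : ⌊a / q⌋₊ = (m + 1) / q := by rw [Nat.floor_div_natCast, hm]
  have h2 : ⌊a / q - 1 / q⌋₊ = m / q := by
    rw [← sub_div, Nat.floor_div_natCast, Nat.floor_sub_one, hm, Nat.add_sub_cancel]
  have h3 := Nat.succ_div (a := m) (b := q)
  have f1 := natCast_floor_eq_intCast_floor (R := ℝ) (a := a / q) (by positivity)
  have f2 := natCast_floor_eq_intCast_floor (R := ℝ) (a := a / q - 1 / q)
    (by rw [← sub_div]; exact div_nonneg (by linarith) hq'.le)
  rw [h1, h3] at f1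
  rw [h2] at f2
  rw [hm, Int.fract, Int.fract, ← f1, ← f2]
  split_ifs <;> push_cast <;> ring

lemma filter_dvd_floor_div_eq_Ioc {x : ℝ} (hx : 0 ≤ x) {q l B : ℕ} (hq : 1 ≤ q) (hl : 1 ≤ l) :
    ((Ioc B ⌊x⌋₊).filter fun n : ℕ => q ∣ ⌊x / n⌋₊).filter (fun n : ℕ => ⌊x / n⌋₊ / q = l) =
      Ioc (max B ⌊x / (q * l + 1)⌋₊) ⌊x / (q * l)⌋₊ := by
  have hq' : (1 : ℝ) ≤ q := by exact_mod_cast hq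
  have hl' : (1 : ℝ) ≤ l := by exact_mod_cast hl
  have hql : (1 : ℝ) ≤ q * l := by nlinarith
  ext n
  rw [mem_filter, mem_filter, mem_Ioc, mem_Ioc, max_lt_iff]
  rcases Nat.eq_zero_or_pos n with rfl | hn
  · simp
  have hn' : (0 : ℝ) < n := by exact_mod_cast hn
  have key : (q ∣ ⌊x / n⌋₊ ∧ ⌊x / n⌋₊ / q = l) ↔ ⌊x / n⌋₊ = q * l := by
    constructor
    · rintro ⟨h1, h2⟩
      rw [← h2, Nat.mul_div_cancel' h1]
    · intro h
      rw [h]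
      exact ⟨dvd_mul_right _ _, Nat.mul_div_cancel_left _ hq⟩
  have key2 : ⌊x / n⌋₊ = q * l ↔ ⌊x / (q * l + 1)⌋₊ < n ∧ n ≤ ⌊x / (q * l)⌋₊ := by
    rw [Nat.floor_eq_iff (by positivity), Nat.floor_lt (by positivity),
      Nat.le_floor_iff (by positivity), le_div_iff₀ hn', div_lt_iff₀ hn',
      div_lt_iff₀ (by positivity), le_div_iff₀ (by positivity)]
    push_cast
    constructor <;> rintro ⟨h1, h2⟩ <;> constructor <;> linarith
  have key3 : n ≤ ⌊x / (q * l)⌋₊ → n ≤ ⌊x⌋₊ := fun h =>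
    h.trans (Nat.floor_le_floor (div_le_self hx hql))
  constructor
  · rintro ⟨⟨⟨h1, h2⟩, h3⟩, h4⟩
    obtain ⟨h5, h6⟩ := key2.mp (key.mp ⟨h3, h4⟩)
    exact ⟨⟨h1, h5⟩, h6⟩
  · rintro ⟨⟨h1, h5⟩, h6⟩
    obtain ⟨h3, h4⟩ := key.mpr (key2.mpr ⟨h5, h6⟩)
    exact ⟨⟨⟨h1, key3 h6⟩, h3⟩, h4⟩

lemma natCast_floor_eq_sub {a : ℝ} (ha : 0 ≤ a) :
    (⌊a⌋₊ : ℝ) = a - 1 / 2 - (Int.fract a - 1 / 2) := by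
  rw [natCast_floor_eq_intCast_floor ha, Int.fract]
  ring

lemma sum_Icc_one_eq_add_sum_Ioc {R : Type*} [AddCommMonoid R] (f : ℕ → R) {B L : ℕ} (h : B ≤ L) :
    ∑ n ∈ Icc 1 L, f n = ∑ n ∈ Icc 1 B, f n + ∑ n ∈ Ioc B L, f n := by
  have : ∀ K, Icc 1 K = Ioc 0 K := fun K => by ext; simp [Nat.succ_le_iff]
  rw [this, this, sum_Ioc_consecutive f (Nat.zero_le B) h]

lemma card_filter_dvd_floor_Icc {x : ℝ} {q B : ℕ} (hq : 1 ≤ q) (hB : (B : ℝ) ≤ x) :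
    (#((Icc 1 B).filter fun n : ℕ => q ∣ ⌊x / (n : ℝ)⌋₊) : ℝ) =
      B * (1 / (q : ℝ)) - ∑ n ∈ Icc 1 B, (Int.fract (x / q / ((n : ℝ) + 0) - 0) - 1 / 2) +
        ∑ n ∈ Icc 1 B, (Int.fract (x / q / ((n : ℝ) + 0) - 1 / q) - 1 / 2) := by
  rw [card_filter]
  push_cast
  have : ∀ n ∈ Icc 1 B, (if q ∣ ⌊x / (n : ℝ)⌋₊ then (1 : ℝ) else 0) =
      1 / (q : ℝ) - (Int.fract (x / q / ((n : ℝ) + 0) - 0) - 1 / 2) +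
        (Int.fract (x / q / ((n : ℝ) + 0) - 1 / q) - 1 / 2) := by
    intro n hn
    obtain ⟨h1, h2⟩ := mem_Icc.mp hn
    have h1' : (0 : ℝ) < n := by exact_mod_cast h1
    have h2' : (n : ℝ) ≤ B := by exact_mod_cast h2
    rw [ite_dvd_floor_eq ((one_le_div h1').mpr (h2'.trans hB)) hq, add_zero, sub_zero,
      div_right_comm]
  rw [sum_congr rfl this, sum_add_distrib, sum_sub_distrib, sum_const, Nat.card_Icc, nsmul_eq_mul,
    Nat.add_sub_cancel]

lemma card_filter_dvd_floor_Ioc {x : ℝ} {q B : ℕ} (hq : 1 ≤ q) (hB : 1 ≤ B)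
    (hBx : (B : ℝ) ^ 2 ≤ x / q) (hxB : x / q < ((B : ℝ) + 1) ^ 2) :
    ∃ e : ℝ, 0 ≤ e ∧ e ≤ 1 ∧ (#((Ioc B ⌊x⌋₊).filter fun n : ℕ => q ∣ ⌊x / (n : ℝ)⌋₊) : ℝ) =
      ∑ l ∈ Icc 1 B, (x / q / (l : ℝ) - x / q / ((l : ℝ) + 1 / q)) -
        ∑ l ∈ Icc 1 B, (Int.fract (x / q / ((l : ℝ) + 0) - 0) - 1 / 2) +
        ∑ l ∈ Icc 1 B, (Int.fract (x / q / ((l : ℝ) + 1 / q) - 0) - 1 / 2) - e := by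
  have hq' : (1 : ℝ) ≤ q := by exact_mod_cast hq
  have hB' : (1 : ℝ) ≤ B := by exact_mod_cast hB
  have hx : 0 < x := by
    have : 0 < x / q := by nlinarith
    exact (div_pos_iff_of_pos_right (by linarith)).mp this
  set y := x / q with hy
  have hy0 : 0 < y := by positivity
  have hθ0 : 0 < 1 / (q : ℝ) := by positivity
  have hθ1 : 1 / (q : ℝ) ≤ 1 := (div_le_one (by linarith)).mpr hq'
  set θ := 1 / (q : ℝ) with hθ
  have hmaps : ∀ n ∈ (Ioc B ⌊x⌋₊).filter (fun n : ℕ => q ∣ ⌊x / (n : ℝ)⌋₊),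
      ⌊x / (n : ℝ)⌋₊ / q ∈ Icc 1 B := by
    intro n hn
    rw [mem_filter, mem_Ioc] at hn
    obtain ⟨⟨h1, h2⟩, h3⟩ := hn
    have hn0 : (0 : ℝ) < n := by exact_mod_cast (by omega : 0 < n)
    have hnx : (n : ℝ) ≤ x := (Nat.le_floor_iff hx.le).mp h2
    have hpos : 0 < ⌊x / (n : ℝ)⌋₊ := Nat.floor_pos.mpr ((one_le_div hn0).mpr hnx)
    rw [mem_Icc]
    refine ⟨Nat.div_pos (Nat.le_of_dvd hpos h3) hq, ?_⟩
    rw [← Nat.floor_div_natCast, div_right_comm, ← hy]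
    have hBn : (B : ℝ) + 1 ≤ n := by exact_mod_cast h1
    refine Nat.lt_add_one_iff.mp ((Nat.floor_lt (by positivity)).mpr ?_)
    rw [div_lt_iff₀ hn0]
    push_cast
    nlinarith
  set F : ℕ → ℕ := fun l => ⌊y / ((l : ℝ) + θ)⌋₊ with hF
  have hfib : ∀ l ∈ Icc 1 B, (#(((Ioc B ⌊x⌋₊).filter fun n : ℕ => q ∣ ⌊x / (n : ℝ)⌋₊).filter
      (fun n : ℕ => ⌊x / (n : ℝ)⌋₊ / q = l)) : ℝ) =
      (y / (l : ℝ) - y / ((l : ℝ) + θ)) - (Int.fract (y / ((l : ℝ) + 0) - 0) - 1 / 2) +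
      (Int.fract (y / ((l : ℝ) + θ) - 0) - 1 / 2) - (((B - F l : ℕ)) : ℝ) := by
    intro l hl
    obtain ⟨h1, h2⟩ := mem_Icc.mp hl
    have h1' : (1 : ℝ) ≤ l := by exact_mod_cast h1
    have h2' : (l : ℝ) ≤ B := by exact_mod_cast h2
    rw [filter_dvd_floor_div_eq_Ioc hx.le hq h1, Nat.card_Ioc]
    have e1 : x / (q * l) = y / l := by rw [hy, div_div]
    have e2 : x / (q * l + 1) = y / (l + θ) := by
      rw [hy, hθ, div_div]
      congr 1
      field_simp
    rw [e1, e2]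
    change (((⌊y / (l : ℝ)⌋₊ - max B (F l)) : ℕ) : ℝ) = _
    have g1 : B ≤ ⌊y / (l : ℝ)⌋₊ := by
      rw [Nat.le_floor_iff (by positivity), le_div_iff₀ (by positivity)]
      nlinarith
    have g2 : F l ≤ ⌊y / (l : ℝ)⌋₊ := by
      apply Nat.floor_le_floor
      gcongr
      linarith
    have g3 : ((⌊y / (l : ℝ)⌋₊ - max B (F l) : ℕ) : ℝ) =
        ⌊y / (l : ℝ)⌋₊ - F l - ((B - F l : ℕ) : ℝ) := by
      rw [Nat.cast_sub (max_le g1 g2), ← Nat.sub_add_eq_max, Nat.cast_add]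
      ring
    rw [g3, natCast_floor_eq_sub (by positivity), hF]
    simp only
    rw [natCast_floor_eq_sub (a := y / ((l : ℝ) + θ)) (by positivity), add_zero, sub_zero, sub_zero]
    ring
  refine ⟨∑ l ∈ Icc 1 B, ((B - F l : ℕ) : ℝ), sum_nonneg fun _ _ => Nat.cast_nonneg _, ?_, ?_⟩
  · rw [sum_eq_single_of_mem B (mem_Icc.mpr ⟨hB, le_rfl⟩)]
    · have : B - 1 ≤ F B := by
        rw [hF, Nat.le_floor_iff (by positivity), le_div_iff₀ (by positivity)]
        rw [Nat.cast_sub hB, Nat.cast_one]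
        nlinarith
      exact_mod_cast (by omega : B - F B ≤ 1)
    · intro l hl hlB
      obtain ⟨h1, h2⟩ := mem_Icc.mp hl
      have h3 : (l : ℝ) + 1 ≤ B := by exact_mod_cast (by omega : l + 1 ≤ B)
      have h4 : B ≤ F l := by
        rw [hF, Nat.le_floor_iff (by positivity), le_div_iff₀ (by positivity)]
        nlinarith
      rw [Nat.sub_eq_zero_of_le h4, Nat.cast_zero]
  · rw [card_eq_sum_card_fiberwise hmaps, Nat.cast_sum, sum_congr rfl hfib, sum_sub_distrib,
      sum_add_distrib, sum_sub_distrib]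

lemma abs_card_filter_dvd_floor_sub_le_of_le {x z : ℝ} {q M : ℕ} (hq : 1 ≤ q) (hM : x ≤ M)
    (hz : 1 ≤ z) (hzx : z ^ 3 = x / q) :
    |(#((Icc 1 ⌊x⌋₊).filter fun n : ℕ => q ∣ ⌊x / (n : ℝ)⌋₊) : ℝ) -
      ∑ m ∈ Icc 1 M with q ∣ m, 1 / ((m : ℝ) * (m + 1)) * x| ≤
      40000 * z * (Nat.log 2 ⌊x⌋₊ + 1) := by
  have hq' : (1 : ℝ) ≤ q := by exact_mod_cast hq
  have hz3 : 1 ≤ z ^ 3 := one_le_pow₀ hz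
  have hxq : x = z ^ 3 * q := by rw [hzx]; field_simp
  have hzx' : z ^ 3 ≤ x := by nlinarith
  set B := ⌊√(z ^ 3)⌋₊ with hBdef
  have hB : 1 ≤ B := Nat.floor_pos.mpr (Real.one_le_sqrt.mpr hz3)
  have hB' : (1 : ℝ) ≤ B := by exact_mod_cast hB
  have hsq : √(z ^ 3) ^ 2 = z ^ 3 := Real.sq_sqrt (by linarith)
  have hB1 : (B : ℝ) ≤ √(z ^ 3) := Nat.floor_le (Real.sqrt_nonneg _)
  have hB2 : √(z ^ 3) < B + 1 := Nat.lt_floor_add_one _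
  have hBz : (B : ℝ) ^ 2 ≤ z ^ 3 := by rw [← hsq]; gcongr
  have hzB : z ^ 3 < ((B : ℝ) + 1) ^ 2 := by rw [← hsq]; gcongr
  have hBz1 : (B : ℝ) ≤ z ^ 3 := by nlinarith
  have hBx : (B : ℝ) ≤ x := hBz1.trans hzx'
  have hBX : B ≤ ⌊x⌋₊ := Nat.le_floor hBx
  have hθ0 : 0 ≤ 1 / (q : ℝ) := by positivity
  have hθ1 : 1 / (q : ℝ) ≤ 1 := (div_le_one (by linarith)).mpr hq'
  have hcard : (#((Icc 1 ⌊x⌋₊).filter fun n : ℕ => q ∣ ⌊x / (n : ℝ)⌋₊) : ℝ) =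
      #((Icc 1 B).filter fun n : ℕ => q ∣ ⌊x / (n : ℝ)⌋₊) +
        #((Ioc B ⌊x⌋₊).filter fun n : ℕ => q ∣ ⌊x / (n : ℝ)⌋₊) := by
    rw [card_filter, card_filter, card_filter, sum_Icc_one_eq_add_sum_Ioc _ hBX, Nat.cast_add]
  obtain ⟨e, he0, he1, he⟩ := card_filter_dvd_floor_Ioc (x := x) hq hB
    (by rwa [← hzx]) (by rwa [← hzx])
  have hBL : B ≤ M / q := by
    rw [Nat.le_div_iff_mul_le hq]
    have : (B : ℝ) * q ≤ M := by nlinarith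
    exact_mod_cast this
  have hyL : z ^ 3 ≤ ((M / q : ℕ) : ℝ) + 1 := by
    rw [hzx, div_le_iff₀ (by linarith)]
    refine hM.trans ?_
    exact_mod_cast (Nat.lt_succ_iff.mp ((Nat.lt_div_mul_add hq).trans_le (by
      rw [add_mul]; omega : _ ≤ ((M / q) + 1) * q + 1)))
  have hmain : ∑ m ∈ Icc 1 M with q ∣ m, 1 / ((m : ℝ) * (m + 1)) * x =
      ∑ l ∈ Icc 1 B, (z ^ 3 / (l : ℝ) - z ^ 3 / ((l : ℝ) + 1 / q)) +
      ∑ l ∈ Ioc B (M / q), (z ^ 3 / (l : ℝ) - z ^ 3 / ((l : ℝ) + 1 / q)) := by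
    rw [← sum_Icc_one_eq_add_sum_Ioc _ hBL, sum_filter_dvd_Icc hq]
    refine sum_congr rfl fun l hl => ?_
    have : (0 : ℝ) < l := by exact_mod_cast (mem_Icc.mp hl).1
    rw [hxq]
    push_cast
    field_simp
    ring
  have hE := fun {θ τ : ℝ} (h0 : 0 ≤ θ) (h1 : θ ≤ 1) =>
    abs_sum_fract_hyperbola_le (τ := τ) hz h0 h1 hBz
  have hE1 := hE (θ := 0) (τ := 0) le_rfl zero_le_one
  have hE2 := hE (θ := 0) (τ := 1 / (q : ℝ)) le_rfl zero_le_one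
  have hE3 := hE (θ := 1 / (q : ℝ)) (τ := 0) hθ0 hθ1
  have hR := abs_mul_sub_sum_Ioc_le hθ0 hθ1 hB hBL hBz hzB.le hyL
  rw [hcard, he, card_filter_dvd_floor_Icc hq hBx, hmain, ← hzx]
  have hlog : (Nat.log 2 B : ℝ) ≤ Nat.log 2 ⌊x⌋₊ := by exact_mod_cast Nat.log_mono_right hBX
  have hl0 : (0 : ℝ) ≤ Nat.log 2 B := Nat.cast_nonneg _
  have hE4 : 8000 * z * (Nat.log 2 B + 1) ≤ 8000 * z * (Nat.log 2 ⌊x⌋₊ + 1) := by gcongr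
  have hE5 : 1 ≤ z * (Nat.log 2 ⌊x⌋₊ + 1) := by nlinarith
  rw [abs_le] at hE1 hE2 hE3 hR ⊢
  constructor <;> linarith [hE1.1, hE1.2, hE2.1, hE2.2, hE3.1, hE3.2, hR.1, hR.2]

lemma sum_Icc_one_div_mul_add_one_le_one (L : ℕ) :
    ∑ l ∈ Icc 1 L, 1 / ((l : ℝ) * (l + 1)) ≤ 1 := by
  suffices ∑ l ∈ Icc 1 L, 1 / ((l : ℝ) * (l + 1)) = 1 - 1 / ((L : ℝ) + 1) by
    rw [this]
    have : 0 ≤ 1 / ((L : ℝ) + 1) := by positivity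
    linarith
  induction L with
  | zero => simp
  | succ L ih =>
    rw [sum_Icc_succ_top (by omega), ih]
    push_cast
    field_simp
    ring

/-- The number of `n ≤ x` with `q ∣ ⌊x/n⌋`, with an error term uniform in `q`. -/
lemma abs_card_filter_dvd_floor_sub_le {x : ℝ} (hx : 1 ≤ x) {q M : ℕ} (hq : 1 ≤ q) (hM : x ≤ M) :
    |(#((Icc 1 ⌊x⌋₊).filter fun n : ℕ => q ∣ ⌊x / (n : ℝ)⌋₊) : ℝ) -
      ∑ m ∈ Icc 1 M with q ∣ m, 1 / ((m : ℝ) * (m + 1)) * x| ≤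
      40000 * (x / q) ^ ((1 : ℝ) / 3) * (Nat.log 2 ⌊x⌋₊ + 1) := by
  have hq' : (1 : ℝ) ≤ q := by exact_mod_cast hq
  have hxq : 0 < x / q := by positivity
  rcases le_or_gt 1 (x / q) with h | h
  · refine abs_card_filter_dvd_floor_sub_le_of_le hq hM (Real.one_le_rpow h (by norm_num)) ?_
    rw [← Real.rpow_natCast, ← Real.rpow_mul hxq.le]
    norm_num
  have hlt : x < q := by rwa [div_lt_one (by linarith)] at h
  have hcard : #((Icc 1 ⌊x⌋₊).filter fun n : ℕ => q ∣ ⌊x / (n : ℝ)⌋₊) = 0 := by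
    rw [card_eq_zero, filter_eq_empty_iff]
    intro n hn hdvd
    obtain ⟨h1, h2⟩ := mem_Icc.mp hn
    have h1' : (1 : ℝ) ≤ n := by exact_mod_cast h1
    have h2' : (n : ℝ) ≤ x := (Nat.le_floor_iff (by linarith)).mp h2
    have hpos : 0 < ⌊x / (n : ℝ)⌋₊ := Nat.floor_pos.mpr ((one_le_div (by linarith)).mpr h2')
    have h3 := Nat.le_of_dvd hpos hdvd
    have h4 : (q : ℝ) ≤ x / n := (Nat.le_floor_iff (by positivity)).mp h3
    have h5 : x / n ≤ x := div_le_self (by linarith) h1'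
    linarith
  have hsum0 : 0 ≤ ∑ m ∈ Icc 1 M with q ∣ m, 1 / ((m : ℝ) * (m + 1)) * x :=
    sum_nonneg fun _ _ => by positivity
  rw [hcard, Nat.cast_zero, zero_sub, abs_neg, abs_of_nonneg hsum0, sum_filter_dvd_Icc hq]
  have hle : ∑ l ∈ Icc 1 (M / q), 1 / (((q * l : ℕ) : ℝ) * ((q * l : ℕ) + 1)) * x ≤ x / q := by
    calc _ ≤ ∑ l ∈ Icc 1 (M / q), x / q * (1 / ((l : ℝ) * (l + 1))) := by
          refine sum_le_sum fun l hl => ?_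
          have hl : (1 : ℝ) ≤ l := by exact_mod_cast (mem_Icc.mp hl).1
          rw [div_mul_div_comm, one_div_mul_eq_div, mul_one, ← mul_assoc]
          push_cast
          gcongr
          nlinarith
      _ ≤ x / q * 1 := by
        rw [← mul_sum]
        gcongr
        exact sum_Icc_one_div_mul_add_one_le_one _
      _ = x / q := mul_one _
  refine hle.trans ?_
  have h1 : x / q ≤ (x / q) ^ ((1 : ℝ) / 3) :=
    Real.self_le_rpow_of_le_one hxq.le h.le (by norm_num)
  have h2 : (0 : ℝ) ≤ Nat.log 2 ⌊x⌋₊ := Nat.cast_nonneg _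
  have h3 : 0 ≤ (x / q) ^ ((1 : ℝ) / 3) := by positivity
  nlinarith [mul_nonneg h3 h2]

lemma lcm_id_pow_dvd {k m : ℕ} (s : Finset ℕ) (hs : ∀ d ∈ s, d ^ k ∣ m) : (s.lcm id) ^ k ∣ m := by
  induction s using Finset.induction_on with
  | empty => simp
  | insert a s _ ih =>
    rw [lcm_insert, id, lcm_eq_nat_lcm, ← Nat.pow_lcm_pow]
    exact Nat.lcm_dvd (hs a (mem_insert_self _ _)) (ih fun d hd => hs d (mem_insert_of_mem hd))

lemma muk_eq_sum_moebius {k m X : ℕ} (hk : 1 ≤ k) (hm : 1 ≤ m) (hmX : m ≤ X) :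
    muk k m = ∑ d ∈ Icc 1 X, if d ^ k ∣ m then (ArithmeticFunction.moebius d : ℝ) else 0 := by
  set s := (Icc 1 X).filter fun d => d ^ k ∣ m with hs
  set g := s.lcm id with hg
  have hgm : g ^ k ∣ m := lcm_id_pow_dvd s fun d hd => (mem_filter.mp hd).2
  have hg0 : g ≠ 0 := by
    intro h
    rw [h, zero_pow (by omega), zero_dvd_iff] at hgm
    omega
  have hdvd : ∀ d, d ^ k ∣ m ↔ d ∣ g := by
    intro d
    refine ⟨fun h => ?_, fun h => (pow_dvd_pow_of_dvd h k).trans hgm⟩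
    refine dvd_lcm (f := id) (mem_filter.mpr ⟨mem_Icc.mpr ⟨?_, ?_⟩, h⟩)
    · rcases Nat.eq_zero_or_pos d with rfl | hd
      · rw [zero_pow (by omega), zero_dvd_iff] at h
        omega
      · exact hd
    · exact ((Nat.le_self_pow (by omega) d).trans (Nat.le_of_dvd hm h)).trans hmX
  have hsg : s = g.divisors := by
    ext d
    rw [hs, mem_filter, mem_Icc, Nat.mem_divisors, hdvd]
    refine ⟨fun h => ⟨h.2, hg0⟩,
      fun h => ⟨⟨Nat.pos_of_dvd_of_pos h.1 (Nat.pos_of_ne_zero hg0), ?_⟩, h.1⟩⟩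
    have h2 := (hdvd d).mpr h.1
    exact ((Nat.le_self_pow (by omega) d).trans (Nat.le_of_dvd hm h2)).trans hmX
  have hfree : (∀ p : ℕ, p.Prime → ¬ p ^ k ∣ m) ↔ g = 1 := by
    simp only [hdvd]
    rw [Nat.eq_one_iff_not_exists_prime_dvd]
  have hmob : ∑ d ∈ g.divisors, ArithmeticFunction.moebius d = if g = 1 then 1 else 0 := by
    rw [← ArithmeticFunction.coe_mul_zeta_apply, ArithmeticFunction.moebius_mul_coe_zeta,
      ArithmeticFunction.one_apply]
  rw [← sum_filter, ← hs, hsg, ← Int.cast_sum, hmob, muk]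
  simp only [hfree]
  split_ifs <;> simp

lemma abs_sum_muk_sub_le {k : ℕ} (hk : 4 ≤ k) {x : ℝ} (hx : 1 ≤ x) {M : ℕ} (hM : x ≤ M) :
    |∑ n ∈ Icc 1 ⌊x⌋₊, muk k ⌊x / (n : ℝ)⌋₊ -
      (∑ m ∈ Icc 1 M, muk k m / ((m : ℝ) * (m + 1))) * x| ≤
      40000 * (∑' d : ℕ, 1 / (d : ℝ) ^ ((4 : ℝ) / 3)) * x ^ ((1 : ℝ) / 3) *
        (Nat.log 2 ⌊x⌋₊ + 1) := by
  have h1 : ∑ n ∈ Icc 1 ⌊x⌋₊, muk k ⌊x / (n : ℝ)⌋₊ = ∑ d ∈ Icc 1 M,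
      (ArithmeticFunction.moebius d : ℝ) *
        #((Icc 1 ⌊x⌋₊).filter fun n : ℕ => d ^ k ∣ ⌊x / (n : ℝ)⌋₊) := by
    have : ∀ n ∈ Icc 1 ⌊x⌋₊, muk k ⌊x / (n : ℝ)⌋₊ = ∑ d ∈ Icc 1 M,
        if d ^ k ∣ ⌊x / (n : ℝ)⌋₊ then (ArithmeticFunction.moebius d : ℝ) else 0 := by
      intro n hn
      obtain ⟨h1, h2⟩ := mem_Icc.mp hn
      have h1' : (1 : ℝ) ≤ n := by exact_mod_cast h1
      have h2' : (n : ℝ) ≤ x := (Nat.le_floor_iff (by linarith)).mp h2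
      refine muk_eq_sum_moebius (by omega)
        (Nat.floor_pos.mpr ((one_le_div (by linarith)).mpr h2')) ?_
      exact Nat.floor_le_of_le ((div_le_self (by linarith) h1').trans hM)
    rw [sum_congr rfl this, sum_comm]
    refine sum_congr rfl fun d _ => ?_
    rw [← sum_filter, sum_const, nsmul_eq_mul, mul_comm]
  have h2 : (∑ m ∈ Icc 1 M, muk k m / ((m : ℝ) * (m + 1))) * x = ∑ d ∈ Icc 1 M,
      (ArithmeticFunction.moebius d : ℝ) *
        ∑ m ∈ Icc 1 M with d ^ k ∣ m, 1 / ((m : ℝ) * (m + 1)) * x := by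
    have : ∀ m ∈ Icc 1 M, muk k m / ((m : ℝ) * (m + 1)) * x = ∑ d ∈ Icc 1 M,
        if d ^ k ∣ m then
          (ArithmeticFunction.moebius d : ℝ) * (1 / ((m : ℝ) * (m + 1)) * x) else 0 := by
      intro m hm
      obtain ⟨h1, h2⟩ := mem_Icc.mp hm
      rw [muk_eq_sum_moebius (by omega) h1 h2, sum_div, sum_mul]
      refine sum_congr rfl fun d _ => ?_
      split_ifs <;> ring
    rw [sum_mul, sum_congr rfl this, sum_comm]
    refine sum_congr rfl fun d _ => ?_
    rw [← sum_filter, mul_sum]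
  rw [h1, h2, ← sum_sub_distrib]
  have hsummable : Summable fun d : ℕ => 1 / (d : ℝ) ^ ((4 : ℝ) / 3) :=
    Real.summable_one_div_nat_rpow.mpr (by norm_num)
  calc _ ≤ ∑ d ∈ Icc 1 M, 40000 * x ^ ((1 : ℝ) / 3) * (Nat.log 2 ⌊x⌋₊ + 1) *
        (1 / (d : ℝ) ^ ((4 : ℝ) / 3)) := by
        refine (abs_sum_le_sum_abs _ _).trans (sum_le_sum fun d hd => ?_)
        have hd1 := (mem_Icc.mp hd).1
        have hd1' : (1 : ℝ) ≤ d := by exact_mod_cast hd1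
        rw [← mul_sub, abs_mul]
        have hmu : |(ArithmeticFunction.moebius d : ℝ)| ≤ 1 := by
          exact_mod_cast ArithmeticFunction.abs_moebius_le_one (n := d)
        have hA := abs_card_filter_dvd_floor_sub_le hx (Nat.one_le_pow k d hd1) hM
        have hpow : (x / ((d ^ k : ℕ) : ℝ)) ^ ((1 : ℝ) / 3) ≤
            x ^ ((1 : ℝ) / 3) * (1 / (d : ℝ) ^ ((4 : ℝ) / 3)) := by
          calc _ ≤ (x / (d : ℝ) ^ 4) ^ ((1 : ℝ) / 3) := by
                push_cast
                gcongr
            _ = x ^ ((1 : ℝ) / 3) / ((d : ℝ) ^ 4) ^ ((1 : ℝ) / 3) :=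
              Real.div_rpow (by linarith) (by positivity) _
            _ = _ := by
              rw [← Real.rpow_natCast, ← Real.rpow_mul (by linarith), div_eq_mul_one_div]
              norm_num
        calc _ ≤ 1 * _ := mul_le_mul hmu hA (abs_nonneg _) zero_le_one
          _ ≤ 1 * (40000 * (x ^ ((1 : ℝ) / 3) * (1 / (d : ℝ) ^ ((4 : ℝ) / 3))) *
              (Nat.log 2 ⌊x⌋₊ + 1)) := by gcongr
          _ = _ := by ring
    _ = 40000 * x ^ ((1 : ℝ) / 3) * (Nat.log 2 ⌊x⌋₊ + 1) *
        ∑ d ∈ Icc 1 M, 1 / (d : ℝ) ^ ((4 : ℝ) / 3) := by rw [mul_sum]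
    _ ≤ 40000 * x ^ ((1 : ℝ) / 3) * (Nat.log 2 ⌊x⌋₊ + 1) *
        ∑' d : ℕ, 1 / (d : ℝ) ^ ((4 : ℝ) / 3) := by
      gcongr
      exact hsummable.sum_le_tsum _ fun _ _ => by positivity
    _ = _ := by ring

lemma muk_nonneg (k n : ℕ) : 0 ≤ muk k n := by
  unfold muk
  split_ifs <;> norm_num

lemma muk_le_one (k n : ℕ) : muk k n ≤ 1 := by
  unfold muk
  split_ifs <;> norm_num

lemma tendsto_sum_muk_div (k : ℕ) :
    Tendsto (fun M : ℕ => ∑ m ∈ Icc 1 M, muk k m / ((m : ℝ) * (m + 1))) atTop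
      (nhds (∑' n : ℕ, muk k (n + 1) / (((n : ℝ) + 1) * ((n : ℝ) + 2)))) := by
  have hs : Summable fun n : ℕ => muk k (n + 1) / (((n : ℝ) + 1) * ((n : ℝ) + 2)) := by
    have h := (summable_nat_add_iff 1).mpr
      (Real.summable_one_div_nat_pow.mpr (by norm_num : 1 < 2))
    refine Summable.of_nonneg_of_le (fun n => ?_) (fun n => ?_) h
    · have := muk_nonneg k (n + 1)
      positivity
    · push_cast
      rw [sq]
      gcongr
      · exact muk_le_one _ _
      · norm_num
  convert hs.hasSum.tendsto_sum_nat using 2 with M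
  rw [← Ico_add_one_right_eq_Icc, sum_Ico_eq_sum_range, Nat.add_sub_cancel]
  refine sum_congr rfl fun n _ => ?_
  rw [add_comm 1 n]
  push_cast
  ring_nf

lemma natLog_floor_add_one_le {x : ℝ} (hx : 3 ≤ x) : (Nat.log 2 ⌊x⌋₊ + 1 : ℝ) ≤ 3 * Real.log x := by
  have h1 : 1 ≤ Real.log x := by
    rw [Real.le_log_iff_exp_le (by linarith)]
    linarith [Real.exp_one_lt_d9]
  have h2 : (Nat.log 2 ⌊x⌋₊ : ℝ) ≤ Real.logb 2 ⌊x⌋₊ := Real.natLog_le_logb _ _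
  have hpos : (0 : ℝ) < ⌊x⌋₊ := by exact_mod_cast Nat.floor_pos.mpr (by linarith)
  have h3 : Real.logb 2 ⌊x⌋₊ ≤ 2 * Real.log x := by
    rw [Real.logb, div_le_iff₀ (Real.log_pos one_lt_two)]
    have h4 := Real.log_le_log hpos (Nat.floor_le (by linarith))
    nlinarith [Real.log_two_gt_d9]
  linarith

/-- For fixed `k ≥ 4`, with `μ_k` the indicator of `k`-free numbers,
`∑_{n ≤ x} μ_k(⌊x/n⌋) = C_k x + O(x^{1/3} log x)` as `x → ∞`, where
`C_k = ∑_{n=1}^∞ μ_k(n)/(n(n+1))`. -/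
theorem kfree_floor_sum_asymptotic (k : ℕ) (hk : 4 ≤ k) :
    (fun x : ℝ => (∑ n ∈ Finset.Icc 1 ⌊x⌋₊, muk k ⌊x / (n : ℝ)⌋₊) -
        (∑' n : ℕ, muk k (n + 1) / (((n : ℝ) + 1) * ((n : ℝ) + 2))) * x)
      =O[atTop] fun x : ℝ => x ^ ((1 : ℝ) / 3) * Real.log x := by
  set Z : ℝ := ∑' d : ℕ, 1 / (d : ℝ) ^ ((4 : ℝ) / 3)
  have hZ : 0 ≤ Z := tsum_nonneg fun _ => by positivity
  refine IsBigO.of_bound (120000 * Z) ?_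
  filter_upwards [eventually_ge_atTop 3] with x hx
  have hlog : 0 ≤ Real.log x := Real.log_nonneg (by linarith)
  have hlim := (((tendsto_sum_muk_div k).mul_const x).const_sub
    (∑ n ∈ Icc 1 ⌊x⌋₊, muk k ⌊x / (n : ℝ)⌋₊)).abs
  have hle := le_of_tendsto hlim (b := 40000 * Z * x ^ ((1 : ℝ) / 3) * (Nat.log 2 ⌊x⌋₊ + 1)) <| by
    filter_upwards [eventually_ge_atTop ⌈x⌉₊] with M hM
    exact abs_sum_muk_sub_le hk (by linarith) (Nat.ceil_le.mp hM)
  have hrhs : 0 ≤ x ^ ((1 : ℝ) / 3) * Real.log x :=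
    mul_nonneg (Real.rpow_nonneg (by linarith) _) hlog
  rw [Real.norm_eq_abs, Real.norm_eq_abs, abs_of_nonneg hrhs]
  calc _ ≤ 40000 * Z * x ^ ((1 : ℝ) / 3) * (Nat.log 2 ⌊x⌋₊ + 1) := hle
    _ ≤ 40000 * Z * x ^ ((1 : ℝ) / 3) * (3 * Real.log x) := by
      gcongr
      exact natLog_floor_add_one_le hx
    _ = _ := by ring
end

section
/- Let μ₂ be the indicator function of the squarefree numbers. Then for every ε > 0, ∑_{n ≤ x} μ₂(⌊x/n⌋) = C · x + O_ε(x^{152/401+ε}) as x → ∞, where C = ∑_{n=1}^∞ μ₂(n)/(n(n+1)). -/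
open Finset Filter Asymptotics

lemma mul_add_emod_injOn {q : ℕ} {a k : ℤ} (hq : (0 : ℤ) < q) (hc : IsCoprime a (q : ℤ)) :
    Set.InjOn (fun h : ℕ => ((k + a * h) % q).toNat) (range q : Set ℕ) := by
  intro h1 hh1 h2 hh2 he
  simp only [coe_range, Set.mem_Iio] at hh1 hh2
  have e1 := Int.emod_nonneg (k + a * h1) hq.ne'
  have e2 := Int.emod_nonneg (k + a * h2) hq.ne'
  have he' : (k + a * h1) % q = (k + a * h2) % q := by
    simp only at he
    omega
  have hd : (q : ℤ) ∣ a * (h2 - h1) := by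
    have := Int.emod_emod_of_dvd
    have := (Int.emod_eq_emod_iff_emod_sub_eq_zero.1 he')
    have := Int.dvd_of_emod_eq_zero this
    rw [show a * ((h2 : ℤ) - h1) = -((k + a * h1) - (k + a * h2)) by ring]
    exact (dvd_neg.2 this)
  have hd2 := hc.symm.dvd_of_dvd_mul_left hd
  have := Int.eq_zero_of_abs_lt_dvd hd2 (by rw [abs_lt]; omega)
  omega

/-- Summing `fract (y + a h / q) - 1/2` over a complete residue system modulo `q`. -/
lemma abs_sum_fract_add_mul_div_sub_half_le (y : ℝ) (a : ℤ) (q : ℕ) (hq : 0 < q)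
    (hc : IsCoprime a (q : ℤ)) :
    |∑ h ∈ range q, (Int.fract (y + a * h / q) - 1 / 2)| ≤ 1 / 2 := by
  have hq' : (0 : ℝ) < q := by exact_mod_cast hq
  have hqz : (0 : ℤ) < q := by exact_mod_cast hq
  set k : ℤ := ⌊q * y⌋ with hk
  set θ : ℝ := Int.fract (q * y) with hθ
  have hy : q * y = k + θ := (Int.floor_add_fract _).symm
  have hfr : ∀ h : ℕ, Int.fract (y + a * h / q) = ((((k + a * h) % q : ℤ) : ℝ) + θ) / q := by
    intro h
    have h0 := Int.emod_nonneg (k + a * h) hqz.ne'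
    have h1 := Int.emod_lt_of_pos (k + a * h) hqz
    have h1' : (((k + a * h) % q : ℤ) : ℝ) + 1 ≤ q := by exact_mod_cast h1
    have h0' : (0 : ℝ) ≤ (((k + a * h) % q : ℤ) : ℝ) := by exact_mod_cast h0
    have hθ0 := Int.fract_nonneg (q * y)
    have hθ1 := Int.fract_lt_one (q * y)
    rw [Int.fract_eq_iff]
    refine ⟨by positivity, by rw [div_lt_one hq']; linarith, (k + a * h) / q, ?_⟩
    have h2 : (((k + a * h) % q : ℤ) : ℝ) = k + a * h - q * ((k + a * h) / q : ℤ) := by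
      rw [Int.emod_def]; push_cast; ring
    rw [h2]
    have : y = (k + θ) / q := by rw [← hy]; field_simp
    rw [this]; field_simp; ring
  have hperm : ∑ h ∈ range q, (((k + a * h) % q : ℤ) : ℝ) = ∑ j ∈ range q, (j : ℝ) := by
    refine Finset.sum_nbij (fun h : ℕ => ((k + a * h) % q).toNat) ?_ ?_ ?_ ?_
    · intro h _
      have h0 := Int.emod_nonneg (k + a * h) hqz.ne'
      have h1 := Int.emod_lt_of_pos (k + a * h) hqz
      simp only [mem_range]; omega
    · exact mul_add_emod_injOn hqz hc
    · refine Finset.surjOn_of_injOn_of_card_le _ ?_ (mul_add_emod_injOn hqz hc) le_rfl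
      intro h _
      have h0 := Int.emod_nonneg (k + a * h) hqz.ne'
      have h1 := Int.emod_lt_of_pos (k + a * h) hqz
      simp only [coe_range, Set.mem_Iio]; omega
    · intro h _
      have h0 := Int.emod_nonneg (k + a * h) hqz.ne'
      have : ((((k + a * h) % q).toNat : ℤ) : ℝ) = (((k + a * h) % q : ℤ) : ℝ) := by
        rw [Int.toNat_of_nonneg h0]
      rw [← this]; norm_cast
  have hsum : ∑ h ∈ range q, (Int.fract (y + a * h / q) - 1 / 2) = θ - 1 / 2 := by
    simp_rw [hfr]
    rw [Finset.sum_sub_distrib, ← Finset.sum_div, Finset.sum_add_distrib, hperm]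
    have hG : (∑ j ∈ range q, (j : ℝ)) = q * (q - 1) / 2 := by
      clear * -
      induction q with
      | zero => simp
      | succ n ih => rw [Finset.sum_range_succ, ih]; push_cast; ring
    rw [hG]; simp only [sum_const, card_range, nsmul_eq_mul]
    field_simp; ring
  rw [hsum, abs_le]
  have hθ0 := Int.fract_nonneg (q * y)
  have hθ1 := Int.fract_lt_one (q * y)
  constructor <;> linarith

lemma abs_sum_fract_sub_half_le_five (y : ℝ) (a : ℤ) (q : ℕ) (hq : 0 < q)
    (hc : IsCoprime a (q : ℤ)) (t : ℕ → ℝ)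
    (ht : ∀ h < q, |t h - (y + a * h / q)| ≤ 2 / q) :
    |∑ h ∈ range q, (Int.fract (t h) - 1 / 2)| ≤ 5 := by
  have hq' : (0 : ℝ) < q := by exact_mod_cast hq
  have h4 : ∑ h ∈ range q, (4 / q : ℝ) = 4 := by
    simp only [sum_const, card_range, nsmul_eq_mul]; field_simp
  have up := abs_le.1 (abs_sum_fract_add_mul_div_sub_half_le (y - 2 / q) a q hq hc)
  have lo := abs_le.1 (abs_sum_fract_add_mul_div_sub_half_le (y + 2 / q) a q hq hc)
  have key : ∀ u v : ℝ, u ≤ v → Int.fract v - Int.fract u ≤ v - u := by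
    intro u v huv
    have : (⌊u⌋ : ℝ) ≤ ⌊v⌋ := by exact_mod_cast Int.floor_mono huv
    rw [← Int.self_sub_floor, ← Int.self_sub_floor]; linarith
  have c1 : ∑ h ∈ range q, (Int.fract (t h) - 1 / 2) ≤
      ∑ h ∈ range q, ((Int.fract (y - 2 / q + a * h / q) - 1 / 2) + 4 / q) := by
    refine Finset.sum_le_sum fun h hh => ?_
    have := abs_le.1 (ht h (mem_range.1 hh))
    have := key (y - 2 / q + a * h / q) (t h) (by linarith)
    have e : (4 / q : ℝ) = 2 / q + 2 / q := by ring
    linarith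
  have c2 : ∑ h ∈ range q, ((Int.fract (y + 2 / q + a * h / q) - 1 / 2) - 4 / q) ≤
      ∑ h ∈ range q, (Int.fract (t h) - 1 / 2) := by
    refine Finset.sum_le_sum fun h hh => ?_
    have := abs_le.1 (ht h (mem_range.1 hh))
    have := key (t h) (y + 2 / q + a * h / q) (by linarith)
    have e : (4 / q : ℝ) = 2 / q + 2 / q := by ring
    linarith
  rw [Finset.sum_add_distrib, h4] at c1
  rw [Finset.sum_sub_distrib, h4] at c2
  rw [abs_le]; constructor <;> linarith

/-- Greedy decomposition of an interval into blocks of bounded length. -/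
lemma abs_sum_Ico_le_of_blocks (f G : ℕ → ℝ) (Q B : ℕ) (hf : ∀ n, |f n| ≤ 1)
    (hG : ∀ n, 0 ≤ G n) (A : ℕ)
    (h : ∀ n, A ≤ n → n < B → ∃ q, 1 ≤ q ∧ q ≤ Q ∧
      (n + q ≤ B → |∑ i ∈ Ico n (n + q), f i| ≤ ∑ i ∈ Ico n (n + q), G i)) :
    |∑ i ∈ Ico A B, f i| ≤ ∑ i ∈ Ico A B, G i + Q := by
  induction hd : B - A using Nat.strong_induction_on generalizing A with
  | _ d ih =>
    by_cases hAB : B ≤ A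
    · simp [Finset.Ico_eq_empty_of_le hAB]
    push Not at hAB
    obtain ⟨q, hq1, hqQ, hq⟩ := h A le_rfl hAB
    by_cases hB : A + q ≤ B
    · have h1 := hq hB
      have h2 := ih (B - (A + q)) (by omega) (A + q)
        (fun n hn hnB => h n (by omega) hnB) rfl
      rw [← Finset.sum_Ico_consecutive f (by omega : A ≤ A + q) hB,
        ← Finset.sum_Ico_consecutive G (by omega : A ≤ A + q) hB]
      refine (abs_add_le _ _).trans ?_
      linarith
    · have h1 : |∑ i ∈ Ico A B, f i| ≤ ∑ i ∈ Ico A B, (1 : ℝ) :=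
        (Finset.abs_sum_le_sum_abs _ _).trans (Finset.sum_le_sum fun i _ => hf i)
      have h2 : ∑ i ∈ Ico A B, (1 : ℝ) ≤ Q := by
        simp only [sum_const, Nat.card_Ico, nsmul_eq_mul, mul_one]
        exact_mod_cast (by omega : B - A ≤ Q)
      have h3 : 0 ≤ ∑ i ∈ Ico A B, G i := Finset.sum_nonneg fun i _ => hG i
      linarith

lemma card_le_add_one_of_sub_le (S : Finset ℕ) (D : ℝ) (hD : 0 ≤ D)
    (h : ∀ m ∈ S, ∀ n ∈ S, m ≤ n → (n : ℝ) - m ≤ D) : (#S : ℝ) ≤ D + 1 := by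
  rcases S.eq_empty_or_nonempty with rfl | hS
  · simp; linarith
  have hsub : S ⊆ Icc (S.min' hS) (S.min' hS + ⌊D⌋₊) := by
    intro n hn
    have h1 := S.min'_le n hn
    have h2 := h _ (S.min'_mem hS) n hn h1
    have h3 : n - S.min' hS ≤ ⌊D⌋₊ := Nat.le_floor (by rw [Nat.cast_sub h1]; exact h2)
    rw [mem_Icc]; omega
  have h1 := Finset.card_le_card hsub
  have h3 : #S ≤ ⌊D⌋₊ + 1 := by
    rw [Nat.card_Icc] at h1; omega
  calc (#S : ℝ) ≤ ⌊D⌋₊ + 1 := by exact_mod_cast h3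
    _ ≤ D + 1 := by linarith [Nat.floor_le hD]

lemma abs_div_add_sub_taylor_le {X u h N : ℝ} (hX : 0 ≤ X) (hN : 0 < N) (hu : N ≤ u)
    (hh : 0 ≤ h) : |X / (u + h) - (X / u - h * (X / u ^ 2))| ≤ h ^ 2 * (X / N ^ 3) := by
  have hu0 : 0 < u := hN.trans_le hu
  have e : X / (u + h) - (X / u - h * (X / u ^ 2)) = h ^ 2 * (X / (u ^ 2 * (u + h))) := by
    field_simp; ring
  rw [e, abs_of_nonneg (by positivity)]
  have : N ^ 3 ≤ u ^ 2 * (u + h) := by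
    calc N ^ 3 = N ^ 2 * N := by ring
      _ ≤ u ^ 2 * (u + h) := by gcongr; linarith
  gcongr

lemma div_sq_sub_div_sq_le {X u v N : ℝ} (hX : 0 ≤ X) (hN : 0 < N) (hu : N ≤ u) (huv : u ≤ v) :
    X / u ^ 2 - X / v ^ 2 ≤ (v - u) * (2 * (X / N ^ 3)) := by
  have hu0 : 0 < u := hN.trans_le hu
  have hv0 : 0 < v := hu0.trans_le huv
  have e : X / u ^ 2 - X / v ^ 2 = (v - u) * (X / (u ^ 2 * v) + X / (u * v ^ 2)) := by
    field_simp; ring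
  rw [e]
  have h1 : N ^ 3 ≤ u ^ 2 * v := by
    calc N ^ 3 = N ^ 2 * N := by ring
      _ ≤ u ^ 2 * v := by gcongr; linarith
  have h2 : N ^ 3 ≤ u * v ^ 2 := by
    calc N ^ 3 = N * N ^ 2 := by ring
      _ ≤ u * v ^ 2 := by gcongr; linarith
  have h3 : X / (u ^ 2 * v) ≤ X / N ^ 3 := by gcongr
  have h4 : X / (u * v ^ 2) ≤ X / N ^ 3 := by gcongr
  exact mul_le_mul_of_nonneg_left (by linarith) (by linarith)

lemma le_div_sq_sub_div_sq {X u v N : ℝ} (hX : 0 ≤ X) (hN : 0 < N) (hu : N ≤ u) (huv : u ≤ v)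
    (hv : v ≤ 4 * N) : (v - u) * (X / (32 * N ^ 3)) ≤ X / u ^ 2 - X / v ^ 2 := by
  have hu0 : 0 < u := hN.trans_le hu
  have hv0 : 0 < v := hu0.trans_le huv
  have e : X / u ^ 2 - X / v ^ 2 = (v - u) * (X / (u ^ 2 * v) + X / (u * v ^ 2)) := by
    field_simp; ring
  rw [e]
  have h1 : u ^ 2 * v ≤ 64 * N ^ 3 := by
    calc u ^ 2 * v ≤ (4 * N) ^ 2 * (4 * N) := by gcongr; linarith
      _ = _ := by ring
  have h2 : u * v ^ 2 ≤ 64 * N ^ 3 := by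
    calc u * v ^ 2 ≤ (4 * N) * (4 * N) ^ 2 := by gcongr; linarith
      _ = _ := by ring
  have h3 : X / (64 * N ^ 3) ≤ X / (u ^ 2 * v) := by gcongr
  have h4 : X / (64 * N ^ 3) ≤ X / (u * v ^ 2) := by gcongr
  have h5 : X / (32 * N ^ 3) = X / (64 * N ^ 3) + X / (64 * N ^ 3) := by ring
  exact mul_le_mul_of_nonneg_left (by linarith) (by linarith)

/-- A function dominating, on each short block, the reciprocal of the denominator of a rational
approximation to `Y ^ 3 / (n + α) ^ 2`. -/
noncomputable def rationalWeight (Y α Q N : ℝ) (n : ℕ) : ℝ :=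
  ∑ q ∈ Icc 1 ⌊Q⌋₊, ∑ a ∈ Icc 1 ⌊2 * q * N / Q ^ 3⌋₊,
    if |Y ^ 3 / (n + α) ^ 2 - (a : ℝ) / q| ≤ 3 / (q * Q) then (1 / q : ℝ) else 0

lemma sum_rationalWeight_le {Y α Q : ℝ} {N B : ℕ} (hα0 : 0 ≤ α) (hα1 : α ≤ 1)
    (hN : 1 ≤ N) (hQ : 1 ≤ Q) (hY : 0 < Y) (hQY : Q = N / Y) (hB : B ≤ 3 * N + 1) :
    ∑ n ∈ Ico (N + 1) B, rationalWeight Y α Q N n ≤ 386 * Y * (1 + Real.log Q) := by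
  have hN' : (1 : ℝ) ≤ N := by exact_mod_cast hN
  have hN0 : (0 : ℝ) < N := by linarith
  have hQ0 : 0 < Q := by linarith
  have hXN : Y ^ 3 / (32 * (N : ℝ) ^ 3) = 1 / (32 * Q ^ 3) := by rw [hQY]; field_simp
  unfold rationalWeight
  rw [Finset.sum_comm]
  have hcount : ∀ q ∈ Icc 1 ⌊Q⌋₊, ∀ a : ℕ,
      ∑ n ∈ Ico (N + 1) B,
        (if |Y ^ 3 / (n + α) ^ 2 - (a : ℝ) / q| ≤ 3 / (q * Q) then (1 / q : ℝ) else 0)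
      ≤ 193 * Q ^ 2 / q * (1 / q) := by
    intro q hq a
    rw [mem_Icc] at hq
    have hq1 : (1 : ℝ) ≤ q := by exact_mod_cast hq.1
    have hqQ : (q : ℝ) ≤ Q := (Nat.cast_le.2 hq.2).trans (Nat.floor_le hQ0.le)
    have hq0 : (0 : ℝ) < q := by linarith
    rw [← Finset.sum_filter, Finset.sum_const, nsmul_eq_mul]
    refine mul_le_mul_of_nonneg_right ?_ (by positivity)
    have := card_le_add_one_of_sub_le
      ((Ico (N + 1) B).filter fun n : ℕ => |Y ^ 3 / (n + α) ^ 2 - (a : ℝ) / q| ≤ 3 / (q * Q))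
      (192 * Q ^ 2 / q) (by positivity) ?_
    · refine this.trans ?_
      have : 1 ≤ Q ^ 2 / q := by
        rw [le_div_iff₀ hq0]; nlinarith
      have e1 : 192 * Q ^ 2 / q = 192 * (Q ^ 2 / q) := by ring
      have e2 : 193 * Q ^ 2 / q = 193 * (Q ^ 2 / q) := by ring
      rw [e1, e2]; linarith
    · intro m hm n hn hmn
      simp only [mem_filter, mem_Ico] at hm hn
      have hm1 := abs_le.1 hm.2
      have hn1 := abs_le.1 hn.2
      have hmN : (N : ℝ) + 1 ≤ m := by exact_mod_cast hm.1.1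
      have hnN : (n : ℝ) ≤ 3 * N := by exact_mod_cast (by omega : n ≤ 3 * N)
      have hmn' : (m : ℝ) ≤ n := by exact_mod_cast hmn
      have := le_div_sq_sub_div_sq (X := Y ^ 3) (u := m + α) (v := n + α) (N := N)
        (by positivity) hN0 (by linarith) (by linarith) (by linarith)
      rw [hXN] at this
      have h2 : ((n : ℝ) - m) * (1 / (32 * Q ^ 3)) ≤ 6 / (q * Q) := by
        have e : (6 : ℝ) / (q * Q) = 3 / (q * Q) + 3 / (q * Q) := by ring
        have e' : (n : ℝ) + α - (m + α) = n - m := by ring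
        rw [e'] at this
        linarith
      have h3 : (n : ℝ) - m = ((n : ℝ) - m) * (1 / (32 * Q ^ 3)) * (32 * Q ^ 3) := by
        field_simp
      rw [h3]
      calc _ ≤ 6 / (q * Q) * (32 * Q ^ 3) := by gcongr
        _ = _ := by field_simp; norm_num
  have hq : ∀ q ∈ Icc 1 ⌊Q⌋₊, ∑ n ∈ Ico (N + 1) B, ∑ a ∈ Icc 1 ⌊2 * (q : ℝ) * N / Q ^ 3⌋₊,
      (if |Y ^ 3 / (n + α) ^ 2 - (a : ℝ) / q| ≤ 3 / (q * Q) then (1 / q : ℝ) else 0)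
      ≤ 386 * Y * (q : ℝ)⁻¹ := by
    intro q hq
    rw [Finset.sum_comm]
    have hq' := hq
    rw [mem_Icc] at hq
    have hq1 : (1 : ℝ) ≤ q := by exact_mod_cast hq.1
    have hq0 : (0 : ℝ) < q := by linarith
    refine (Finset.sum_le_sum fun a _ => hcount q hq' a).trans ?_
    rw [Finset.sum_const, nsmul_eq_mul, Nat.card_Icc, Nat.add_sub_cancel]
    have hf := Nat.floor_le (by positivity : 0 ≤ 2 * (q : ℝ) * N / Q ^ 3)
    calc _ ≤ 2 * (q : ℝ) * N / Q ^ 3 * (193 * Q ^ 2 / q * (1 / q)) := by gcongr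
      _ = 386 * Y * (q : ℝ)⁻¹ := by rw [hQY]; field_simp; norm_num
  refine (Finset.sum_le_sum hq).trans ?_
  rw [← Finset.mul_sum]
  refine mul_le_mul_of_nonneg_left ?_ (by positivity)
  have h1 := harmonic_floor_le_one_add_log Q hQ
  have : ((harmonic ⌊Q⌋₊ : ℚ) : ℝ) = ∑ q ∈ Icc 1 ⌊Q⌋₊, (q : ℝ)⁻¹ := by
    rw [harmonic_eq_sum_Icc]; push_cast; rfl
  rw [← this]; exact h1

/-- Estimate for the sawtooth function along `Y ^ 3 / (n + α) + β` over a dyadic range. -/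
lemma abs_sum_Ico_fract_le {Y α β : ℝ} {N B : ℕ} (hY : 1 ≤ Y) (hα0 : 0 ≤ α) (hα1 : α ≤ 1)
    (hN : 1 ≤ N) (hNY : 17 * (N : ℝ) ≤ Y ^ 2) (hB : B ≤ 3 * N + 1) :
    |∑ n ∈ Ico (N + 1) B, (Int.fract (Y ^ 3 / (n + α) + β) - 1 / 2)|
      ≤ 2000 * Y * (1 + Real.log Y) := by
  have hN' : (1 : ℝ) ≤ N := by exact_mod_cast hN
  have hN0 : (0 : ℝ) < N := by linarith
  have hY0 : 0 < Y := by linarith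
  have hlogY := Real.log_nonneg hY
  have hpsi : ∀ n : ℕ, |Int.fract (Y ^ 3 / ((n : ℝ) + α) + β) - 1 / 2| ≤ 1 := fun n => by
    have h0 := Int.fract_nonneg (Y ^ 3 / ((n : ℝ) + α) + β)
    have h1 := Int.fract_lt_one (Y ^ 3 / ((n : ℝ) + α) + β)
    rw [abs_le]; constructor <;> linarith
  set Q : ℝ := N / Y with hQdef
  have hQYN : Q * Y = N := by rw [hQdef]; field_simp
  have hQleY : Q ≤ Y := by
    rw [hQdef, div_le_iff₀ hY0]; nlinarith
  rcases lt_or_ge Q 8 with hQ8 | hQ8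
  · have h1 : |∑ n ∈ Ico (N + 1) B, (Int.fract (Y ^ 3 / ((n : ℝ) + α) + β) - 1 / 2)|
        ≤ ∑ n ∈ Ico (N + 1) B, (1 : ℝ) :=
      (Finset.abs_sum_le_sum_abs _ _).trans (Finset.sum_le_sum fun i _ => hpsi i)
    have h2 : ∑ n ∈ Ico (N + 1) B, (1 : ℝ) ≤ 2 * N := by
      simp only [sum_const, Nat.card_Ico, nsmul_eq_mul, mul_one]
      exact_mod_cast (by omega : B - (N + 1) ≤ 2 * N)
    have h3 : (N : ℝ) ≤ 8 * Y := by rw [← hQYN]; gcongr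
    nlinarith [mul_nonneg hY0.le hlogY]
  have hQ0 : 0 < Q := by linarith
  have hfl : 8 ≤ ⌊Q⌋₊ := Nat.le_floor (by exact_mod_cast hQ8)
  have hX : Y ^ 3 / (N : ℝ) ^ 3 = 1 / Q ^ 3 := by rw [hQdef]; field_simp
  have hGnn : ∀ n, 0 ≤ 5 * rationalWeight Y α Q N n := by
    intro n
    unfold rationalWeight
    refine mul_nonneg (by norm_num) (Finset.sum_nonneg fun q _ => Finset.sum_nonneg fun a _ => ?_)
    split_ifs <;> positivity
  have main := abs_sum_Ico_le_of_blocks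
    (fun n : ℕ => Int.fract (Y ^ 3 / ((n : ℝ) + α) + β) - 1 / 2)
    (fun n => 5 * rationalWeight Y α Q N n) ⌊Q⌋₊ B hpsi hGnn (N + 1) ?_
  · refine main.trans ?_
    rw [← Finset.mul_sum]
    have h1 := sum_rationalWeight_le hα0 hα1 hN (by linarith) hY0 hQdef hB
    have h2 := Nat.floor_le hQ0.le
    have h3 : Real.log Q ≤ Real.log Y := Real.log_le_log hQ0 hQleY
    have h4 : Y * Real.log Q ≤ Y * Real.log Y := by gcongr
    nlinarith [mul_nonneg hY0.le hlogY]
  intro n hn hnB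
  have hnN : (N : ℝ) + 1 ≤ n := by exact_mod_cast hn
  have hn3 : (n : ℝ) ≤ 3 * N := by exact_mod_cast (by omega : n ≤ 3 * N)
  set u : ℝ := n + α with hu
  have huN : (N : ℝ) ≤ u := by linarith
  have hu4 : u ≤ 4 * N := by linarith
  have hu0 : 0 < u := by linarith
  set s : ℝ := Y ^ 3 / u ^ 2 with hs
  obtain ⟨r, hr, hrden⟩ := Real.exists_rat_abs_sub_le_and_den_le s (by omega : 0 < ⌊Q⌋₊)
  set q := r.den with hqdef
  have hq1 : 1 ≤ q := r.den_pos
  have hq1' : (1 : ℝ) ≤ q := by exact_mod_cast hq1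
  have hq0 : (0 : ℝ) < q := by linarith
  have hqQ : (q : ℝ) ≤ Q := (Nat.cast_le.2 hrden).trans (Nat.floor_le hQ0.le)
  have hrcast : (r : ℝ) = (r.num : ℝ) / q := by rw [hqdef]; exact Rat.cast_def r
  have hr' : |s - (r.num : ℝ) / q| ≤ 1 / (q * Q) := by
    rw [← hrcast]
    refine hr.trans ?_
    have := (Nat.lt_floor_add_one Q).le
    rw [mul_comm (q : ℝ) Q]
    gcongr
  have hsmall : 1 / (q * Q) ≤ 1 / Q := by
    gcongr; nlinarith
  have hslow : 1 / Q < s := by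
    have : 1 / Q = Y / N := by rw [hQdef]; field_simp
    rw [this, hs, div_lt_div_iff₀ hN0 (by positivity)]
    have : u ^ 2 ≤ (4 * N) ^ 2 := by gcongr
    have h16 : 16 * (N : ℝ) < Y ^ 2 := by linarith
    calc Y * u ^ 2 ≤ Y * (4 * N) ^ 2 := by gcongr
      _ = Y * N * (16 * N) := by ring
      _ < Y * N * Y ^ 2 := by gcongr
      _ = _ := by ring
  have hr1 := abs_le.1 hr'
  have hnumpos : 0 < r.num := by
    have : 0 < (r.num : ℝ) / q := by linarith
    have := (div_pos_iff_of_pos_right hq0).1 this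
    exact_mod_cast this
  obtain ⟨a, ha⟩ := Int.eq_ofNat_of_zero_le hnumpos.le
  have ha1 : 1 ≤ a := by omega
  have ha1' : (1 : ℝ) ≤ a := by exact_mod_cast ha1
  have hacast : (r.num : ℝ) = a := by rw [ha]; simp
  rw [hacast] at hr' hr1
  refine ⟨q, hq1, hrden, fun hnq => ?_⟩
  have hqq : (q : ℝ) ^ 2 * (1 / Q ^ 3) ≤ 1 / q := by
    rw [mul_one_div, div_le_div_iff₀ (by positivity) hq0, one_mul]
    calc (q : ℝ) ^ 2 * q = (q : ℝ) ^ 3 := by ring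
      _ ≤ Q ^ 3 := by gcongr
  have hQq : 1 / Q ≤ 1 / q := by gcongr
  have hleft : |∑ i ∈ Ico n (n + q), (Int.fract (Y ^ 3 / ((i : ℝ) + α) + β) - 1 / 2)| ≤ 5 := by
    rw [Finset.sum_Ico_eq_sum_range, Nat.add_sub_cancel_left]
    refine abs_sum_fract_sub_half_le_five (Y ^ 3 / u + β) (-r.num) q hq1 ?_
      (fun h => Y ^ 3 / (((n + h : ℕ) : ℝ) + α) + β) ?_
    · rw [IsCoprime.neg_left_iff, Int.isCoprime_iff_gcd_eq_one]
      exact r.reduced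
    · intro h hh
      have hh' : (h : ℝ) ≤ q := by exact_mod_cast hh.le
      have h0 : (0 : ℝ) ≤ h := Nat.cast_nonneg h
      have t1 := abs_div_add_sub_taylor_le (X := Y ^ 3) (u := u) (h := h) (N := N)
        (by positivity) hN0 huN h0
      rw [hX] at t1
      have t2 : (h : ℝ) ^ 2 * (1 / Q ^ 3) ≤ 1 / q := by
        refine le_trans ?_ hqq
        gcongr
      have t3 : |(h : ℝ) * (s - a / q)| ≤ 1 / q := by
        rw [abs_mul, abs_of_nonneg h0]
        calc (h : ℝ) * |s - a / q| ≤ q * (1 / (q * Q)) := by gcongr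
          _ = 1 / Q := by field_simp
          _ ≤ _ := hQq
      have e : Y ^ 3 / (((n + h : ℕ) : ℝ) + α) + β - (Y ^ 3 / u + β + ((-r.num : ℤ) : ℝ) * h / q)
          = (Y ^ 3 / (u + h) - (Y ^ 3 / u - h * (Y ^ 3 / u ^ 2))) - h * (s - a / q) := by
        push_cast
        rw [hacast, show (n : ℝ) + h + α = u + h by rw [hu]; ring, ← hs]
        ring
      rw [e]
      refine (abs_sub _ _).trans ?_
      have : (2 : ℝ) / q = 1 / q + 1 / q := by ring
      linarith
  refine hleft.trans ?_
  have hG : ∀ i ∈ Ico n (n + q), (5 : ℝ) / q ≤ 5 * rationalWeight Y α Q N i := by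
    intro i hi
    rw [mem_Ico] at hi
    have hi1 : (n : ℝ) ≤ i := by exact_mod_cast hi.1
    have hi2 : (i : ℝ) ≤ n + q := by exact_mod_cast hi.2.le
    have hcond : |Y ^ 3 / ((i : ℝ) + α) ^ 2 - (a : ℝ) / q| ≤ 3 / (q * Q) := by
      have d1 := div_sq_sub_div_sq_le (X := Y ^ 3) (u := u) (v := i + α) (N := N)
        (by positivity) hN0 huN (by linarith)
      have d0 : 0 ≤ Y ^ 3 / u ^ 2 - Y ^ 3 / ((i : ℝ) + α) ^ 2 := by
        rw [sub_nonneg]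
        gcongr
        linarith
      rw [hX] at d1
      have d2 : ((i : ℝ) + α - u) * (2 * (1 / Q ^ 3)) ≤ 2 / (q * Q) := by
        calc _ ≤ (q : ℝ) * (2 * (1 / Q ^ 3)) := by gcongr; linarith
          _ = 2 / q * (q ^ 2 * (1 / Q ^ 2)) * (1 / Q) := by field_simp
          _ ≤ 2 / q * 1 * (1 / Q) := by
              gcongr
              rw [mul_one_div, div_le_one (by positivity)]
              gcongr
          _ = _ := by field_simp
      have e3 : (3 : ℝ) / (q * Q) = 1 / (q * Q) + 2 / (q * Q) := by ring
      rw [abs_le]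
      constructor <;> linarith
    have hmem : a ∈ Icc 1 ⌊2 * (q : ℝ) * N / Q ^ 3⌋₊ := by
      rw [mem_Icc]
      refine ⟨ha1, Nat.le_floor ?_⟩
      have hs2 : s ≤ N / Q ^ 3 := by
        have : (N : ℝ) / Q ^ 3 = Y ^ 3 / N ^ 2 := by rw [hQdef]; field_simp
        rw [this, hs]
        gcongr
      have h1 : (a : ℝ) / q ≤ N / Q ^ 3 + 1 / (q * Q) := by linarith
      have h2 : (a : ℝ) ≤ q * (N / Q ^ 3) + 1 / Q := by
        calc (a : ℝ) = q * (a / q) := by field_simp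
          _ ≤ q * (N / Q ^ 3 + 1 / (q * Q)) := by gcongr
          _ = _ := by field_simp
      have h3 : 1 / Q ≤ 1 / 2 := by gcongr; linarith
      have e : 2 * (q : ℝ) * N / Q ^ 3 = 2 * (q * (N / Q ^ 3)) := by ring
      rw [e]; linarith
    have : (1 : ℝ) / q ≤ rationalWeight Y α Q N i := by
      unfold rationalWeight
      have hnn : ∀ (q' a' : ℕ), (0 : ℝ) ≤
          if |Y ^ 3 / ((i : ℝ) + α) ^ 2 - (a' : ℝ) / q'| ≤ 3 / (q' * Q)
            then (1 / q' : ℝ) else 0 := by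
        intro q' a'; split_ifs <;> positivity
      refine le_trans ?_ (Finset.single_le_sum
        (fun q' _ => Finset.sum_nonneg fun a' _ => hnn q' a') (mem_Icc.2 ⟨hq1, hrden⟩))
      refine le_trans ?_ (Finset.single_le_sum (fun a' _ => hnn q a') hmem)
      rw [if_pos hcond]
    calc (5 : ℝ) / q = 5 * (1 / q) := by ring
      _ ≤ _ := by gcongr
  calc (5 : ℝ) = ∑ i ∈ Ico n (n + q), (5 : ℝ) / q := by
        simp only [sum_const, Nat.card_Ico, nsmul_eq_mul, Nat.add_sub_cancel_left]; field_simp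
    _ ≤ _ := Finset.sum_le_sum hG

/-- Van der Corput type estimate for the sawtooth function along `Y ^ 3 / (n + α) + β`. -/
lemma abs_sum_fract_sub_half_le_s12 {Y α β : ℝ} (hY : 1 ≤ Y) (hα0 : 0 ≤ α) (hα1 : α ≤ 1) (K : ℕ)
    (hK : 17 * (K : ℝ) ≤ Y ^ 2) :
    |∑ n ∈ Icc 1 K, (Int.fract (Y ^ 3 / (n + α) + β) - 1 / 2)|
      ≤ (Nat.log 2 K + 1) * (2000 * Y * (1 + Real.log Y)) := by
  have hlogY := Real.log_nonneg hY
  have hE : 2000 ≤ 2000 * Y * (1 + Real.log Y) := by nlinarith [mul_nonneg (by linarith : 0 ≤ Y) hlogY]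
  induction K using Nat.strong_induction_on with
  | _ K ih =>
    rcases lt_or_ge K 2 with hK2 | hK2
    · have h1 : |∑ n ∈ Icc 1 K, (Int.fract (Y ^ 3 / ((n : ℝ) + α) + β) - 1 / 2)|
          ≤ ∑ n ∈ Icc 1 K, (1 : ℝ) := by
        refine (Finset.abs_sum_le_sum_abs _ _).trans (Finset.sum_le_sum fun n _ => ?_)
        have h0 := Int.fract_nonneg (Y ^ 3 / ((n : ℝ) + α) + β)
        have h1 := Int.fract_lt_one (Y ^ 3 / ((n : ℝ) + α) + β)
        rw [abs_le]; constructor <;> linarith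
      have h2 : ∑ n ∈ Icc 1 K, (1 : ℝ) ≤ 1 := by
        simp only [sum_const, Nat.card_Icc, nsmul_eq_mul, mul_one]
        exact_mod_cast (by omega : K + 1 - 1 ≤ 1)
      have h3 : (0 : ℝ) ≤ Nat.log 2 K := Nat.cast_nonneg _
      nlinarith
    · have hhalf : ((K / 2 : ℕ) : ℝ) ≤ K := by exact_mod_cast Nat.div_le_self K 2
      have h1 := ih (K / 2) (by omega) (by linarith)
      have h2 := abs_sum_Ico_fract_le (β := β) (N := K / 2) (B := K + 1) hY hα0 hα1 (by omega)
        (by linarith) (by omega)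
      have hlog : (Nat.log 2 K : ℝ) = Nat.log 2 (K / 2) + 1 := by
        rw [Nat.log_of_one_lt_of_le (by norm_num) hK2]; push_cast; ring
      have hs : ∑ n ∈ Icc 1 K, (Int.fract (Y ^ 3 / ((n : ℝ) + α) + β) - 1 / 2) =
          ∑ n ∈ Icc 1 (K / 2), (Int.fract (Y ^ 3 / ((n : ℝ) + α) + β) - 1 / 2) +
          ∑ n ∈ Ico (K / 2 + 1) (K + 1), (Int.fract (Y ^ 3 / ((n : ℝ) + α) + β) - 1 / 2) := by
        rw [← Finset.Ico_add_one_right_eq_Icc, ← Finset.Ico_add_one_right_eq_Icc]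
        exact (Finset.sum_Ico_consecutive _ (by omega) (by omega)).symm
      rw [hs, hlog]
      refine (abs_add_le _ _).trans ?_
      linarith

/-- The divisor bound `d(n) ≪ n ^ ε`. -/
lemma exists_card_divisors_le_rpow (ε : ℝ) (hε : 0 < ε) :
    ∃ C : ℝ, 1 ≤ C ∧ ∀ n : ℕ, n ≠ 0 → (#n.divisors : ℝ) ≤ C * (n : ℝ) ^ ε := by
  set A : ℝ := 1 + 1 / (ε * Real.log 2) with hA
  have hl2 : 0 < Real.log 2 := Real.log_pos (by norm_num)
  have hA1 : 1 ≤ A := by rw [hA]; have : 0 < 1 / (ε * Real.log 2) := by positivity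
                         linarith
  obtain ⟨P, hP⟩ := exists_nat_ge ((2 : ℝ) ^ (1 / ε))
  refine ⟨A ^ P, one_le_pow₀ hA1, fun n hn => ?_⟩
  have hlocal : ∀ p ∈ n.primeFactors, ((n.factorization p + 1 : ℕ) : ℝ) ≤
      (if p < P then A else 1) * ((p : ℝ) ^ n.factorization p) ^ ε := by
    intro p hp
    have hp2 : 2 ≤ p := (Nat.prime_of_mem_primeFactors hp).two_le
    have hp2' : (2 : ℝ) ≤ p := by exact_mod_cast hp2
    set a := n.factorization p
    have hpa : ((p : ℝ) ^ a) ^ ε = ((p : ℝ) ^ ε) ^ a := by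
      rw [← Real.rpow_natCast, ← Real.rpow_natCast, ← Real.rpow_mul (by positivity),
        ← Real.rpow_mul (by positivity), mul_comm]
    rw [hpa]
    split_ifs with h
    · have h1 : (2 : ℝ) ^ ε ≤ (p : ℝ) ^ ε := Real.rpow_le_rpow (by norm_num) hp2' hε.le
      have h2 : 1 + a * (ε * Real.log 2) ≤ ((2 : ℝ) ^ ε) ^ a := by
        rw [Real.rpow_def_of_pos (by norm_num), ← Real.exp_nat_mul]
        have := Real.add_one_le_exp ((a : ℝ) * (Real.log 2 * ε))
        linarith
      have h3 : ((2 : ℝ) ^ ε) ^ a ≤ ((p : ℝ) ^ ε) ^ a := by gcongr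
      have h4 : (a : ℝ) + 1 ≤ A * (1 + a * (ε * Real.log 2)) := by
        have : A * (1 + a * (ε * Real.log 2)) =
            1 + a + (1 / (ε * Real.log 2) + a * (ε * Real.log 2)) := by
          rw [hA]; field_simp; ring
        rw [this]
        have : 0 ≤ 1 / (ε * Real.log 2) + a * (ε * Real.log 2) := by positivity
        linarith
      push_cast
      calc (a : ℝ) + 1 ≤ A * (1 + a * (ε * Real.log 2)) := h4
        _ ≤ A * ((p : ℝ) ^ ε) ^ a := by gcongr; linarith
    · push Not at h
      have h1 : (2 : ℝ) ≤ (p : ℝ) ^ ε := by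
        calc (2 : ℝ) = ((2 : ℝ) ^ (1 / ε)) ^ ε := by
              rw [← Real.rpow_mul (by norm_num)]; field_simp; simp
          _ ≤ (p : ℝ) ^ ε := by
              gcongr
              exact hP.trans (by exact_mod_cast h)
      rw [one_mul]
      calc ((a + 1 : ℕ) : ℝ) ≤ ((2 ^ a : ℕ) : ℝ) := by exact_mod_cast Nat.lt_two_pow_self
        _ = (2 : ℝ) ^ a := by push_cast; rfl
        _ ≤ _ := by gcongr
  have hprod : ∏ p ∈ n.primeFactors, ((p : ℝ) ^ n.factorization p) ^ ε = (n : ℝ) ^ ε := by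
    rw [Real.finsetProd_rpow _ _ fun p _ => by positivity]
    congr 1
    have := Nat.prod_factorization_pow_eq_self hn
    conv_rhs => rw [← this]
    rw [Finsupp.prod, Nat.support_factorization]; push_cast; rfl
  rw [Nat.card_divisors hn]
  push_cast
  calc ∏ p ∈ n.primeFactors, ((n.factorization p : ℝ) + 1)
      ≤ ∏ p ∈ n.primeFactors, ((if p < P then A else 1) * ((p : ℝ) ^ n.factorization p) ^ ε) :=
        Finset.prod_le_prod (fun _ _ => by positivity)
          fun p hp => by simpa using hlocal p hp
    _ = (∏ p ∈ n.primeFactors, if p < P then A else 1) * (n : ℝ) ^ ε := by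
        rw [Finset.prod_mul_distrib, hprod]
    _ ≤ A ^ P * (n : ℝ) ^ ε := by
        refine mul_le_mul_of_nonneg_right ?_ (by positivity)
        rw [← Finset.prod_filter, Finset.prod_const]
        refine pow_le_pow_right₀ hA1 ?_
        calc _ ≤ #(range P) := Finset.card_le_card fun p hp => by
              simp only [mem_filter] at hp; exact mem_range.2 hp.2
          _ = P := card_range P

lemma sq_dvd_sq_mul_squarefree_iff {m a b : ℕ} (ha : Squarefree a) (hb : b ≠ 0) :
    m ^ 2 ∣ b ^ 2 * a ↔ m ∣ b := by
  refine ⟨fun h => ?_, fun h => (pow_dvd_pow_of_dvd h 2).mul_right a⟩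
  obtain ⟨g, m', b', hg, hc, rfl, rfl⟩ := Nat.exists_coprime' (m := m) (n := b)
    (Nat.gcd_pos_of_pos_right m (Nat.pos_of_ne_zero hb))
  have h1 : m' ^ 2 ∣ b' ^ 2 * a := by
    have : g ^ 2 * m' ^ 2 ∣ g ^ 2 * (b' ^ 2 * a) := by
      rw [mul_pow, mul_pow] at h
      convert h using 1 <;> ring
    exact Nat.dvd_of_mul_dvd_mul_left (by positivity) this
  have h2 : m' ^ 2 ∣ a := (Nat.Coprime.pow 2 2 hc).dvd_of_dvd_mul_left h1
  have h3 : m' = 1 := Nat.isUnit_iff.1 (ha m' (by rwa [← sq]))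
  rw [h3, one_mul]
  exact dvd_mul_left g b'

/-- `μ₂(d) = ∑_{m² ∣ d} μ(m)`. -/
lemma muk_two_eq_sum_moebius {d R : ℕ} (hd : d ≠ 0) (hR : ∀ m, m ^ 2 ∣ d → m ≤ R) :
    muk 2 d = ∑ m ∈ Icc 1 R, (ArithmeticFunction.moebius m : ℝ) * if m ^ 2 ∣ d then 1 else 0 := by
  obtain ⟨a, b, hab, ha⟩ := Nat.sq_mul_squarefree d
  have hb : b ≠ 0 := by rintro rfl; simp at hab; exact hd hab.symm
  have hiff : ∀ m, m ^ 2 ∣ d ↔ m ∣ b := fun m => by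
    rw [← hab]; exact sq_dvd_sq_mul_squarefree_iff ha hb
  have hset : (Icc 1 R).filter (fun m => m ^ 2 ∣ d) = b.divisors := by
    ext m
    simp only [mem_filter, mem_Icc, Nat.mem_divisors, hiff]
    refine ⟨fun h => ⟨h.2, hb⟩, fun h => ⟨⟨Nat.pos_of_dvd_of_pos h.1 (Nat.pos_of_ne_zero hb),
      hR m ((hiff m).2 h.1)⟩, h.1⟩⟩
  simp_rw [mul_ite, mul_one, mul_zero]
  rw [← Finset.sum_filter, hset]
  have hm : ∑ m ∈ b.divisors, ArithmeticFunction.moebius m = if b = 1 then 1 else 0 := by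
    rw [← ArithmeticFunction.coe_mul_zeta_apply, ArithmeticFunction.moebius_mul_coe_zeta,
      ArithmeticFunction.one_apply]
  have hm' : ∑ m ∈ b.divisors, (ArithmeticFunction.moebius m : ℝ) = if b = 1 then 1 else 0 := by
    have := congrArg (Int.cast : ℤ → ℝ) hm
    push_cast at this
    rw [this]
  rw [hm']
  unfold muk
  have : (∀ p : ℕ, p.Prime → ¬ p ^ 2 ∣ d) ↔ b = 1 := by
    simp_rw [hiff]
    exact Nat.eq_one_iff_not_exists_prime_dvd.symm
  simp only [this]

/-- Grouping the `n` with `⌊x / n⌋ = d`. -/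
lemma sum_Ioc_floor_div (F : ℕ → ℝ) {x : ℝ} (hx : 0 ≤ x) (K : ℕ) :
    ∑ n ∈ Ioc ⌊x / (K + 1 : ℕ)⌋₊ ⌊x⌋₊, F ⌊x / n⌋₊ =
      ∑ d ∈ Icc 1 K, F d * ((⌊x / d⌋₊ : ℝ) - ⌊x / (d + 1 : ℕ)⌋₊) := by
  have hanti : ∀ k : ℕ, 1 ≤ k → ⌊x / (k + 1 : ℕ)⌋₊ ≤ ⌊x / k⌋₊ := fun k hk => by
    have : (1 : ℝ) ≤ k := by exact_mod_cast hk
    refine Nat.floor_mono ?_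
    gcongr
    linarith
  induction K with
  | zero => simp
  | succ K ih =>
    have hle : ⌊x / (K + 1 : ℕ)⌋₊ ≤ ⌊x⌋₊ := by
      refine Nat.floor_mono (div_le_self hx ?_)
      push_cast
      linarith [Nat.cast_nonneg (α := ℝ) K]
    have h1 := hanti (K + 1) (by omega)
    rw [Finset.sum_Icc_succ_top (by omega), ← ih, ← Finset.sum_Ioc_consecutive _ h1 hle, add_comm]
    congr 1
    have : ∀ n ∈ Ioc ⌊x / (K + 1 + 1 : ℕ)⌋₊ ⌊x / (K + 1 : ℕ)⌋₊, F ⌊x / n⌋₊ = F (K + 1) := by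
      intro n hn
      rw [mem_Ioc] at hn
      congr 1
      have hn0 : 0 < n := by omega
      have hn0' : (0 : ℝ) < n := by exact_mod_cast hn0
      have h2 := (Nat.floor_lt (by positivity)).1 hn.1
      have h3 := (Nat.le_floor_iff (by positivity)).1 hn.2
      rw [div_lt_iff₀ (by positivity)] at h2
      rw [le_div_iff₀ (by positivity)] at h3
      rw [Nat.floor_eq_iff (by positivity)]
      push_cast at h2 h3 ⊢
      rw [le_div_iff₀ hn0', div_lt_iff₀ hn0']
      constructor <;> linarith
    rw [Finset.sum_congr rfl this, Finset.sum_const, Nat.card_Ioc, nsmul_eq_mul,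
      Nat.cast_sub h1, mul_comm]

lemma tsum_muk_tail (k Z : ℕ) : ∃ θ : ℝ, 0 ≤ θ ∧ θ ≤ 1 / (Z + 1) ∧
    ∑' n : ℕ, muk k (n + 1) / (((n : ℝ) + 1) * ((n : ℝ) + 2)) =
      ∑ d ∈ Icc 1 Z, muk k d * (1 / ((d : ℝ) * (d + 1))) + θ := by
  set g : ℕ → ℝ := fun n => muk k (n + 1) / (((n : ℝ) + 1) * ((n : ℝ) + 2)) with hg
  have hg0 : ∀ n, 0 ≤ g n := fun n => div_nonneg (muk_nonneg _ _) (by positivity)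
  have hpart : ∀ W N : ℕ, ∑ i ∈ range N, g (i + W) ≤ 1 / ((W : ℝ) + 1) - 1 / ((W : ℝ) + N + 1) := by
    intro W N
    induction N with
    | zero => simp
    | succ N ih =>
      rw [Finset.sum_range_succ]
      have h1 : g (N + W) ≤ 1 / ((W : ℝ) + N + 1) - 1 / ((W : ℝ) + (N + 1 : ℕ) + 1) := by
        have e : 1 / ((W : ℝ) + N + 1) - 1 / ((W : ℝ) + (N + 1 : ℕ) + 1) =
            1 / (((N + W : ℕ) + 1 : ℝ) * ((N + W : ℕ) + 2)) := by
          push_cast; field_simp; ring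
        rw [e]
        simp only [hg]
        gcongr
        exact muk_le_one _ _
      linarith
  have hpart' : ∀ W N : ℕ, ∑ i ∈ range N, g (i + W) ≤ 1 / ((W : ℝ) + 1) := fun W N => by
    have : 0 ≤ 1 / ((W : ℝ) + N + 1) := by positivity
    linarith [hpart W N]
  have hs : Summable g := summable_of_sum_range_le hg0 fun N => by simpa using hpart' 0 N
  refine ⟨∑' n, g (n + Z), tsum_nonneg fun n => hg0 _,
    Real.tsum_le_of_sum_range_le (fun n => hg0 _) (hpart' Z), ?_⟩
  rw [← hs.sum_add_tsum_nat_add Z]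
  congr 1
  rw [← Finset.Ico_add_one_right_eq_Icc, Finset.sum_Ico_eq_sum_range]
  refine Finset.sum_congr rfl fun i _ => ?_
  simp only [hg]
  rw [add_comm 1 i]
  push_cast
  rw [mul_one_div]
  ring_nf

/-- Reindexing a sum over multiples of `q`. -/
lemma sum_Ioc_dvd (q K Z : ℕ) (hq : 0 < q) (f : ℕ → ℝ) :
    ∑ d ∈ Ioc K Z, (if q ∣ d then 1 else 0) * f d = ∑ l ∈ Ioc (K / q) (Z / q), f (q * l) := by
  simp_rw [ite_mul, one_mul, zero_mul]
  rw [← Finset.sum_filter]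
  symm
  refine Finset.sum_nbij (fun l => q * l) ?_ ?_ ?_ (fun _ _ => rfl)
  · intro l hl
    rw [mem_Ioc] at hl
    simp only [mem_filter, mem_Ioc]
    refine ⟨⟨?_, ?_⟩, dvd_mul_right q l⟩
    · rw [mul_comm]; exact (Nat.div_lt_iff_lt_mul hq).1 hl.1
    · rw [mul_comm]; exact (Nat.le_div_iff_mul_le hq).1 hl.2
  · intro a _ b _ hab
    exact Nat.eq_of_mul_eq_mul_left hq hab
  · intro d hd
    simp only [coe_filter, mem_Ioc, Set.mem_ofPred_eq] at hd
    obtain ⟨⟨h1, h2⟩, l, rfl⟩ := hd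
    refine ⟨l, ?_, rfl⟩
    simp only [coe_Ioc, Set.mem_Ioc]
    rw [mul_comm] at h1 h2
    exact ⟨(Nat.div_lt_iff_lt_mul hq).2 h1, (Nat.le_div_iff_mul_le hq).2 h2⟩

lemma sum_Icc_dvd (q K : ℕ) (hq : 0 < q) (f : ℕ → ℝ) :
    ∑ d ∈ Icc 1 K, (if q ∣ d then 1 else 0) * f d = ∑ l ∈ Icc 1 (K / q), f (q * l) := by
  have h := sum_Ioc_dvd q 0 K hq f
  rw [Nat.zero_div] at h
  exact h

lemma sum_inv_multiples_lower (q K Z : ℕ) (hq : 0 < q) (hK : 0 < K) (hKZ : K ≤ Z) :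
    1 / ((q : ℝ) * K) - 1 / (K : ℝ) ^ 2 - 1 / ((q : ℝ) * Z) ≤
      ∑ d ∈ Ioc K Z, (if q ∣ d then 1 else 0) * (1 / ((d : ℝ) * (d + 1))) := by
  rw [sum_Ioc_dvd q K Z hq]
  have hq1 : (1 : ℝ) ≤ q := by exact_mod_cast hq
  have hK0 : (0 : ℝ) < K := by exact_mod_cast hK
  have hZ0 : (0 : ℝ) < Z := by exact_mod_cast hK.trans_le hKZ
  set a := K / q with ha
  have hab : a ≤ Z / q := Nat.div_le_div_right hKZ
  have key : ∀ b, a ≤ b → (1 / ((q : ℝ) ^ 2 * (a + 1)) - 1 / ((q : ℝ) ^ 2 * (b + 1))) ≤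
      ∑ l ∈ Ioc a b, 1 / (((q * l : ℕ) : ℝ) * ((q * l : ℕ) + 1)) := by
    intro b hb
    induction b, hb using Nat.le_induction with
    | base => simp
    | succ b hb ih =>
      rw [Finset.sum_Ioc_succ_top hb]
      have e : 1 / ((q : ℝ) ^ 2 * (b + 1)) - 1 / ((q : ℝ) ^ 2 * ((b + 1 : ℕ) + 1)) =
          1 / ((q * (b + 1)) * ((q : ℝ) * (b + 1) + q)) := by
        push_cast; field_simp; ring
      have : 1 / ((q * (b + 1)) * ((q : ℝ) * (b + 1) + q)) ≤
          1 / (((q * (b + 1) : ℕ) : ℝ) * ((q * (b + 1) : ℕ) + 1)) := by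
        push_cast
        gcongr
      linarith
  refine le_trans ?_ (key _ hab)
  have h1 : (q : ℝ) * (a + 1) ≤ K + q := by
    have : q * a ≤ K := Nat.mul_div_le K q
    have : (q : ℝ) * a ≤ K := by exact_mod_cast this
    linarith
  have h2 : (Z : ℝ) ≤ q * ((Z / q : ℕ) + 1) := by
    have := Nat.lt_mul_div_succ Z hq
    exact_mod_cast this.le
  have h3 : 1 / ((q : ℝ) ^ 2 * ((Z / q : ℕ) + 1)) ≤ 1 / (q * Z) := by
    rw [sq, mul_assoc]; gcongr
  have h4 : 1 / ((q : ℝ) * (K + q)) ≤ 1 / ((q : ℝ) ^ 2 * (a + 1)) := by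
    rw [sq, mul_assoc]; gcongr
  have h5 : 1 / ((q : ℝ) * K) - 1 / (q * (K + q)) ≤ 1 / (K : ℝ) ^ 2 := by
    have : 1 / ((q : ℝ) * K) - 1 / (q * (K + q)) = 1 / (K * (K + q)) := by field_simp; ring
    rw [this, sq]
    gcongr
    linarith
  linarith

lemma sum_inv_multiples_upper (q K Z : ℕ) (hq : 0 < q) (hK : 0 < K) :
    ∑ d ∈ Ioc K Z, (if q ∣ d then 1 else 0) * (1 / ((d : ℝ) * (d + 1))) ≤
      1 / ((q : ℝ) * K) + 1 / (K : ℝ) ^ 2 := by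
  rw [sum_Ioc_dvd q K Z hq]
  have hq1 : (1 : ℝ) ≤ q := by exact_mod_cast hq
  have hK0 : (0 : ℝ) < K := by exact_mod_cast hK
  set a := K / q with ha
  have h1 : (K : ℝ) + 1 ≤ q * (a + 1) := by
    have := Nat.lt_mul_div_succ K hq
    exact_mod_cast this
  rcases le_or_gt (Z / q) a with hle | hlt
  · rw [Finset.Ioc_eq_empty (not_lt.2 hle), Finset.sum_empty]; positivity
  have key : ∀ b, a + 1 ≤ b →
      ∑ l ∈ Ioc a b, 1 / (((q * l : ℕ) : ℝ) * ((q * l : ℕ) + 1)) ≤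
      1 / (K : ℝ) ^ 2 + (1 / ((q : ℝ) ^ 2 * (a + 1)) - 1 / ((q : ℝ) ^ 2 * b)) := by
    intro b hb
    induction b, hb using Nat.le_induction with
    | base =>
      rw [Finset.sum_Ioc_succ_top le_rfl, Finset.Ioc_self, Finset.sum_empty]
      push_cast
      rw [sub_self, zero_add, add_zero, sq]
      gcongr <;> linarith
    | succ b hb ih =>
      have hb0 : (0 : ℝ) < b := by exact_mod_cast a.succ_pos.trans_le hb
      rw [Finset.sum_Ioc_succ_top (by omega)]
      have e : 1 / ((q : ℝ) ^ 2 * b) - 1 / ((q : ℝ) ^ 2 * (b + 1 : ℕ)) =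
          1 / ((q * (b + 1)) * ((q : ℝ) * b)) := by
        push_cast; field_simp; ring
      have : 1 / (((q * (b + 1) : ℕ) : ℝ) * ((q * (b + 1) : ℕ) + 1)) ≤
          1 / ((q * (b + 1)) * ((q : ℝ) * b)) := by
        push_cast
        gcongr
        nlinarith
      linarith
  refine (key _ hlt).trans ?_
  have h3 : 0 ≤ 1 / ((q : ℝ) ^ 2 * (Z / q : ℕ)) := by positivity
  have h4 : 1 / ((q : ℝ) ^ 2 * (a + 1)) ≤ 1 / ((q : ℝ) * K) := by
    rw [sq, mul_assoc]; gcongr; linarith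
  linarith

lemma sum_inv_multiples_le (q K Z : ℕ) (hq : 0 < q) (hK : 0 < K) :
    ∑ d ∈ Ioc K Z, (if q ∣ d then 1 else 0) * (1 / ((d : ℝ) * (d + 1))) ≤
      2 / ((q : ℝ) * K) := by
  rw [sum_Ioc_dvd q K Z hq]
  have hq1 : (1 : ℝ) ≤ q := by exact_mod_cast hq
  have hK0 : (0 : ℝ) < K := by exact_mod_cast hK
  set a := K / q with ha
  have h1 : (K : ℝ) + 1 ≤ q * (a + 1) := by
    have := Nat.lt_mul_div_succ K hq
    exact_mod_cast this
  rcases le_or_gt (Z / q) a with hle | hlt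
  · rw [Finset.Ioc_eq_empty (not_lt.2 hle), Finset.sum_empty]; positivity
  have key : ∀ b, a ≤ b →
      ∑ l ∈ Ioc a b, 1 / (((q * l : ℕ) : ℝ) * ((q * l : ℕ) + 1)) ≤
      (2 / ((q : ℝ) ^ 2 * (a + 1)) - 2 / ((q : ℝ) ^ 2 * (b + 1))) := by
    intro b hb
    induction b, hb using Nat.le_induction with
    | base => simp
    | succ b hb ih =>
      rw [Finset.sum_Ioc_succ_top (by omega)]
      have e : 2 / ((q : ℝ) ^ 2 * (b + 1)) - 2 / ((q : ℝ) ^ 2 * ((b + 1 : ℕ) + 1)) =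
          2 / ((q * (b + 1)) * ((q : ℝ) * (b + 2))) := by
        push_cast; field_simp; ring
      have : 1 / (((q * (b + 1) : ℕ) : ℝ) * ((q * (b + 1) : ℕ) + 1)) ≤
          2 / ((q * (b + 1)) * ((q : ℝ) * (b + 2))) := by
        push_cast
        have hb0 : (0 : ℝ) ≤ b := Nat.cast_nonneg b
        rw [div_le_div_iff₀ (by positivity) (by positivity)]
        have : (q : ℝ) * (b + 2) ≤ 2 * (q * (b + 1) + 1) := by nlinarith
        calc _ = (q * ((b : ℝ) + 1)) * (q * (b + 2)) := by ring
          _ ≤ (q * ((b : ℝ) + 1)) * (2 * (q * (b + 1) + 1)) := by gcongr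
          _ = _ := by ring
      linarith
  refine (key _ hlt.le).trans ?_
  have h3 : 0 ≤ 2 / ((q : ℝ) ^ 2 * ((Z / q : ℕ) + 1)) := by positivity
  have h4 : 2 / ((q : ℝ) ^ 2 * (a + 1)) ≤ 2 / ((q : ℝ) * K) := by
    rw [sq, mul_assoc]; gcongr; linarith
  linarith

lemma dvd_floor_indicator {t : ℝ} (ht : 1 ≤ t) {q : ℕ} (hq : 0 < q) :
    (if q ∣ ⌊t⌋₊ then (1 : ℝ) else 0) = 1 / q +
      ((Int.fract (t / q + -(1 / q)) - 1 / 2) - (Int.fract (t / q) - 1 / 2)) := by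
  have hq0 : (0 : ℝ) < q := by exact_mod_cast hq
  have e : t / q + -(1 / q) = (t - 1) / q := by ring
  have f1 : (⌊t / q⌋ : ℝ) = ((⌊t⌋₊ / q : ℕ) : ℝ) := by
    rw [← Nat.floor_div_natCast, natCast_floor_eq_intCast_floor (by positivity)]
  have f2 : (⌊(t - 1) / q⌋ : ℝ) = (((⌊t⌋₊ - 1) / q : ℕ) : ℝ) := by
    rw [← Nat.floor_sub_one, ← Nat.floor_div_natCast, natCast_floor_eq_intCast_floor]
    exact div_nonneg (by linarith) hq0.le
  have h1 : 1 ≤ ⌊t⌋₊ := Nat.le_floor (by exact_mod_cast ht)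
  have h2 := Nat.succ_div (a := ⌊t⌋₊ - 1) (b := q)
  rw [Nat.sub_add_cancel h1] at h2
  rw [e, ← Int.self_sub_floor, ← Int.self_sub_floor, f1, f2, h2]
  push_cast
  ring

/-- Counting `n ≤ Y` with `q ∣ ⌊x / n⌋`. -/
lemma abs_sum_dvd_floor_sub_le {x P : ℝ} {q Y : ℕ} (hq : 0 < q) (hP : 1 ≤ P)
    (hPx : P ^ 3 = x / q) (hY : 17 * (Y : ℝ) ≤ P ^ 2) (hYx : (Y : ℝ) ≤ x) :
    |∑ n ∈ Icc 1 Y, (if q ∣ ⌊x / n⌋₊ then (1 : ℝ) else 0) - Y / q| ≤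
      2 * ((Nat.log 2 Y + 1) * (2000 * P * (1 + Real.log P))) := by
  have e : ∑ n ∈ Icc 1 Y, (if q ∣ ⌊x / n⌋₊ then (1 : ℝ) else 0) - Y / q =
      ∑ n ∈ Icc 1 Y, (Int.fract (P ^ 3 / (n + 0) + -(1 / q)) - 1 / 2) -
      ∑ n ∈ Icc 1 Y, (Int.fract (P ^ 3 / (n + 0) + 0) - 1 / 2) := by
    have h1 : ∀ n ∈ Icc 1 Y, (if q ∣ ⌊x / n⌋₊ then (1 : ℝ) else 0) = 1 / q +
        ((Int.fract (P ^ 3 / (n + 0) + -(1 / q)) - 1 / 2) -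
          (Int.fract (P ^ 3 / (n + 0) + 0) - 1 / 2)) := by
      intro n hn
      rw [mem_Icc] at hn
      have hn0 : (0 : ℝ) < n := by exact_mod_cast hn.1
      have hnY : (n : ℝ) ≤ Y := by exact_mod_cast hn.2
      have hfl : 1 ≤ x / n := by rw [le_div_iff₀ hn0]; linarith
      rw [dvd_floor_indicator hfl hq, hPx, add_zero, add_zero, div_right_comm]
    rw [Finset.sum_congr rfl h1, Finset.sum_add_distrib, Finset.sum_sub_distrib]
    simp only [sum_const, Nat.card_Icc, Nat.add_sub_cancel, nsmul_eq_mul]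
    ring
  rw [e]
  have a1 := abs_sum_fract_sub_half_le_s12 (α := 0) (β := -(1 / q)) hP le_rfl (by norm_num) Y hY
  have a2 := abs_sum_fract_sub_half_le_s12 (α := 0) (β := 0) hP le_rfl (by norm_num) Y hY
  refine (abs_sub _ _).trans ?_
  linarith

lemma abs_sum_multiples_fract_sub_le {x P : ℝ} {q K : ℕ} (hq : 0 < q) (hP : 1 ≤ P)
    (hPx : P ^ 3 = x / q) (hK : 17 * (K : ℝ) ≤ P ^ 2) :
    |∑ d ∈ Icc 1 K, (if q ∣ d then 1 else 0) *
        (Int.fract (x / d) - Int.fract (x / (d + 1 : ℕ)))| ≤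
      2 * ((Nat.log 2 K + 1) * (2000 * P * (1 + Real.log P))) := by
  have hq1 : (1 : ℝ) ≤ q := by exact_mod_cast hq
  rw [sum_Icc_dvd q K hq]
  have hle : K / q ≤ K := Nat.div_le_self K q
  have hle' : ((K / q : ℕ) : ℝ) ≤ K := by exact_mod_cast hle
  have e : ∑ l ∈ Icc 1 (K / q),
        (Int.fract (x / (q * l : ℕ)) - Int.fract (x / (q * l + 1 : ℕ))) =
      ∑ l ∈ Icc 1 (K / q), (Int.fract (P ^ 3 / (l + 0) + 0) - 1 / 2) -
      ∑ l ∈ Icc 1 (K / q), (Int.fract (P ^ 3 / (l + 1 / q) + 0) - 1 / 2) := by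
    rw [← Finset.sum_sub_distrib]
    refine Finset.sum_congr rfl fun l hl => ?_
    rw [hPx]
    have hl0 : (0 : ℝ) < l := by exact_mod_cast (mem_Icc.1 hl).1
    have e1 : x / q / (l + 0) + 0 = x / (q * l : ℕ) := by
      push_cast; rw [add_zero, add_zero, div_div]
    have e2 : x / q / (l + 1 / q) + 0 = x / (q * l + 1 : ℕ) := by
      push_cast; rw [add_zero, div_div]; congr 1; field_simp
    rw [e1, e2]; ring
  rw [e]
  have hE : 0 ≤ 2000 * P * (1 + Real.log P) := by
    have := Real.log_nonneg hP
    positivity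
  have hlog : (Nat.log 2 (K / q) : ℝ) ≤ Nat.log 2 K := by
    exact_mod_cast Nat.log_mono_right hle
  have hmono : ((Nat.log 2 (K / q) : ℝ) + 1) * (2000 * P * (1 + Real.log P)) ≤
      (Nat.log 2 K + 1) * (2000 * P * (1 + Real.log P)) := by gcongr
  have a1 := abs_sum_fract_sub_half_le_s12 (α := 0) (β := 0) hP le_rfl (by norm_num) (K / q)
    (by linarith)
  have a2 := abs_sum_fract_sub_half_le_s12 (α := 1 / q) (β := 0) hP (by positivity)
    (by rw [div_le_one (by linarith)]; exact hq1) (K / q) (by linarith)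
  refine (abs_sub _ _).trans ?_
  linarith

/-- Divisor-bound estimate for the number of `n ≤ Y` with `q ∣ ⌊x / n⌋`. -/
lemma sum_dvd_floor_le {x T : ℝ} {q Y : ℕ} (hq : 0 < q) (hYx : (Y : ℝ) ≤ x) (hT0 : 0 ≤ T)
    (hT : ∀ k : ℕ, k ≠ 0 → (k : ℝ) ≤ x → (#k.divisors : ℝ) ≤ T) :
    ∑ n ∈ Icc 1 Y, (if q ∣ ⌊x / n⌋₊ then (1 : ℝ) else 0) ≤ T * (Y / q + 1) := by
  have hq1 : (1 : ℝ) ≤ q := by exact_mod_cast hq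
  have hq0 : (0 : ℝ) < q := by linarith
  have hx : 0 ≤ x := (Nat.cast_nonneg Y).trans hYx
  rw [← Finset.sum_filter, Finset.sum_const, nsmul_eq_mul, mul_one]
  set S := (Icc 1 Y).filter fun n : ℕ => q ∣ ⌊x / n⌋₊ with hS
  set f : ℕ → ℕ := fun n => n * (⌊x / n⌋₊ / q) with hf
  have hfacts : ∀ n ∈ S, f n ≠ 0 ∧ n ∣ f n ∧ (f n : ℝ) * q ≤ x ∧ x - Y ≤ (f n : ℝ) * q := by
    intro n hn
    simp only [hS, mem_filter, mem_Icc] at hn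
    obtain ⟨⟨hn1, hnY⟩, l, hl⟩ := hn
    have hn0 : (0 : ℝ) < n := by exact_mod_cast hn1
    have hnY' : (n : ℝ) ≤ Y := by exact_mod_cast hnY
    have hfl : 1 ≤ ⌊x / n⌋₊ := Nat.le_floor (by
      rw [Nat.cast_one, le_div_iff₀ hn0]; linarith)
    have hl0 : l ≠ 0 := by rintro rfl; omega
    have hfn : f n = n * l := by
      simp only [hf]; rw [hl, Nat.mul_div_cancel_left _ hq]
    have hcast : (f n : ℝ) * q = n * (⌊x / n⌋₊ : ℝ) := by
      rw [hfn, hl]; push_cast; ring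
    have g1 := Nat.floor_le (by positivity : 0 ≤ x / n)
    have g2 := Nat.lt_floor_add_one (x / n)
    rw [le_div_iff₀ hn0] at g1
    rw [div_lt_iff₀ hn0] at g2
    refine ⟨by rw [hfn]; exact mul_ne_zero (by omega) hl0, by rw [hfn]; exact dvd_mul_right n l,
      by rw [hcast]; linarith, by rw [hcast]; linarith⟩
  have himg : (#(S.image f) : ℝ) ≤ Y / q + 1 := by
    refine card_le_add_one_of_sub_le _ _ (by positivity) ?_
    intro m hm n hn _
    obtain ⟨m', hm', rfl⟩ := mem_image.1 hm
    obtain ⟨n', hn', rfl⟩ := mem_image.1 hn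
    rw [le_div_iff₀ hq0, sub_mul]
    linarith [(hfacts m' hm').2.2.2, (hfacts n' hn').2.2.1]
  have hfib : ∀ k ∈ S.image f, #{n ∈ S | f n = k} ≤ ⌊T⌋₊ := by
    intro k hk
    obtain ⟨n', hn', rfl⟩ := mem_image.1 hk
    obtain ⟨h1, -, h3, -⟩ := hfacts n' hn'
    refine Nat.le_floor (le_trans ?_ (hT (f n') h1 ?_))
    · refine Nat.cast_le.2 (Finset.card_le_card fun n hn => ?_)
      simp only [mem_filter] at hn
      rw [Nat.mem_divisors]
      exact ⟨by rw [← hn.2]; exact (hfacts n hn.1).2.1, h1⟩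
    · have : (0 : ℝ) ≤ f n' := Nat.cast_nonneg _
      nlinarith
  have hc := Finset.card_le_mul_card_image S ⌊T⌋₊ hfib
  calc (#S : ℝ) ≤ ⌊T⌋₊ * #(S.image f) := by exact_mod_cast hc
    _ ≤ T * (Y / q + 1) := by
      gcongr
      exact Nat.floor_le hT0

lemma sum_rpow_neg_two_thirds_le (M : ℕ) :
    ∑ m ∈ Icc 1 M, (m : ℝ) ^ (-(2 / 3) : ℝ) ≤ 3 * (M : ℝ) ^ (1 / 3 : ℝ) := by
  induction M with
  | zero => simp
  | succ M ih =>
    rw [Finset.sum_Icc_succ_top (by omega)]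
    set a : ℝ := ((M + 1 : ℕ) : ℝ) ^ (1 / 3 : ℝ) with ha
    set b : ℝ := (M : ℝ) ^ (1 / 3 : ℝ) with hb
    have ha3 : a ^ 3 = M + 1 := by
      rw [ha, ← Real.rpow_natCast, ← Real.rpow_mul (by positivity)]; norm_num
    have hb3 : b ^ 3 = M := by
      rw [hb, ← Real.rpow_natCast, ← Real.rpow_mul (by positivity)]; norm_num
    have ha0 : 0 < a := by positivity
    have hb0 : 0 ≤ b := by positivity
    have hba : b ≤ a := by
      rw [ha, hb]; gcongr; linarith
    have e : ((M + 1 : ℕ) : ℝ) ^ (-(2 / 3) : ℝ) = 1 / a ^ 2 := by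
      rw [ha, ← Real.rpow_natCast, ← Real.rpow_mul (by positivity), one_div,
        ← Real.rpow_neg (by positivity)]; norm_num
    rw [e]
    have : 1 / a ^ 2 ≤ 3 * (a - b) := by
      rw [div_le_iff₀ (by positivity)]
      have h1 : (a - b) * (a ^ 2 + a * b + b ^ 2) = 1 := by
        have : (a - b) * (a ^ 2 + a * b + b ^ 2) = a ^ 3 - b ^ 3 := by ring
        rw [this, ha3, hb3]; ring
      have h2 : a ^ 2 + a * b + b ^ 2 ≤ 3 * a ^ 2 := by nlinarith
      nlinarith [sub_nonneg.2 hba]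
    linarith

/-- Möbius expansion of the error term, with the hyperbola method at `d = ⌊x / n⌋ = K`. -/
lemma abs_sum_muk_floor_sub_le {x : ℝ} {K : ℕ} (hK : 0 < K) (hKx : (K : ℝ) ≤ x)
    (hxK : x < ((K : ℝ) + 1) ^ 2) :
    |∑ n ∈ Icc 1 ⌊x⌋₊, muk 2 ⌊x / (n : ℝ)⌋₊ -
        (∑' n : ℕ, muk 2 (n + 1) / (((n : ℝ) + 1) * ((n : ℝ) + 2))) * x| ≤
      1 + ∑ m ∈ Icc 1 K, |∑ n ∈ Icc 1 ⌊x / (K + 1 : ℕ)⌋₊,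
          (if m ^ 2 ∣ ⌊x / n⌋₊ then (1 : ℝ) else 0) -
        ∑ d ∈ Icc 1 K, (if m ^ 2 ∣ d then 1 else 0) *
          (Int.fract (x / d) - Int.fract (x / (d + 1 : ℕ))) -
        x * ∑ d ∈ Ioc K ⌊x⌋₊, (if m ^ 2 ∣ d then 1 else 0) * (1 / ((d : ℝ) * (d + 1)))| := by
  have hK1 : (1 : ℝ) ≤ K := by exact_mod_cast hK
  have hx1 : 1 ≤ x := hK1.trans hKx
  have hx0 : 0 ≤ x := by linarith
  have hYx : x / (K + 1 : ℕ) ≤ x := div_le_self hx0 (by push_cast; linarith)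
  have hYZ : ⌊x / (K + 1 : ℕ)⌋₊ ≤ ⌊x⌋₊ := Nat.floor_le_floor hYx
  have hKZ : K ≤ ⌊x⌋₊ := Nat.le_floor hKx
  have hexp : ∀ (s : Finset ℕ) (g : ℕ → ℕ) (w : ℕ → ℝ),
      (∀ i ∈ s, g i ≠ 0 ∧ (g i : ℝ) ≤ x) → ∑ i ∈ s, muk 2 (g i) * w i =
        ∑ m ∈ Icc 1 K, (ArithmeticFunction.moebius m : ℝ) *
          ∑ i ∈ s, (if m ^ 2 ∣ g i then 1 else 0) * w i := by
    intro s g w hs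
    simp_rw [Finset.mul_sum]
    rw [Finset.sum_comm]
    refine Finset.sum_congr rfl fun i hi => ?_
    obtain ⟨h0, hx⟩ := hs i hi
    rw [muk_two_eq_sum_moebius h0 (R := K), Finset.sum_mul]
    · exact Finset.sum_congr rfl fun m _ => by ring
    · intro m hm
      have h1 : (m : ℝ) ^ 2 ≤ g i := by
        exact_mod_cast Nat.le_of_dvd (Nat.pos_of_ne_zero h0) hm
      have h2 : (m : ℝ) < K + 1 := by
        refine lt_of_pow_lt_pow_left₀ 2 (by positivity) (by linarith)
      exact Nat.lt_succ_iff.1 (by exact_mod_cast h2)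
  obtain ⟨θ, hθ0, hθ1, hθ⟩ := tsum_muk_tail 2 ⌊x⌋₊
  have hxθ : x * θ ≤ 1 := by
    have h1 := Nat.lt_floor_add_one x
    have h2 : θ * (⌊x⌋₊ + 1) ≤ 1 := by
      rwa [le_div_iff₀ (by positivity)] at hθ1
    nlinarith
  have hS : ∑ n ∈ Icc 1 ⌊x⌋₊, muk 2 ⌊x / (n : ℝ)⌋₊ =
      ∑ n ∈ Icc 1 ⌊x / (K + 1 : ℕ)⌋₊, muk 2 ⌊x / (n : ℝ)⌋₊ * 1 +
      ∑ d ∈ Icc 1 K, muk 2 d * ((⌊x / d⌋₊ : ℝ) - ⌊x / (d + 1 : ℕ)⌋₊) := by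
    rw [← sum_Ioc_floor_div (muk 2) hx0 K]
    simp only [mul_one]
    exact (Finset.sum_Ioc_consecutive _ (Nat.zero_le _) hYZ).symm
  have hC : ∑ d ∈ Icc 1 ⌊x⌋₊, muk 2 d * (1 / ((d : ℝ) * (d + 1))) =
      ∑ d ∈ Icc 1 K, muk 2 d * (1 / ((d : ℝ) * (d + 1))) +
      ∑ d ∈ Ioc K ⌊x⌋₊, muk 2 d * (1 / ((d : ℝ) * (d + 1))) :=
    (Finset.sum_Ioc_consecutive _ (Nat.zero_le _) hKZ).symm
  have hfl : ∑ d ∈ Icc 1 K, muk 2 d * ((⌊x / d⌋₊ : ℝ) - ⌊x / (d + 1 : ℕ)⌋₊) =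
      (∑ d ∈ Icc 1 K, muk 2 d * (1 / ((d : ℝ) * (d + 1)))) * x -
      ∑ d ∈ Icc 1 K, muk 2 d * (Int.fract (x / d) - Int.fract (x / (d + 1 : ℕ))) := by
    rw [Finset.sum_mul, ← Finset.sum_sub_distrib]
    refine Finset.sum_congr rfl fun d hd => ?_
    have hd0 : (0 : ℝ) < d := by exact_mod_cast (mem_Icc.1 hd).1
    rw [natCast_floor_eq_intCast_floor (by positivity),
      natCast_floor_eq_intCast_floor (by positivity), ← Int.self_sub_fract (x / d),
      ← Int.self_sub_fract (x / (d + 1 : ℕ))]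
    have : x / d - x / (d + 1 : ℕ) = 1 / ((d : ℝ) * (d + 1)) * x := by
      push_cast; field_simp; ring
    linear_combination muk 2 d * this
  have e1 := hexp (Icc 1 ⌊x / (K + 1 : ℕ)⌋₊) (fun n => ⌊x / n⌋₊) (fun _ => 1) (by
    intro n hn
    obtain ⟨hn1, hnY⟩ := mem_Icc.1 hn
    have hn0 : (1 : ℝ) ≤ n := by exact_mod_cast hn1
    have hnx : (n : ℝ) ≤ x :=
      ((Nat.le_floor_iff (by positivity)).1 hnY).trans hYx
    constructor
    · rw [Nat.ne_zero_iff_zero_lt, Nat.floor_pos, le_div_iff₀ (by linarith)]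
      linarith
    · exact (Nat.floor_le (by positivity)).trans (div_le_self hx0 hn0))
  have e2 := hexp (Icc 1 K) id
    (fun d => Int.fract (x / d) - Int.fract (x / (d + 1 : ℕ))) (by
    intro d hd
    obtain ⟨h1, h2⟩ := mem_Icc.1 hd
    have : (d : ℝ) ≤ K := by exact_mod_cast h2
    exact ⟨by simp only [id]; omega, this.trans hKx⟩)
  have e3 := hexp (Ioc K ⌊x⌋₊) id (fun d => 1 / ((d : ℝ) * (d + 1))) (by
    intro d hd
    obtain ⟨h1, h2⟩ := mem_Ioc.1 hd
    exact ⟨by simp only [id]; omega, (Nat.le_floor_iff hx0).1 h2⟩)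
  simp only [id, mul_one] at e1 e2 e3
  rw [hS, hfl, hθ, hC]
  simp only [mul_one]
  rw [e1, e2, e3]
  have habs : ∀ m : ℕ, |(ArithmeticFunction.moebius m : ℝ)| ≤ 1 := fun m => by
    exact_mod_cast ArithmeticFunction.abs_moebius_le_one
  set A := fun m : ℕ => ∑ n ∈ Icc 1 ⌊x / (K + 1 : ℕ)⌋₊,
    (if m ^ 2 ∣ ⌊x / n⌋₊ then (1 : ℝ) else 0) with hA
  set B := fun m : ℕ => ∑ d ∈ Icc 1 K, (if m ^ 2 ∣ d then 1 else 0) *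
    (Int.fract (x / d) - Int.fract (x / (d + 1 : ℕ))) with hB
  set D := fun m : ℕ => ∑ d ∈ Ioc K ⌊x⌋₊, (if m ^ 2 ∣ d then 1 else 0) *
    (1 / ((d : ℝ) * (d + 1))) with hD
  set Q := ∑ d ∈ Icc 1 K, muk 2 d * (1 / ((d : ℝ) * (d + 1))) with hQ
  have e : ∑ m ∈ Icc 1 K, (ArithmeticFunction.moebius m : ℝ) * A m +
      (Q * x - ∑ m ∈ Icc 1 K, (ArithmeticFunction.moebius m : ℝ) * B m) -
      (Q + ∑ m ∈ Icc 1 K, (ArithmeticFunction.moebius m : ℝ) * D m + θ) * x =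
      -(x * θ) + ∑ m ∈ Icc 1 K, (ArithmeticFunction.moebius m : ℝ) *
        (A m - B m - x * D m) := by
    have : ∑ m ∈ Icc 1 K, (ArithmeticFunction.moebius m : ℝ) * (A m - B m - x * D m) =
        ∑ m ∈ Icc 1 K, (ArithmeticFunction.moebius m : ℝ) * A m -
        ∑ m ∈ Icc 1 K, (ArithmeticFunction.moebius m : ℝ) * B m -
        (∑ m ∈ Icc 1 K, (ArithmeticFunction.moebius m : ℝ) * D m) * x := by
      rw [Finset.sum_mul, ← Finset.sum_sub_distrib, ← Finset.sum_sub_distrib]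
      exact Finset.sum_congr rfl fun m _ => by ring
    rw [this]; ring
  rw [e]
  refine (abs_add_le _ _).trans (add_le_add ?_ ((Finset.abs_sum_le_sum_abs _ _).trans
    (Finset.sum_le_sum fun m _ => ?_)))
  · rw [abs_neg, abs_of_nonneg (by positivity)]
    exact hxθ
  · rw [abs_mul]
    exact mul_le_of_le_one_left (abs_nonneg _) (habs m)

/-- Pairs `(m, n)` with `m > V` and `m² ∣ ⌊x / n⌋`. -/
lemma sum_Ioc_sum_sq_dvd_floor_le {x T W : ℝ} {V K Y : ℕ} (hYx : (Y : ℝ) ≤ x) (hT0 : 0 ≤ T)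
    (hT : ∀ k : ℕ, k ≠ 0 → (k : ℝ) ≤ x → (#k.divisors : ℝ) ≤ T) (hW0 : 0 ≤ W)
    (hW : x ≤ W * ((V : ℝ) + 1) ^ 2) :
    ∑ m ∈ Ioc V K, ∑ n ∈ Icc 1 Y, (if m ^ 2 ∣ ⌊x / n⌋₊ then (1 : ℝ) else 0) ≤ T * W := by
  have hx : 0 ≤ x := (Nat.cast_nonneg Y).trans hYx
  rw [Finset.sum_comm]
  have h : ∀ n ∈ Icc 1 Y, ∑ m ∈ Ioc V K, (if m ^ 2 ∣ ⌊x / n⌋₊ then (1 : ℝ) else 0) ≤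
      if n ∈ Icc 1 ⌊W⌋₊ then T else 0 := by
    intro n hn
    obtain ⟨hn1, hnY⟩ := mem_Icc.1 hn
    have hn0 : (1 : ℝ) ≤ n := by exact_mod_cast hn1
    have hnY' : (n : ℝ) ≤ Y := by exact_mod_cast hnY
    have hfl : 0 < ⌊x / n⌋₊ := by
      rw [Nat.floor_pos, le_div_iff₀ (by linarith)]; linarith
    have hfx : (⌊x / n⌋₊ : ℝ) ≤ x / n := Nat.floor_le (by positivity)
    rw [← Finset.sum_filter, Finset.sum_const, nsmul_eq_mul, mul_one]
    split_ifs with hnW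
    · refine le_trans ?_ (hT _ hfl.ne' (hfx.trans (div_le_self hx hn0)))
      refine Nat.cast_le.2 (Finset.card_le_card fun m hm => ?_)
      rw [Nat.mem_divisors]
      exact ⟨(dvd_pow_self m two_ne_zero).trans (mem_filter.1 hm).2, hfl.ne'⟩
    · rw [Finset.filter_eq_empty_iff.2]
      · simp
      · intro m hm hdvd
        refine hnW (mem_Icc.2 ⟨hn1, Nat.le_floor ?_⟩)
        have h1 : (V : ℝ) + 1 ≤ m := by exact_mod_cast (mem_Ioc.1 hm).1
        have h2 : (m : ℝ) ^ 2 ≤ ⌊x / n⌋₊ := by exact_mod_cast Nat.le_of_dvd hfl hdvd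
        have h3 : ((V : ℝ) + 1) ^ 2 * n ≤ x := by
          rw [← le_div_iff₀ (by linarith)]
          refine le_trans ?_ (h2.trans hfx)
          gcongr
        have h4 : ((V : ℝ) + 1) ^ 2 * n ≤ ((V : ℝ) + 1) ^ 2 * W := by linarith
        exact le_of_mul_le_mul_left h4 (by positivity)
  refine (Finset.sum_le_sum h).trans ?_
  rw [← Finset.sum_filter, Finset.sum_const, nsmul_eq_mul, mul_comm]
  gcongr
  calc ((#{n ∈ Icc 1 Y | n ∈ Icc 1 ⌊W⌋₊} : ℕ) : ℝ) ≤ (#(Icc 1 ⌊W⌋₊) : ℕ) := by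
        refine Nat.cast_le.2 (Finset.card_le_card fun n hn => (mem_filter.1 hn).2)
    _ = (⌊W⌋₊ : ℝ) := by simp
    _ ≤ W := Nat.floor_le hW0

/-- Contribution of a single small divisor `q`. -/
lemma abs_error_of_small_le {x P : ℝ} {q K : ℕ} (hq : 0 < q) (hK : 0 < K) (hKx : (K : ℝ) ^ 2 ≤ x)
    (hxK : x < ((K : ℝ) + 1) ^ 2) (hP : 1 ≤ P) (hPx : P ^ 3 = x / q)
    (hKP : 17 * ((K : ℝ) + 1) ≤ P ^ 2) :
    |∑ n ∈ Icc 1 ⌊x / (K + 1 : ℕ)⌋₊, (if q ∣ ⌊x / n⌋₊ then (1 : ℝ) else 0) -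
        ∑ d ∈ Icc 1 K, (if q ∣ d then 1 else 0) *
          (Int.fract (x / d) - Int.fract (x / (d + 1 : ℕ))) -
        x * ∑ d ∈ Ioc K ⌊x⌋₊, (if q ∣ d then 1 else 0) * (1 / ((d : ℝ) * (d + 1)))| ≤
      8000 * (1 + Real.log x) ^ 2 * P + 11 := by
  have hK1 : (1 : ℝ) ≤ K := by exact_mod_cast hK
  have hq1 : (1 : ℝ) ≤ q := by exact_mod_cast hq
  have hx1 : 1 ≤ x := by nlinarith
  have hKx' : (K : ℝ) ≤ x := by nlinarith
  set Y := ⌊x / (K + 1 : ℕ)⌋₊ with hY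
  have hYle : (Y : ℝ) ≤ x / (K + 1) := by
    have := Nat.floor_le (show 0 ≤ x / (K + 1 : ℕ) by positivity)
    exact_mod_cast this
  have hYlt : x / (K + 1) < Y + 1 := by
    have := Nat.lt_floor_add_one (x / (K + 1 : ℕ))
    exact_mod_cast this
  have hYK1 : (Y : ℝ) ≤ K + 1 := hYle.trans (by
    rw [div_le_iff₀ (by positivity)]; nlinarith)
  have hYx : (Y : ℝ) ≤ x := hYle.trans (div_le_self (by linarith) (by linarith))
  have hYK : Y ≤ K := by
    have h : x / (K + 1) < K + 1 := by rw [div_lt_iff₀ (by positivity)]; nlinarith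
    exact Nat.lt_succ_iff.1 (by exact_mod_cast hYle.trans_lt h)
  have hlogx : 0 ≤ Real.log x := Real.log_nonneg hx1
  have hlogK : (Nat.log 2 K : ℝ) + 1 ≤ 1 + Real.log x := by
    have h1 : (2 : ℝ) ^ Nat.log 2 K ≤ K := by exact_mod_cast Nat.pow_log_le_self 2 hK.ne'
    have h3 := Real.log_le_log (by positivity) h1
    rw [Real.log_pow] at h3
    have h4 := Real.log_le_log (by positivity) hKx
    rw [Real.log_pow] at h4
    have h5 := Real.log_two_gt_d9
    have h6 : (0 : ℝ) ≤ Nat.log 2 K := Nat.cast_nonneg _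
    push_cast at h4
    nlinarith
  have hlogY : (Nat.log 2 Y : ℝ) + 1 ≤ 1 + Real.log x := by
    have : (Nat.log 2 Y : ℝ) ≤ Nat.log 2 K := by exact_mod_cast Nat.log_mono_right hYK
    linarith
  have hlogP0 : 0 ≤ Real.log P := Real.log_nonneg hP
  have hlogP : 1 + Real.log P ≤ 1 + Real.log x := by
    have h1 : P ≤ x := by
      calc P ≤ P ^ 3 := le_self_pow₀ hP (by norm_num)
        _ = x / q := hPx
        _ ≤ x := div_le_self (by linarith) hq1
    linarith [Real.log_le_log (by linarith) h1]
  have hmain : ∀ N : ℕ, (Nat.log 2 N : ℝ) + 1 ≤ 1 + Real.log x →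
      2 * ((Nat.log 2 N + 1) * (2000 * P * (1 + Real.log P))) ≤
      4000 * (1 + Real.log x) ^ 2 * P := by
    intro N hN
    calc 2 * ((Nat.log 2 N + 1) * (2000 * P * (1 + Real.log P)))
        ≤ 2 * ((1 + Real.log x) * (2000 * P * (1 + Real.log x))) := by gcongr
      _ = _ := by ring
  have b1 := (abs_sum_dvd_floor_sub_le hq hP hPx (Y := Y) (by linarith) hYx).trans
    (hmain Y hlogY)
  have b2 := (abs_sum_multiples_fract_sub_le hq hP hPx (K := K) (by linarith)).trans
    (hmain K hlogK)
  have hKZ : K ≤ ⌊x⌋₊ := Nat.le_floor hKx'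
  have c1 := sum_inv_multiples_upper q K ⌊x⌋₊ hq hK
  have c2 := sum_inv_multiples_lower q K ⌊x⌋₊ hq hK hKZ
  set D := ∑ d ∈ Ioc K ⌊x⌋₊, (if q ∣ d then 1 else 0) * (1 / ((d : ℝ) * (d + 1))) with hD
  have hxK2 : x / (K : ℝ) ^ 2 ≤ 4 := by
    rw [div_le_iff₀ (by positivity)]; nlinarith
  have hxZ : x * (1 / ((q : ℝ) * ⌊x⌋₊)) ≤ 2 := by
    have h1 := Nat.lt_floor_add_one x
    have h2 : (1 : ℝ) ≤ ⌊x⌋₊ := by exact_mod_cast hK.trans_le hKZ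
    rw [mul_one_div, div_le_iff₀ (by positivity)]
    nlinarith
  have hYq : |(Y : ℝ) / q - x * (1 / (q * K))| ≤ 5 := by
    have e : (Y : ℝ) / q - x * (1 / (q * K)) = (Y - x / K) / q := by field_simp
    have h1 : x / (K + 1) ≤ x / K := by gcongr; linarith
    have h2 : x / K - x / (K + 1) ≤ x / (K : ℝ) ^ 2 := by
      have : x / K - x / (K + 1) = x / (K * (K + 1)) := by field_simp; ring
      rw [this, sq]; gcongr; linarith
    have h3 : |(Y : ℝ) - x / K| ≤ 5 := by rw [abs_le]; constructor <;> linarith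
    rw [e, abs_div, abs_of_pos (by linarith : (0 : ℝ) < q)]
    exact (div_le_self (abs_nonneg _) hq1).trans h3
  have c1' := mul_le_mul_of_nonneg_left c1 (by linarith : 0 ≤ x)
  have c2' := mul_le_mul_of_nonneg_left c2 (by linarith : 0 ≤ x)
  have e1 : x * (1 / ((q : ℝ) * K) + 1 / (K : ℝ) ^ 2) =
      x * (1 / ((q : ℝ) * K)) + x / (K : ℝ) ^ 2 := by ring
  have e2 : x * (1 / ((q : ℝ) * K) - 1 / (K : ℝ) ^ 2 - 1 / ((q : ℝ) * ⌊x⌋₊)) =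
      x * (1 / ((q : ℝ) * K)) - x / (K : ℝ) ^ 2 - x * (1 / ((q : ℝ) * ⌊x⌋₊)) := by ring
  rw [e1] at c1'
  rw [e2] at c2'
  rw [abs_le] at b1 b2 hYq ⊢
  constructor <;> linarith [b1.1, b1.2, b2.1, b2.2, hYq.1, hYq.2]

/-- Contribution of a single large divisor `q`. -/
lemma abs_error_of_large_le {x : ℝ} {q K : ℕ} (hq : 0 < q) (hK : 0 < K)
    (hxK : x < ((K : ℝ) + 1) ^ 2) (hx : 0 ≤ x) :
    |∑ n ∈ Icc 1 ⌊x / (K + 1 : ℕ)⌋₊, (if q ∣ ⌊x / n⌋₊ then (1 : ℝ) else 0) -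
        ∑ d ∈ Icc 1 K, (if q ∣ d then 1 else 0) *
          (Int.fract (x / d) - Int.fract (x / (d + 1 : ℕ))) -
        x * ∑ d ∈ Ioc K ⌊x⌋₊, (if q ∣ d then 1 else 0) * (1 / ((d : ℝ) * (d + 1)))| ≤
      ∑ n ∈ Icc 1 ⌊x / (K + 1 : ℕ)⌋₊, (if q ∣ ⌊x / n⌋₊ then (1 : ℝ) else 0) +
        9 * K * ((q : ℝ))⁻¹ := by
  have hK1 : (1 : ℝ) ≤ K := by exact_mod_cast hK
  have hq0 : (0 : ℝ) < q := by exact_mod_cast hq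
  have h1 : |∑ d ∈ Icc 1 K, (if q ∣ d then 1 else 0) *
      (Int.fract (x / d) - Int.fract (x / (d + 1 : ℕ)))| ≤ K * (q : ℝ)⁻¹ := by
    rw [sum_Icc_dvd q K hq]
    refine (Finset.abs_sum_le_sum_abs _ _).trans ?_
    calc ∑ l ∈ Icc 1 (K / q), |Int.fract (x / (q * l : ℕ)) - Int.fract (x / (q * l + 1 : ℕ))|
        ≤ ∑ l ∈ Icc 1 (K / q), (1 : ℝ) := Finset.sum_le_sum fun l _ => by
          rw [abs_le]
          constructor <;> linarith [Int.fract_nonneg (x / (q * l : ℕ)),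
            Int.fract_lt_one (x / (q * l : ℕ)), Int.fract_nonneg (x / (q * l + 1 : ℕ)),
            Int.fract_lt_one (x / (q * l + 1 : ℕ))]
      _ = (K / q : ℕ) := by simp
      _ ≤ K / q := Nat.cast_div_le
      _ = _ := div_eq_mul_inv _ _
  have h2 := sum_inv_multiples_le q K ⌊x⌋₊ hq hK
  have h3 : 0 ≤ ∑ d ∈ Ioc K ⌊x⌋₊, (if q ∣ d then 1 else 0) * (1 / ((d : ℝ) * (d + 1))) :=
    Finset.sum_nonneg fun d _ => by split_ifs <;> positivity
  have h4 : 0 ≤ ∑ n ∈ Icc 1 ⌊x / (K + 1 : ℕ)⌋₊, (if q ∣ ⌊x / n⌋₊ then (1 : ℝ) else 0) :=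
    Finset.sum_nonneg fun d _ => by split_ifs <;> positivity
  have h5 : x * (2 / ((q : ℝ) * K)) ≤ 8 * (K * (q : ℝ)⁻¹) := by
    have : x ≤ 4 * (K : ℝ) ^ 2 := by nlinarith
    calc x * (2 / ((q : ℝ) * K)) ≤ (4 * (K : ℝ) ^ 2) * (2 / ((q : ℝ) * K)) := by gcongr
      _ = _ := by field_simp; ring
  have h6 := mul_le_mul_of_nonneg_left h2 hx
  have h7 := mul_nonneg hx h3
  rw [abs_le] at h1 ⊢
  constructor <;> linarith [h1.1, h1.2]

lemma rpow_mul_rpow_bounds {z P : ℝ} {m : ℕ} (hz : 9 ≤ z) (hm : 0 < m) (hmz : (m : ℝ) ≤ z / 9)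
    (hP : P = z ^ (8 / 3 : ℝ) * (m : ℝ) ^ (-(2 / 3) : ℝ)) :
    1 ≤ P ∧ P ^ 3 = z ^ 8 / (m ^ 2 : ℕ) ∧ 18 * z ^ 4 ≤ P ^ 2 := by
  have hz0 : 0 < z := by linarith
  have hm0 : (0 : ℝ) < m := by exact_mod_cast hm
  have hP0 : 0 < P := by rw [hP]; positivity
  have hP3 : P ^ 3 = z ^ 8 / (m ^ 2 : ℕ) := by
    have a1 : (z ^ (8 / 3 : ℝ)) ^ 3 = z ^ 8 := by
      rw [← Real.rpow_natCast, ← Real.rpow_mul hz0.le, ← Real.rpow_natCast z 8]; norm_num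
    have a2 : ((m : ℝ) ^ (-(2 / 3) : ℝ)) ^ 3 = ((m : ℝ) ^ 2)⁻¹ := by
      rw [← Real.rpow_natCast, ← Real.rpow_mul hm0.le, ← Real.rpow_natCast (m : ℝ) 2,
        ← Real.rpow_neg hm0.le]
      norm_num
    rw [hP, mul_pow, a1, a2, div_eq_mul_inv]
    push_cast
    rfl
  have hm2 : (m : ℝ) ^ 2 ≤ z ^ 2 / 81 := by
    calc (m : ℝ) ^ 2 ≤ (z / 9) ^ 2 := by gcongr
      _ = _ := by ring
  have hP3' : 81 * z ^ 6 ≤ P ^ 3 := by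
    rw [hP3, le_div_iff₀ (by positivity)]
    push_cast
    calc 81 * z ^ 6 * (m : ℝ) ^ 2 ≤ 81 * z ^ 6 * (z ^ 2 / 81) := by gcongr
      _ = z ^ 8 := by ring
  have hPz : 18 * z ^ 4 ≤ P ^ 2 := by
    refine le_of_pow_le_pow_left₀ (n := 3) (by norm_num) (by positivity) ?_
    calc (18 * z ^ 4) ^ 3 = 5832 * z ^ 12 := by ring
      _ ≤ 6561 * z ^ 12 := by gcongr; norm_num
      _ = (81 * z ^ 6) ^ 2 := by ring
      _ ≤ (P ^ 3) ^ 2 := by gcongr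
      _ = _ := by ring
  have hz4 : 1 ≤ z ^ 4 := one_le_pow₀ (by linarith)
  exact ⟨(one_le_sq_iff₀ hP0.le).1 (by linarith), hP3, hPz⟩

lemma abs_sum_muk_floor_sub_le_of_card_divisors_le {z T : ℝ} (hz : 9 ≤ z) (hT1 : 0 ≤ T)
    (hT : ∀ k : ℕ, k ≠ 0 → (k : ℝ) ≤ z ^ 8 → (#k.divisors : ℝ) ≤ T) :
    |∑ n ∈ Icc 1 ⌊z ^ 8⌋₊, muk 2 ⌊z ^ 8 / (n : ℝ)⌋₊ -
        (∑' n : ℕ, muk 2 (n + 1) / (((n : ℝ) + 1) * ((n : ℝ) + 2))) * z ^ 8| ≤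
      (25000 * (1 + Real.log (z ^ 8)) ^ 2 + 20 * T) * z ^ 3 := by
  set x := z ^ 8 with hx
  set K := ⌊z ^ 4⌋₊ with hK
  set M := ⌊z / 9⌋₊ with hM
  set V := ⌊z ^ 3⌋₊ with hV
  set L := 1 + Real.log x with hL
  have hz0 : 0 < z := by linarith
  have hx1 : 1 ≤ x := one_le_pow₀ (by linarith)
  have hL1 : 1 ≤ L := by have := Real.log_nonneg hx1; linarith
  have hKle : (K : ℝ) ≤ z ^ 4 := Nat.floor_le (by positivity)
  have hKlt : z ^ 4 < K + 1 := Nat.lt_floor_add_one _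
  have hVle : (V : ℝ) ≤ z ^ 3 := Nat.floor_le (by positivity)
  have hVlt : z ^ 3 < V + 1 := Nat.lt_floor_add_one _
  have hMle : (M : ℝ) ≤ z / 9 := Nat.floor_le (by positivity)
  have hMlt : z / 9 < M + 1 := Nat.lt_floor_add_one _
  have hM0 : 0 < M := Nat.floor_pos.2 (by linarith)
  have hM1 : (1 : ℝ) ≤ M := by exact_mod_cast hM0
  have hz3 : z ≤ z ^ 3 := le_self_pow₀ (by linarith) (by norm_num)
  have hz34 : z ^ 3 ≤ z ^ 4 := pow_le_pow_right₀ (by linarith) (by norm_num)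
  have hz23 : z ^ 2 ≤ z ^ 3 := pow_le_pow_right₀ (by linarith) (by norm_num)
  have hMV : M ≤ V := Nat.floor_le_floor (by linarith)
  have hVK : V ≤ K := Nat.floor_le_floor hz34
  have hK0 : 0 < K := hM0.trans_le (hMV.trans hVK)
  have hK1 : (1 : ℝ) ≤ K := by exact_mod_cast hK0
  have hx4 : x = (z ^ 4) ^ 2 := by rw [hx]; ring
  have hKx2 : (K : ℝ) ^ 2 ≤ x := by rw [hx4]; gcongr
  have hxK : x < ((K : ℝ) + 1) ^ 2 := by rw [hx4]; gcongr
  have hKx : (K : ℝ) ≤ x := by nlinarith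
  refine (abs_sum_muk_floor_sub_le hK0 hKx hxK).trans ?_
  set Y := ⌊x / (K + 1 : ℕ)⌋₊ with hY
  have hYle : (Y : ℝ) ≤ x / (K + 1) := by
    have := Nat.floor_le (show 0 ≤ x / (K + 1 : ℕ) by positivity)
    exact_mod_cast this
  have hYx : (Y : ℝ) ≤ x := hYle.trans (div_le_self (by linarith) (by linarith))
  have hYz : (Y : ℝ) ≤ z ^ 4 := hYle.trans (by
    rw [div_le_iff₀ (by positivity), hx4, sq]; gcongr)
  set A := fun m : ℕ => ∑ n ∈ Icc 1 Y, (if m ^ 2 ∣ ⌊x / n⌋₊ then (1 : ℝ) else 0) with hA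
  set E := fun m : ℕ => |A m - ∑ d ∈ Icc 1 K, (if m ^ 2 ∣ d then 1 else 0) *
          (Int.fract (x / d) - Int.fract (x / (d + 1 : ℕ))) -
        x * ∑ d ∈ Ioc K ⌊x⌋₊, (if m ^ 2 ∣ d then 1 else 0) * (1 / ((d : ℝ) * (d + 1)))| with hE
  have hsplit : ∑ m ∈ Icc 1 K, E m = ∑ m ∈ Icc 1 M, E m + ∑ m ∈ Ioc M K, E m :=
    (Finset.sum_Ioc_consecutive _ (Nat.zero_le _) (hMV.trans hVK)).symm
  have hsmall : ∑ m ∈ Icc 1 M, E m ≤ 24000 * L ^ 2 * z ^ 3 + 2 * z ^ 3 := by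
    have h1 : ∀ m ∈ Icc 1 M, E m ≤
        8000 * L ^ 2 * (z ^ (8 / 3 : ℝ) * (m : ℝ) ^ (-(2 / 3) : ℝ)) + 11 := by
      intro m hm
      obtain ⟨hm1, hmM⟩ := mem_Icc.1 hm
      have hmz : (m : ℝ) ≤ z / 9 := le_trans (by exact_mod_cast hmM) hMle
      obtain ⟨hP1, hP3, hPz⟩ := rpow_mul_rpow_bounds hz hm1 hmz rfl
      have hz4 : 6561 ≤ z ^ 4 := by
        calc (6561 : ℝ) = 9 ^ 4 := by norm_num
          _ ≤ z ^ 4 := by gcongr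
      exact abs_error_of_small_le (q := m ^ 2) (by positivity) hK0 hKx2 hxK hP1 hP3 (by linarith)
    refine (Finset.sum_le_sum h1).trans ?_
    rw [Finset.sum_add_distrib, ← Finset.mul_sum, ← Finset.mul_sum]
    simp only [sum_const, Nat.card_Icc, Nat.add_sub_cancel, nsmul_eq_mul]
    have h2 : z ^ (8 / 3 : ℝ) * ∑ m ∈ Icc 1 M, (m : ℝ) ^ (-(2 / 3) : ℝ) ≤ 3 * z ^ 3 := by
      calc z ^ (8 / 3 : ℝ) * ∑ m ∈ Icc 1 M, (m : ℝ) ^ (-(2 / 3) : ℝ)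
          ≤ z ^ (8 / 3 : ℝ) * (3 * (M : ℝ) ^ (1 / 3 : ℝ)) := by
            gcongr; exact sum_rpow_neg_two_thirds_le M
        _ ≤ z ^ (8 / 3 : ℝ) * (3 * z ^ (1 / 3 : ℝ)) := by gcongr; linarith
        _ = 3 * (z ^ (8 / 3 : ℝ) * z ^ (1 / 3 : ℝ)) := by ring
        _ = 3 * z ^ 3 := by
          rw [← Real.rpow_add hz0, ← Real.rpow_natCast z 3]; norm_num
    have h3 : 8000 * L ^ 2 * (z ^ (8 / 3 : ℝ) * ∑ m ∈ Icc 1 M, (m : ℝ) ^ (-(2 / 3) : ℝ)) ≤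
        8000 * L ^ 2 * (3 * z ^ 3) := by gcongr
    linarith
  have hlarge : ∀ m ∈ Ioc M K, E m ≤ A m + 9 * z ^ 4 * ((m : ℝ) ^ 2)⁻¹ := by
    intro m hm
    have hm0 : 0 < m := by have := (mem_Ioc.1 hm).1; omega
    have h := abs_error_of_large_le (q := m ^ 2) (by positivity) hK0 hxK (by linarith)
    refine h.trans (add_le_add le_rfl ?_)
    push_cast
    gcongr
  have hinv : ∀ N, M ≤ N → ∑ m ∈ Ioc M N, ((m : ℝ) ^ 2)⁻¹ ≤ 18 / z := by
    intro N hN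
    have h := sum_Ioc_inv_sq_le_sub (α := ℝ) hM0.ne' hN
    have h1 : (0 : ℝ) ≤ (N : ℝ)⁻¹ := by positivity
    have h2 : (M : ℝ)⁻¹ ≤ 18 / z := by
      rw [inv_eq_one_div, div_le_div_iff₀ (by positivity) hz0]; linarith
    linarith
  have hz418 : z ^ 4 * (18 / z) = 18 * z ^ 3 := by field_simp
  have hmid : ∑ m ∈ Ioc M V, A m ≤ 19 * T * z ^ 3 := by
    have h1 : ∀ m ∈ Ioc M V, A m ≤ T * (z ^ 4 * ((m : ℝ) ^ 2)⁻¹ + 1) := by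
      intro m hm
      have hm0 : 0 < m := by have := (mem_Ioc.1 hm).1; omega
      refine (sum_dvd_floor_le (q := m ^ 2) (by positivity) hYx hT1 hT).trans ?_
      rw [div_eq_mul_inv]
      push_cast
      gcongr
    refine (Finset.sum_le_sum h1).trans ?_
    rw [← Finset.mul_sum, Finset.sum_add_distrib, ← Finset.mul_sum]
    have h2 : z ^ 4 * ∑ m ∈ Ioc M V, ((m : ℝ) ^ 2)⁻¹ ≤ z ^ 4 * (18 / z) := by
      gcongr; exact hinv V hMV
    have h3 : ∑ m ∈ Ioc M V, (1 : ℝ) ≤ V := by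
      simp only [sum_const, Nat.card_Ioc, nsmul_eq_mul, mul_one]
      exact_mod_cast Nat.sub_le V M
    have h4 : z ^ 4 * ∑ m ∈ Ioc M V, ((m : ℝ) ^ 2)⁻¹ + ∑ m ∈ Ioc M V, (1 : ℝ) ≤ 19 * z ^ 3 := by
      linarith
    calc _ ≤ T * (19 * z ^ 3) := by gcongr
      _ = _ := by ring
  have htop : ∑ m ∈ Ioc V K, A m ≤ T * z ^ 3 := by
    refine (sum_Ioc_sum_sq_dvd_floor_le hYx hT1 hT (W := z ^ 2) (by positivity) ?_).trans
      (by gcongr)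
    calc x = z ^ 2 * (z ^ 3) ^ 2 := by rw [hx]; ring
      _ ≤ z ^ 2 * ((V : ℝ) + 1) ^ 2 := by gcongr
  have hAsplit : ∑ m ∈ Ioc M K, A m = ∑ m ∈ Ioc M V, A m + ∑ m ∈ Ioc V K, A m :=
    (Finset.sum_Ioc_consecutive _ hMV hVK).symm
  have hbig : ∑ m ∈ Ioc M K, E m ≤ 20 * T * z ^ 3 + 162 * z ^ 3 := by
    refine (Finset.sum_le_sum hlarge).trans ?_
    rw [Finset.sum_add_distrib, ← Finset.mul_sum, hAsplit]
    have h2 : 9 * z ^ 4 * ∑ m ∈ Ioc M K, ((m : ℝ) ^ 2)⁻¹ ≤ 9 * z ^ 4 * (18 / z) := by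
      gcongr; exact hinv K (hMV.trans hVK)
    linarith
  rw [hsplit]
  have hL2 : 1 * z ^ 3 ≤ L ^ 2 * z ^ 3 := by gcongr; exact one_le_pow₀ hL1
  linarith

/-- With `μ₂` the indicator of squarefree numbers, for every `ε > 0`,
`∑_{n ≤ x} μ₂(⌊x/n⌋) = C x + O_ε(x^{152/401+ε})` as `x → ∞`, where
`C = ∑_{n=1}^∞ μ₂(n)/(n(n+1))`. -/
theorem squarefree_floor_sum_asymptotic_eps :
    ∀ ε : ℝ, 0 < ε →
      (fun x : ℝ => (∑ n ∈ Finset.Icc 1 ⌊x⌋₊, muk 2 ⌊x / (n : ℝ)⌋₊) -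
          (∑' n : ℕ, muk 2 (n + 1) / (((n : ℝ) + 1) * ((n : ℝ) + 2))) * x)
        =O[atTop] fun x : ℝ => x ^ ((152 : ℝ) / 401 + ε) := by
  intro ε hε
  obtain ⟨C, hC1, hC⟩ := exists_card_divisors_le_rpow ε hε
  have hlog : (fun x : ℝ => 1 + Real.log x) =o[atTop] fun x => x ^ ((1 : ℝ) / 1000) := by
    refine IsLittleO.add ?_ (isLittleO_log_rpow_atTop (by norm_num))
    exact (isLittleO_const_left.2 (Or.inr (tendsto_norm_atTop_atTop.comp
      (tendsto_rpow_atTop (by norm_num)))))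
  refine IsBigO.of_bound (25000 + 20 * C) ?_
  filter_upwards [hlog.bound one_pos, eventually_ge_atTop ((9 : ℝ) ^ 8)] with x hx1 hx9
  have hx0 : 0 < x := lt_of_lt_of_le (by norm_num) hx9
  have hx1' : 1 ≤ x := le_trans (by norm_num) hx9
  have hL0 : 0 ≤ 1 + Real.log x := by linarith [Real.log_nonneg hx1']
  rw [one_mul, Real.norm_of_nonneg hL0, Real.norm_of_nonneg (by positivity)] at hx1
  set z := x ^ (1 / 8 : ℝ) with hz
  have hz8 : z ^ 8 = x := by
    rw [hz, ← Real.rpow_natCast, ← Real.rpow_mul hx0.le]; norm_num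
  have hz3 : z ^ 3 = x ^ (3 / 8 : ℝ) := by
    rw [hz, ← Real.rpow_natCast, ← Real.rpow_mul hx0.le]; norm_num
  have hz9 : 9 ≤ z := by
    refine le_of_pow_le_pow_left₀ (n := 8) (by norm_num) (by positivity) ?_
    rwa [hz8]
  have h := abs_sum_muk_floor_sub_le_of_card_divisors_le (T := C * x ^ ε) hz9 (by positivity) (by
    intro k hk hkx
    rw [hz8] at hkx
    refine (hC k hk).trans ?_
    gcongr)
  rw [hz8, hz3] at h
  rw [Real.norm_eq_abs, Real.norm_of_nonneg (by positivity)]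
  refine h.trans ?_
  have h1 : (1 + Real.log x) ^ 2 * x ^ (3 / 8 : ℝ) ≤ x ^ ((152 : ℝ) / 401 + ε) := by
    calc (1 + Real.log x) ^ 2 * x ^ (3 / 8 : ℝ)
        ≤ (x ^ ((1 : ℝ) / 1000)) ^ 2 * x ^ (3 / 8 : ℝ) := by gcongr
      _ = x ^ ((1 : ℝ) / 500 + 3 / 8) := by
        rw [← Real.rpow_natCast, ← Real.rpow_mul hx0.le, ← Real.rpow_add hx0]; norm_num
      _ ≤ _ := Real.rpow_le_rpow_of_exponent_le hx1' (by linarith)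
  have h2 : x ^ ε * x ^ (3 / 8 : ℝ) ≤ x ^ ((152 : ℝ) / 401 + ε) := by
    rw [← Real.rpow_add hx0]
    exact Real.rpow_le_rpow_of_exponent_le hx1' (by linarith)
  calc (25000 * (1 + Real.log x) ^ 2 + 20 * (C * x ^ ε)) * x ^ (3 / 8 : ℝ)
      = 25000 * ((1 + Real.log x) ^ 2 * x ^ (3 / 8 : ℝ)) +
        20 * C * (x ^ ε * x ^ (3 / 8 : ℝ)) := by ring
    _ ≤ 25000 * x ^ ((152 : ℝ) / 401 + ε) + 20 * C * x ^ ((152 : ℝ) / 401 + ε) := by gcongr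
    _ = _ := by ring
end
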